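/- arXiv:math/0703893 — 3 statements merged into one kernel-verified Lean document; each statement's English description precedes it below -/
import Mathlib

section
/- Write 𝕋_{k,0} = lim_{u→∞} 𝕋_k(u) and 𝕋_{k,1} = lim_{u→∞} u(𝕋_k(u) − 𝕋_{k,0}) in End(M[m]) for k = 1,…,N (these limits exist). Then: (i) each 𝕋_{k,0} and 𝕋_{k,1} is a scalar operator, and for every x ∈ ℂ, x^N + Σ_{k=1}^N (−1)^k 𝕋_{k,0} x^{N−k} = ∏_{i=1}^N (x − Q_i) · Id and Σ_{k=1}^N (−1)^k 𝕋_{k,1} x^{N−k} = − Σ_{j=1}^N m_j Q_j ∏_{i≠j} (x − Q_i) · Id; (ii) 𝕋_N(u) = (∏_{i=1}^N Q_i) ∏_{s=1}^n ∏_{i=1}^{N−1} ((u − z_s + Λ^{(s)}_i − i + 1)/(u − z_s − i + 1)) · Id, and for k = 1,…,N−1 the function ∏_{i=1}^k ∏_{s=1}^n (u − z_s − i + 1) · 𝕋_k(u) is an End(M[m])-valued polynomial in u of degree at most nk. -/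
noncomputable section

namespace XXXModel

/-- A vector-valued quasi-exponential: a finite sum of functions
`Q₀^u p(u) = e^{(ln Q₀) u} p(u)` with `Q₀` a nonzero complex number with a fixed choice of
logarithm and `p` a vector-valued polynomial. -/
def IsQE {M : Type*} [AddCommGroup M] [Module ℂ M] (f : ℂ → M) : Prop :=
  ∃ (k d : ℕ) (lam : Fin k → ℂ) (v : Fin k → Fin d → M),
    ∀ u : ℂ, f u = ∑ i : Fin k, ∑ j : Fin d,
      (Complex.exp (lam i * u) * u ^ (j : ℕ)) • v i j

/-- `g` is meromorphic at the point `x`. -/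
def MeromAt (g : ℂ → ℂ) (x : ℂ) : Prop :=
  ∃ k : ℕ, AnalyticAt ℂ (fun z => (z - x) ^ k * g z) x

/-- Linear independence of a family of functions over the field of one-periodic
meromorphic functions on `ℂ`. -/
def IndepPeriodic {M : Type*} [AddCommGroup M] [Module ℂ M] {ι : Type*} [Fintype ι]
    (F : ι → ℂ → M) : Prop :=
  ∀ c : ι → ℂ → ℂ,
    (∀ i x, MeromAt (c i) x) →
    (∀ i x, c i (x + 1) = c i x) →
    (∀ x : ℂ, (∀ i, AnalyticAt ℂ (c i) x) → ∑ i, c i x • F i x = 0) →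
    ∀ i x, AnalyticAt ℂ (c i) x → c i x = 0

variable {N n : ℕ}

/-- Points where the universal difference operator (of order `N`) associated with the
evaluation points `z` is regular. -/
def Good (N : ℕ) {n : ℕ} (z : Fin n → ℂ) (u : ℂ) : Prop :=
  ∀ j : Fin n, ∀ k : ℕ, k < N → u - (k : ℂ) ≠ z j

section Setup

variable (V : Fin n → Type*) [∀ i, AddCommGroup (V i)] [∀ i, Module ℂ (V i)]
  (M : Type*) [AddCommGroup M] [Module ℂ M]
  (E : ∀ i : Fin n, Fin N → Fin N → (V i →ₗ[ℂ] V i))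
  (φ : M ≃ₗ[ℂ] PiTensorProduct ℂ V)

/-- The commutation relations of `gl_N`: `[e_{ab}, e_{cd}] = δ_{bc} e_{ad} − δ_{da} e_{cb}`,
for the operators `E i a b` (the action of `e_{ab}` on the `i`-th factor `V i`). -/
def GlRel : Prop :=
  ∀ (i : Fin n) (a b c d : Fin N),
    E i a b ∘ₗ E i c d - E i c d ∘ₗ E i a b =
      (if b = c then (1 : ℂ) else 0) • E i a d - (if d = a then (1 : ℂ) else 0) • E i c b

/-- Each `V i` is the irreducible finite-dimensional `gl_N`-module with highest weight
`Λ i`: it is generated by a nonzero vector `v` with `e_{ab} v = 0` for `a < b` and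
`e_{aa} v = Λ_a v`. -/
def IsHW (Λ : Fin n → Fin N → ℤ) : Prop :=
  ∀ i : Fin n, ∃ v : V i, v ≠ 0 ∧
    (∀ a b : Fin N, a < b → E i a b v = 0) ∧
    (∀ a : Fin N, E i a a v = (Λ i a : ℂ) • v) ∧
    ∀ W : Submodule ℂ (V i), (∀ a b : Fin N, ∀ x ∈ W, E i a b x ∈ W) → v ∈ W →
      ∀ x : V i, x ∈ W

/-- `e_{ab}` acting in the `j`-th tensor factor of `M ≃ V 1 ⊗ ⋯ ⊗ V n`. -/
def EE (j : Fin n) (a b : Fin N) : Module.End ℂ M :=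
  φ.symm.toLinearMap ∘ₗ
    (PiTensorProduct.map
      (Function.update (fun i : Fin n => (LinearMap.id : V i →ₗ[ℂ] V i)) j (E j a b))) ∘ₗ
    φ.toLinearMap

variable (z : Fin n → ℂ)

/-- The matrix `L^{(j)}(u - z_j)`, with entries `L_{ab} = δ_{ab} + e_{ba}^{(j)}/(u - z_j)`. -/
def Lmat (j : Fin n) (u : ℂ) : Matrix (Fin N) (Fin N) (Module.End ℂ M) :=
  fun a b => (if a = b then 1 else 0) + (u - z j)⁻¹ • EE V M E φ j b a

/-- The Yangian generating series acting on the tensor product of evaluation modules: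
`T(u) = L^{(n)}(u−z_n) ⋯ L^{(1)}(u−z_1)`. -/
def Tmat (u : ℂ) : Matrix (Fin N) (Fin N) (Module.End ℂ M) :=
  ((List.ofFn fun j : Fin n => Lmat V M E φ z j u).reverse).prod

variable (Q : Matrix (Fin N) (Fin N) ℂ)

/-- `X_{ab}(u,τ) = δ_{ab} − ∑_c Q_{ac} T_{cb}(u) τ^{−1}`, acting on `M`-valued functions. -/
def Xop (a b : Fin N) (f : ℂ → M) : ℂ → M :=
  fun u => (if a = b then f u else 0)
    - ∑ c : Fin N, Q a c • (Tmat V M E φ z u c b) (f (u - 1))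

/-- The universal difference operator
`D_{Q,M}(u,τ) = ∑_{σ ∈ S_N} sgn(σ) X_{1σ(1)}(u,τ) ⋯ X_{Nσ(N)}(u,τ)`. -/
def Dop (f : ℂ → M) : ℂ → M :=
  fun u => ∑ σ : Equiv.Perm (Fin N),
    ((Equiv.Perm.sign σ : ℤˣ) : ℤ) •
      (((List.ofFn fun a : Fin N => Xop V M E φ z Q a (σ a)).foldr (· ∘ ·) id) f u)

/-- The weight subspace `M[m]`. -/
def Wt (m : Fin N → ℤ) : Submodule ℂ M :=
  ⨅ a : Fin N, LinearMap.ker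
    ((∑ j : Fin n, EE V M E φ j a a) - (m a : ℂ) • (1 : Module.End ℂ M))

/-- The subspace `sing M[m]` of `gl_N`-singular vectors of weight `m`. -/
def SingWt (m : Fin N → ℤ) : Submodule ℂ M :=
  Wt V M E φ m ⊓ ⨅ a : Fin N, ⨅ b : Fin N, ⨅ _ : a < b,
    LinearMap.ker (∑ j : Fin n, EE V M E φ j a b)

end Setup

end XXXModel

namespace XXXModel

section Abstract

set_option linter.unusedSectionVars false

variable {R : Type*} [Ring R] [Algebra ℂ R]

/-- The row determinant with rows `c`, the `k`-th factor taken from `A k`. -/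
def rd {N : ℕ} (A : Fin N → Matrix (Fin N) (Fin N) R) (c : Fin N → Fin N) : R :=
  ∑ σ : Equiv.Perm (Fin N), ((Equiv.Perm.sign σ : ℤˣ) : ℤ) •
    (List.ofFn fun k => A k (c k) (σ k)).prod

/-- Two consecutive matrices satisfy the Manin relations. -/
def Manin2 {N : ℕ} (A B : Matrix (Fin N) (Fin N) R) : Prop :=
  ∀ a b c d, A a b * B c d + A c b * B a d = A a d * B c b + A c d * B a b

/-- Manin relations between consecutive members of a family. -/
def ManinFam {N : ℕ} (A : Fin N → Matrix (Fin N) (Fin N) R) : Prop :=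
  ∀ i j : Fin N, (j : ℕ) = i + 1 → Manin2 (A i) (A j)

lemma eq_zero_of_eq_neg {x : R} (h : x = -x) : x = 0 := by
  have h2 : (2 : ℂ) • x = 0 := by
    rw [two_smul]; nth_rewrite 2 [h]; simp
  exact (smul_eq_zero.1 h2).resolve_left two_ne_zero

lemma finRange_split (m : ℕ) (i : Fin m) : ∃ l1 l2 : List (Fin (m + 1)),
    List.finRange (m + 1) = l1 ++ i.castSucc :: i.succ :: l2 ∧
    i.castSucc ∉ l1 ∧ i.succ ∉ l1 ∧ i.castSucc ∉ l2 ∧ i.succ ∉ l2 := by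
  have h1 : (i : ℕ) < (List.finRange (m + 1)).length := by simp
  have h2 : (i : ℕ) + 1 < (List.finRange (m + 1)).length := by simp
  have key : List.finRange (m + 1) = (List.finRange (m + 1)).take i ++
      i.castSucc :: i.succ :: (List.finRange (m + 1)).drop (i + 2) := by
    conv_lhs => rw [← List.take_append_drop i (List.finRange (m + 1)),
      List.drop_eq_getElem_cons h1, List.drop_eq_getElem_cons h2]
    congr 2
    · ext; simp
    · congr 1
      ext; simp
  have nd := List.nodup_finRange (m + 1)
  rw [key] at nd
  refine ⟨_, _, key, ?_⟩
  simp only [List.nodup_append, List.nodup_cons, List.mem_cons] at nd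
  grind

lemma prod_ofFn_split (m : ℕ) (i : Fin m) : ∃ l1 l2 : List (Fin (m + 1)),
    (i.castSucc ∉ l1 ∧ i.succ ∉ l1 ∧ i.castSucc ∉ l2 ∧ i.succ ∉ l2) ∧
    ∀ f : Fin (m + 1) → R, (List.ofFn f).prod =
      (l1.map f).prod * (f i.castSucc * f i.succ) * (l2.map f).prod := by
  obtain ⟨l1, l2, h, h'⟩ := finRange_split m i
  refine ⟨l1, l2, h', fun f => ?_⟩
  rw [List.ofFn_eq_map, h]
  simp [mul_assoc]

lemma rd_swap_adj {m : ℕ} (A : Fin (m + 1) → Matrix (Fin (m + 1)) (Fin (m + 1)) R)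
    (hA : ManinFam A) (c : Fin (m + 1) → Fin (m + 1)) (i : Fin m) :
    rd A (c ∘ Equiv.swap i.castSucc i.succ) = - rd A c := by
  set s := Equiv.swap i.castSucc i.succ with hs
  have hne : i.castSucc ≠ i.succ := (Fin.castSucc_lt_succ).ne
  obtain ⟨l1, l2, ⟨h1, h2, h3, h4⟩, hsp⟩ := prod_ofFn_split (R := R) m i
  have hsfix : ∀ k, k ≠ i.castSucc → k ≠ i.succ → s k = k := fun k a b =>
    Equiv.swap_apply_of_ne_of_ne a b
  rw [eq_neg_iff_add_eq_zero]
  set G : Equiv.Perm (Fin (m + 1)) → R := fun σ =>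
    (List.ofFn fun k => A k (c k) (σ k)).prod +
    (List.ofFn fun k => A k ((c ∘ s) k) (σ k)).prod with hG
  have hsum : rd A (c ∘ s) + rd A c = ∑ σ : Equiv.Perm (Fin (m + 1)),
      ((Equiv.Perm.sign σ : ℤˣ) : ℤ) • G σ := by
    rw [rd, rd, ← Finset.sum_add_distrib]
    refine Finset.sum_congr rfl fun σ _ => ?_
    rw [← smul_add]
    congr 1
    exact add_comm _ _
  rw [hsum]
  have hGs : ∀ σ, G (σ * s) = G σ := by
    intro σ
    simp only [hG, hsp]
    have e1 : ∀ l : List (Fin (m + 1)), i.castSucc ∉ l → i.succ ∉ l → ∀ c' : Fin (m + 1) → Fin (m + 1),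
        (l.map fun k => A k (c' k) ((σ * s) k)) = l.map fun k => A k (c' k) (σ k) := by
      intro l ha hb c'
      refine List.map_congr_left fun k hk => ?_
      rw [Equiv.Perm.mul_apply, hsfix k (by rintro rfl; exact ha hk) (by rintro rfl; exact hb hk)]
    have e2 : ∀ l : List (Fin (m + 1)), i.castSucc ∉ l → i.succ ∉ l →
        (l.map fun k => A k ((c ∘ s) k) (σ k)) = l.map fun k => A k (c k) (σ k) := by
      intro l ha hb
      refine List.map_congr_left fun k hk => ?_
      rw [Function.comp, hsfix k (by rintro rfl; exact ha hk) (by rintro rfl; exact hb hk)]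
    rw [e1 l1 h1 h2 c, e1 l1 h1 h2 (c ∘ s), e1 l2 h3 h4 c, e1 l2 h3 h4 (c ∘ s),
      e2 l1 h1 h2, e2 l2 h3 h4, ← add_mul, ← mul_add, ← add_mul, ← mul_add]
    have := hA i.castSucc i.succ (by simp) (c i.castSucc) (σ i.succ) (c i.succ) (σ i.castSucc)
    congr 2
    simp only [Equiv.Perm.mul_apply, Function.comp, hs, Equiv.swap_apply_left,
      Equiv.swap_apply_right]
    exact this
  apply eq_zero_of_eq_neg
  conv_lhs => rw [← Equiv.sum_comp (Equiv.mulRight s)]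
  rw [← Finset.sum_neg_distrib]
  refine Finset.sum_congr rfl fun σ _ => ?_
  rw [Equiv.coe_mulRight, hGs, Equiv.Perm.sign_mul, hs, Equiv.Perm.sign_swap hne]
  simp

lemma rd_perm {N : ℕ} (A : Fin N → Matrix (Fin N) (Fin N) R)
    (hA : ManinFam A) (π : Equiv.Perm (Fin N)) : ∀ (c : Fin N → Fin N),
    rd A (c ∘ π) = ((Equiv.Perm.sign π : ℤˣ) : ℤ) • rd A c := by
  cases N with
  | zero =>
    intro c
    have : π = 1 := Subsingleton.elim _ _
    subst this
    simp
  | succ m =>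
    have hπ : π ∈ Submonoid.closure
        (Set.range fun i : Fin m ↦ Equiv.swap i.castSucc i.succ) := by
      rw [Equiv.Perm.mclosure_swap_castSucc_succ]; trivial
    induction hπ using Submonoid.closure_induction with
    | mem x hx =>
      obtain ⟨i, rfl⟩ := hx
      intro c
      rw [Equiv.Perm.sign_swap (Fin.castSucc_lt_succ).ne]
      simpa using rd_swap_adj A hA c i
    | one => intro c; simp
    | mul x y _ _ hx hy =>
      intro c
      rw [Equiv.Perm.coe_mul, ← Function.comp_assoc, hy, hx, Equiv.Perm.sign_mul, smul_smul]
      congr 1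
      push_cast
      ring

lemma rd_eq_zero {N : ℕ} (A : Fin N → Matrix (Fin N) (Fin N) R)
    (hA : ManinFam A) (c : Fin N → Fin N) (i j : Fin N) (hij : i ≠ j) (hc : c i = c j) :
    rd A c = 0 := by
  have h := rd_perm A hA (Equiv.swap i j) c
  have h2 : c ∘ Equiv.swap i j = c := by
    funext k
    exact Equiv.apply_swap_eq_self hc k
  rw [h2, Equiv.Perm.sign_swap hij] at h
  apply eq_zero_of_eq_neg
  simpa using h

lemma prod_ofFn_mul {N : ℕ} (a b : Fin N → R) (h : ∀ i j, Commute (b i) (a j)) :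
    (List.ofFn fun k => a k * b k).prod = (List.ofFn a).prod * (List.ofFn b).prod := by
  induction N with
  | zero => simp
  | succ m ih =>
    rw [List.ofFn_succ, List.ofFn_succ, List.ofFn_succ, List.prod_cons, List.prod_cons,
      List.prod_cons, ih _ _ (fun i j => h i.succ j.succ)]
    have hc : Commute (b 0) (List.ofFn fun i : Fin m => a i.succ).prod := by
      apply Commute.list_prod_right
      intro x hx
      obtain ⟨j, rfl⟩ := (List.mem_ofFn' _ _).1 hx
      exact h 0 j.succ
    simp only [mul_assoc]
    rw [← mul_assoc (b 0), hc.eq, mul_assoc]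

lemma rd_mul {N : ℕ} (A B : Fin N → Matrix (Fin N) (Fin N) R)
    (hB : ManinFam B) (hcomm : ∀ i j a b c d, Commute (B i a b) (A j c d)) :
    rd (fun k => A k * B k) id = rd A id * rd B id := by
  have e1 : ∀ σ : Equiv.Perm (Fin N),
      (List.ofFn fun k => (A k * B k) k (σ k)).prod =
      ∑ c : Fin N → Fin N, (List.ofFn fun k => A k k (c k)).prod *
        (List.ofFn fun k => B k (c k) (σ k)).prod := by
    intro σ
    have := (MultilinearMap.mkPiAlgebraFin ℂ N R).map_sum
      (fun k (c : Fin N) => A k k c * B k c (σ k))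
    simp only [MultilinearMap.mkPiAlgebraFin_apply] at this
    simp only [Matrix.mul_apply]
    rw [this]
    refine Finset.sum_congr rfl fun c _ => ?_
    exact prod_ofFn_mul _ _ (fun i j => hcomm _ _ _ _ _ _)
  have e2 : rd (fun k => A k * B k) id =
      ∑ c : Fin N → Fin N, (List.ofFn fun k => A k k (c k)).prod * rd B c := by
    simp only [rd, id, e1, Finset.smul_sum, Finset.mul_sum]
    rw [Finset.sum_comm]
    refine Finset.sum_congr rfl fun c _ => Finset.sum_congr rfl fun σ _ => ?_
    rw [mul_smul_comm]
  rw [e2]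
  have e3 : ∑ c : Fin N → Fin N, (List.ofFn fun k => A k k (c k)).prod * rd B c =
      ∑ π : Equiv.Perm (Fin N), (List.ofFn fun k => A k k (π k)).prod * rd B π := by
    symm
    refine Finset.sum_of_injOn (fun π : Equiv.Perm (Fin N) => (π : Fin N → Fin N))
      (fun a _ b _ h => by exact DFunLike.coe_injective h) (fun _ _ => by simp) ?_ ?_
    · intro c _ hc
      have : ¬ Function.Injective c := by
        intro hinj
        apply hc
        exact ⟨Equiv.ofBijective c (Finite.injective_iff_bijective.1 hinj), by simp, rfl⟩
      rw [Function.Injective] at this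
      push Not at this
      obtain ⟨i, j, h1, h2⟩ := this
      rw [rd_eq_zero B hB c i j h2 h1, mul_zero]
    · intro π _
      rfl
  rw [e3, rd, Finset.sum_mul]
  refine Finset.sum_congr rfl fun π _ => ?_
  have := rd_perm B hB π id
  rw [Function.id_comp] at this
  rw [this, mul_smul_comm, smul_mul_assoc]
  rfl

lemma comm_prod {N : ℕ} (e : R) (f : Fin N → R) :
    e * (List.ofFn f).prod - (List.ofFn f).prod * e =
    ∑ k, (List.ofFn (Function.update f k (e * f k - f k * e))).prod := by
  induction N with
  | zero => simp
  | succ m ih =>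
    have h0 : List.ofFn (Function.update f 0 (e * f 0 - f 0 * e)) =
        (e * f 0 - f 0 * e) :: List.ofFn fun i : Fin m => f i.succ := by
      rw [List.ofFn_succ]
      simp [Fin.succ_ne_zero]
    have hs : ∀ k : Fin m, List.ofFn (Function.update f k.succ (e * f k.succ - f k.succ * e)) =
        f 0 :: List.ofFn (Function.update (fun i : Fin m => f i.succ) k
          (e * f k.succ - f k.succ * e)) := by
      intro k
      rw [List.ofFn_succ]
      congr 1
      congr 1
      funext i
      simp [Function.update_apply]
    rw [Fin.sum_univ_succ, h0]
    simp only [hs, List.prod_cons]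
    rw [← Finset.mul_sum, ← ih (fun i => f i.succ), List.ofFn_succ, List.prod_cons]
    noncomm_ring

lemma prod_update_sub {N : ℕ} (f : Fin N → R) (k : Fin N) (x y : R) :
    (List.ofFn (Function.update f k (x - y))).prod =
    (List.ofFn (Function.update f k x)).prod - (List.ofFn (Function.update f k y)).prod := by
  have := (MultilinearMap.mkPiAlgebraFin ℂ N R).map_update_sub f k x y
  simpa only [MultilinearMap.mkPiAlgebraFin_apply] using this

lemma prod_update_zero {N : ℕ} (f : Fin N → R) (k : Fin N) :
    (List.ofFn (Function.update f k 0)).prod = 0 := by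
  have := (MultilinearMap.mkPiAlgebraFin ℂ N R).map_update_zero f k
  simpa only [MultilinearMap.mkPiAlgebraFin_apply] using this

/-- Centrality of the quantum determinant. -/
lemma rd_central {N : ℕ} (A : Fin N → Matrix (Fin N) (Fin N) R) (hA : ManinFam A)
    (e : R) (p q : Fin N)
    (he : ∀ k a b, e * A k a b - A k a b * e =
      (if q = b then A k a p else 0) - (if a = p then A k q b else 0)) :
    e * rd A id - rd A id * e = 0 := by
  have e1 : ∀ σ : Equiv.Perm (Fin N),
      e * (List.ofFn fun k => A k k (σ k)).prod - (List.ofFn fun k => A k k (σ k)).prod * e =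
      (List.ofFn fun k => A k k (Function.update id q p (σ k))).prod -
      (List.ofFn fun k => A k (Function.update id p q k) (σ k)).prod := by
    intro σ
    rw [comm_prod]
    simp only [he, prod_update_sub]
    rw [Finset.sum_sub_distrib]
    congr 1
    · rw [Finset.sum_eq_single (σ.symm q)]
      · simp only [Equiv.apply_symm_apply, if_true]
        congr 2
        funext k
        by_cases h : k = σ.symm q
        · subst h; simp
        · have : σ k ≠ q := fun h' => h (by rw [← h']; simp)
          simp [Function.update_of_ne h, Function.update_of_ne this]
      · intro k _ hk
        have : q ≠ σ k := fun h' => hk (by rw [h']; simp)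
        rw [if_neg this, prod_update_zero]
      · simp
    · rw [Finset.sum_eq_single p]
      · simp only [if_true]
        congr 2
        funext k
        by_cases h : k = p
        · subst h; simp
        · simp [Function.update_of_ne h]
      · intro k _ hk
        rw [if_neg hk, prod_update_zero]
      · simp
  have e2 : e * rd A id - rd A id * e =
      (∑ σ : Equiv.Perm (Fin N), ((Equiv.Perm.sign σ : ℤˣ) : ℤ) •
        (List.ofFn fun k => A k k (Function.update id q p (σ k))).prod)
      - rd A (Function.update id p q) := by
    rw [rd, rd, Finset.mul_sum, Finset.sum_mul, ← Finset.sum_sub_distrib,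
      ← Finset.sum_sub_distrib]
    refine Finset.sum_congr rfl fun σ _ => ?_
    rw [mul_smul_comm, smul_mul_assoc, ← smul_sub, ← smul_sub]
    congr 1
    exact e1 σ
  rw [e2]
  by_cases hpq : p = q
  · subst hpq
    rw [Function.update_eq_self_iff.2 (by rfl), rd, sub_eq_zero]
    rfl
  · rw [rd_eq_zero A hA _ p q hpq (by
      rw [Function.update_self, Function.update_of_ne (Ne.symm hpq)]; rfl), sub_zero]
    apply eq_zero_of_eq_neg
    conv_lhs => rw [← Equiv.sum_comp (Equiv.mulLeft (Equiv.swap p q))]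
    rw [← Finset.sum_neg_distrib]
    refine Finset.sum_congr rfl fun σ _ => ?_
    rw [Equiv.coe_mulLeft, Equiv.Perm.sign_mul, Equiv.Perm.sign_swap hpq]
    have : ∀ y, Function.update id q p (Equiv.swap p q y) = Function.update id q p y := fun y =>
      Equiv.apply_swap_eq_self (by
        rw [Function.update_self, Function.update_of_ne hpq]; rfl) y
    simp only [Equiv.Perm.mul_apply, this]
    simp

end Abstract

section Single

variable {R : Type*} [Ring R] [Algebra ℂ R] {N : ℕ}

/-- The evaluation `L`-matrix. -/
def LL (e : Fin N → Fin N → R) (x : ℂ) : Matrix (Fin N) (Fin N) R :=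
  fun a b => (if a = b then 1 else 0) + x⁻¹ • e b a

/-- The relations of `gl_N`. -/
def GlR (e : Fin N → Fin N → R) : Prop :=
  ∀ a b c d : Fin N, e a b * e c d - e c d * e a b =
    (if b = c then (1 : ℂ) else 0) • e a d - (if d = a then (1 : ℂ) else 0) • e c b

lemma LL_manin (e : Fin N → Fin N → R) (he : GlR e) (x : ℂ) (h0 : x ≠ 0) (h1 : x - 1 ≠ 0) :
    Manin2 (LL e x) (LL e (x - 1)) := by
  intro a b c d
  have r1 := he b a d c
  have r2 := he b c d a
  rw [sub_eq_iff_eq_add] at r1 r2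
  have hst : (x - 1)⁻¹ = x⁻¹ + x⁻¹ * (x - 1)⁻¹ := by field_simp; ring
  have key : ∀ (p q : ℂ), p = q + q * p → ∀ (A B C D : ℂ) (X Y Z W : R),
      X * Y = D • Z - B • W + Y * X → Z * W = C • X - A • Y + W * Z →
      (A • 1 + q • X) * (C • 1 + p • Y) + (B • 1 + q • Z) * (D • 1 + p • W) =
      (D • 1 + q • W) * (B • 1 + p • Z) + (C • 1 + q • Y) * (A • 1 + p • X) := by
    intro p q hpq A B C D X Y Z W hXY hZW
    simp only [add_mul, mul_add, smul_mul_assoc, mul_smul_comm, one_mul, mul_one, hXY, hZW,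
      smul_add, smul_sub, smul_smul]
    have hpq' : p * q = p - q := by rw [sub_eq_iff_eq_add.2]; linear_combination hpq
    match_scalars <;> first
      | ring1
      | linear_combination A * hpq'
      | linear_combination -A * hpq'
      | linear_combination B * hpq'
      | linear_combination -B * hpq'
      | linear_combination C * hpq'
      | linear_combination -C * hpq'
      | linear_combination D * hpq'
  have hLL : ∀ y a b, LL e y a b = (if a = b then (1 : ℂ) else 0) • (1 : R) + y⁻¹ • e b a := by
    intro y a b
    simp only [LL, ite_smul, one_smul, zero_smul]
  simp only [hLL]
  exact key _ _ hst _ _ _ _ _ _ _ _ r1 r2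

lemma LL_comm (e : Fin N → Fin N → R) (he : GlR e) (x : ℂ) (p q a b : Fin N) :
    e p q * LL e x a b - LL e x a b * e p q =
      (if q = b then LL e x a p else 0) - (if a = p then LL e x q b else 0) := by
  have r := he p q b a
  have : e p q * LL e x a b - LL e x a b * e p q = x⁻¹ • (e p q * e b a - e b a * e p q) := by
    simp only [LL]
    rw [mul_add, add_mul, mul_smul_comm, smul_mul_assoc, smul_sub]
    split_ifs <;> simp
  rw [this, r]
  simp only [LL]
  by_cases h1 : q = b <;> by_cases h2 : a = p
  · subst h1 h2; simp [smul_sub]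
  · subst h1; simp [h2]
  · subst h2; simp [h1]
  · simp [h1, h2]

lemma prod_mem_span {ι : Type*} {V : Type*} [AddCommGroup V] [Module ℂ V]
    (f : ι → Module.End ℂ V) (r : ι → ℂ) (v : V) (l : List ι) (h : ∀ a ∈ l, f a v = r a • v) :
    (l.map f).prod v = (l.map r).prod • v := by
  induction l with
  | nil => simp
  | cons a l ih =>
    have h2 := ih (fun b hb => h b (List.mem_cons_of_mem _ hb))
    simp only [List.map_cons, List.prod_cons, Module.End.mul_apply, h2, map_smul,
      h a List.mem_cons_self, smul_smul]
    rw [mul_comm]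

lemma prod_kill {V : Type*} [AddCommGroup V] [Module ℂ V]
    (f : Fin N → Module.End ℂ V) (r : Fin N → ℂ) (v : V) (l : List (Fin N))
    (hl : l.Pairwise (· < ·)) (a : Fin N) (ha : a ∈ l) (h0 : f a v = 0)
    (h : ∀ b ∈ l, a < b → f b v = r b • v) :
    (l.map f).prod v = 0 := by
  induction l with
  | nil => simp at ha
  | cons c l ih =>
    rw [List.pairwise_cons] at hl
    rcases List.mem_cons.1 ha with rfl | ha
    · have h2 := prod_mem_span f r v l (fun b hb => h b (List.mem_cons_of_mem _ hb) (hl.1 b hb))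
      simp only [List.map_cons, List.prod_cons, Module.End.mul_apply, h2, map_smul, h0, smul_zero]
    · simp only [List.map_cons, List.prod_cons, Module.End.mul_apply,
        ih hl.2 ha (fun b hb => h b (List.mem_cons_of_mem _ hb)), map_zero]

lemma rd_hw {V : Type*} [AddCommGroup V] [Module ℂ V]
    (e : Fin N → Fin N → Module.End ℂ V) (x : ℂ) (lam : Fin N → ℂ) (v : V)
    (h1 : ∀ a b, a < b → e a b v = 0) (h2 : ∀ a, e a a v = lam a • v) :
    rd (fun k : Fin N => LL e (x - (k : ℕ))) id v =
      (∏ k : Fin N, (1 + (x - (k : ℕ))⁻¹ * lam k)) • v := by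
  have hdiag : ∀ k a : Fin N, LL e (x - (k : ℕ)) a a v =
      (1 + (x - (k : ℕ))⁻¹ * lam a) • v := by
    intro k a
    simp [LL, h2, add_smul, smul_smul]
  have hlow : ∀ (k a b : Fin N), b < a → LL e (x - (k : ℕ)) a b v = 0 := by
    intro k a b hab
    simp [LL, h1 b a hab, hab.ne']
  rw [rd, LinearMap.sum_apply, Finset.sum_eq_single 1]
  · simp only [Equiv.Perm.sign_one, Units.val_one, one_smul, id, Equiv.Perm.one_apply]
    rw [List.ofFn_eq_map, prod_mem_span _ (fun k : Fin N => (1 + (x - (k : ℕ))⁻¹ * lam k)) v _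
      (fun a _ => hdiag a a), ← List.ofFn_eq_map, List.prod_ofFn]
  · intro σ _ hσ
    rw [LinearMap.smul_apply, List.ofFn_eq_map]
    have hne : (Finset.univ.filter fun a => σ a ≠ a).Nonempty := by
      by_contra hcon
      apply hσ
      ext a
      by_contra ha
      exact hcon ⟨a, by simpa [Fin.ext_iff] using ha⟩
    set a := (Finset.univ.filter fun a => σ a ≠ a).max' hne with ha
    have hmem := (Finset.univ.filter fun a => σ a ≠ a).max'_mem hne
    rw [← ha, Finset.mem_filter] at hmem
    have hmax : ∀ b, a < b → σ b = b := by
      intro b hb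
      by_contra hcon
      exact absurd ((Finset.univ.filter fun a => σ a ≠ a).le_max' b (by simpa using hcon))
        (not_le.2 hb)
    have hlt : σ a < a := by
      rcases lt_trichotomy (σ a) a with h | h | h
      · exact h
      · exact absurd h hmem.2
      · exact absurd (σ.injective (hmax _ h)) hmem.2
    have hk := prod_kill (fun k : Fin N => LL e (x - (k : ℕ)) (id k) (σ k))
      (fun k : Fin N => (1 + (x - (k : ℕ))⁻¹ * lam k)) v _
      (List.pairwise_lt_finRange N) a (List.mem_finRange a) (hlow a a (σ a) hlt) (by
        intro b _ hab
        simp only [id, hmax b hab]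
        exact hdiag b b)
    exact (congrArg _ hk).trans (smul_zero _)
  · simp

lemma maninFam_LL (e : Fin N → Fin N → R) (he : GlR e) (x : ℂ)
    (hx : ∀ k : ℕ, k < N → x - k ≠ 0) : ManinFam (fun k : Fin N => LL e (x - (k : ℕ))) := by
  intro i j hij
  have h2 := hx _ j.2
  have : x - (j : ℕ) = x - (i : ℕ) - 1 := by rw [hij]; push_cast; ring
  simp only
  rw [this] at h2 ⊢
  exact LL_manin e he _ (hx _ i.2) h2

lemma rd_scalar {V : Type*} [AddCommGroup V] [Module ℂ V]
    (e : Fin N → Fin N → Module.End ℂ V) (he : GlR e) (x : ℂ)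
    (hx : ∀ k : ℕ, k < N → x - k ≠ 0) (lam : Fin N → ℂ) (v : V)
    (h1 : ∀ a b, a < b → e a b v = 0) (h2 : ∀ a, e a a v = lam a • v)
    (hcyc : ∀ W : Submodule ℂ V, (∀ a b : Fin N, ∀ x ∈ W, e a b x ∈ W) → v ∈ W →
      ∀ x : V, x ∈ W) :
    rd (fun k : Fin N => LL e (x - (k : ℕ))) id =
      (∏ k : Fin N, (1 + (x - (k : ℕ))⁻¹ * lam k)) • (1 : Module.End ℂ V) := by
  set D := rd (fun k : Fin N => LL e (x - (k : ℕ))) id with hD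
  set χ := ∏ k : Fin N, (1 + (x - (k : ℕ))⁻¹ * lam k) with hχ
  ext w
  have := hcyc (LinearMap.ker (D - χ • (1 : Module.End ℂ V))) (by
    intro a b y hy
    have hc := rd_central (fun k : Fin N => LL e (x - (k : ℕ))) (maninFam_LL e he x hx) (e a b) a b
      (fun k c d => LL_comm e he _ a b c d)
    rw [← hD] at hc
    have hc2 : D (e a b y) = e a b (D y) := by
      have := LinearMap.congr_fun hc y
      simp only [LinearMap.sub_apply, Module.End.mul_apply, LinearMap.zero_apply] at this
      exact (sub_eq_zero.1 this).symm
    rw [LinearMap.mem_ker, LinearMap.sub_apply, sub_eq_zero] at hy ⊢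
    rw [hc2, hy]
    simp) (by
    rw [LinearMap.mem_ker, LinearMap.sub_apply, hD, rd_hw e x lam v h1 h2]
    simp [hχ]) w
  rw [LinearMap.mem_ker, LinearMap.sub_apply, sub_eq_zero] at this
  exact this

end Single

section Tensor

variable {N n : ℕ} {V : Fin n → Type*} [∀ i, AddCommGroup (V i)] [∀ i, Module ℂ (V i)]
  {M : Type*} [AddCommGroup M] [Module ℂ M]

/-- The action of `End (V j)` on the `j`-th tensor factor. -/
def rho (φ : M ≃ₗ[ℂ] PiTensorProduct ℂ V) (j : Fin n) (X : Module.End ℂ (V j)) :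
    Module.End ℂ M :=
  φ.symm.toLinearMap ∘ₗ
    (PiTensorProduct.map
      (Function.update (fun i : Fin n => (LinearMap.id : V i →ₗ[ℂ] V i)) j X)) ∘ₗ
    φ.toLinearMap

lemma rho_mul (φ : M ≃ₗ[ℂ] PiTensorProduct ℂ V) (j : Fin n) (X Y : Module.End ℂ (V j)) :
    rho φ j (X * Y) = rho φ j X * rho φ j Y := by
  have h : PiTensorProduct.map (R := ℂ) (Function.update
      (fun i : Fin n => (LinearMap.id : V i →ₗ[ℂ] V i)) j (X * Y)) =
      PiTensorProduct.map (Function.update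
      (fun i : Fin n => (LinearMap.id : V i →ₗ[ℂ] V i)) j X) ∘ₗ
      PiTensorProduct.map (Function.update
      (fun i : Fin n => (LinearMap.id : V i →ₗ[ℂ] V i)) j Y) := by
    rw [← PiTensorProduct.map_comp]
    congr 1
    funext i
    by_cases hi : i = j
    · subst hi; simp [Module.End.mul_eq_comp]
    · simp [Function.update_of_ne hi]
  ext w
  simp [rho, h]

lemma rho_commute (φ : M ≃ₗ[ℂ] PiTensorProduct ℂ V) (j k : Fin n) (hjk : j ≠ k)
    (X : Module.End ℂ (V j)) (Y : Module.End ℂ (V k)) :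
    Commute (rho φ j X) (rho φ k Y) := by
  have h : PiTensorProduct.map (R := ℂ) (Function.update
      (fun i : Fin n => (LinearMap.id : V i →ₗ[ℂ] V i)) j X) ∘ₗ
      PiTensorProduct.map (Function.update
      (fun i : Fin n => (LinearMap.id : V i →ₗ[ℂ] V i)) k Y) =
      PiTensorProduct.map (R := ℂ) (Function.update
      (fun i : Fin n => (LinearMap.id : V i →ₗ[ℂ] V i)) k Y) ∘ₗ
      PiTensorProduct.map (Function.update
      (fun i : Fin n => (LinearMap.id : V i →ₗ[ℂ] V i)) j X) := by
    rw [← PiTensorProduct.map_comp, ← PiTensorProduct.map_comp]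
    congr 1
    funext i
    by_cases hi : i = j
    · subst hi; simp [Function.update_of_ne hjk]
    · by_cases hi2 : i = k
      · subst hi2; simp [Function.update_of_ne hi]
      · simp [Function.update_of_ne hi, Function.update_of_ne hi2]
  have h' := fun y => LinearMap.congr_fun h y
  simp only [LinearMap.comp_apply] at h'
  ext w
  simp [rho, h']

/-- `rho` as an algebra homomorphism. -/
def rhoHom (φ : M ≃ₗ[ℂ] PiTensorProduct ℂ V) (j : Fin n) :
    Module.End ℂ (V j) →ₐ[ℂ] Module.End ℂ M :=
  AlgHom.ofLinearMap
    { toFun := rho φ j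
      map_add' := fun X Y => by
        ext w
        simp [rho, PiTensorProduct.map_update_add]
      map_smul' := fun c X => by
        ext w
        simp [rho, PiTensorProduct.map_update_smul] }
    (by
      ext w
      have h : Function.update (fun i : Fin n => (LinearMap.id : V i →ₗ[ℂ] V i)) j 1 =
        fun i : Fin n => (LinearMap.id : V i →ₗ[ℂ] V i) :=
          Function.update_eq_self_iff.2 rfl
      simp [rho, h, PiTensorProduct.map_id])
    (fun X Y => rho_mul φ j X Y)

lemma rd_map {R S : Type*} [Ring R] [Algebra ℂ R] [Ring S] [Algebra ℂ S] (g : R →ₐ[ℂ] S)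
    (A : Fin N → Matrix (Fin N) (Fin N) R) (c : Fin N → Fin N) :
    rd (fun k => (A k).map g) c = g (rd A c) := by
  simp only [rd, map_sum, map_zsmul, map_list_prod, List.map_ofFn]
  rfl

variable (E : ∀ i : Fin n, Fin N → Fin N → (V i →ₗ[ℂ] V i)) (φ : M ≃ₗ[ℂ] PiTensorProduct ℂ V)
  (z : Fin n → ℂ)

lemma Lmat_eq (j : Fin n) (u : ℂ) :
    Lmat V M E φ z j u = (LL (R := Module.End ℂ (V j)) (E j) (u - z j)).map (rhoHom φ j) := by
  refine Matrix.ext fun a b => ?_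
  simp only [Lmat, LL, Matrix.map_apply, map_add, map_smul]
  have h1 : (rhoHom φ j) (if a = b then 1 else 0) = if a = b then 1 else 0 := by
    split_ifs <;> simp
  rw [h1]
  rfl

lemma Lmat_eq' (j : Fin n) (u : ℂ) :
    Lmat V M E φ z j u = LL (R := Module.End ℂ M) (EE V M E φ j) (u - z j) := rfl

/-- Partial monodromy matrix. -/
def TR (js : List (Fin n)) (u : ℂ) : Matrix (Fin N) (Fin N) (Module.End ℂ M) :=
  ((js.map fun j => Lmat V M E φ z j u).reverse).prod

lemma Tmat_eq (u : ℂ) : Tmat V M E φ z u = TR E φ z (List.finRange n) u := by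
  rw [Tmat, TR, List.ofFn_eq_map]

lemma TR_cons (j : Fin n) (js : List (Fin n)) (u : ℂ) :
    TR E φ z (j :: js) u = TR E φ z js u * Lmat V M E φ z j u := by
  simp [TR]

lemma TR_nil (u : ℂ) : TR E φ z [] u = 1 := by
  simp [TR]

lemma Lmat_commute_TR (j : Fin n) (js : List (Fin n)) (h : j ∉ js) (u v : ℂ) (a b c d : Fin N) :
    Commute (Lmat V M E φ z j u a b) (TR E φ z js v c d) := by
  induction js generalizing c d with
  | nil =>
    rw [TR_nil, Matrix.one_apply]
    split_ifs
    · exact Commute.one_right _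
    · exact Commute.zero_right _
  | cons k js ih =>
    rw [TR_cons, Matrix.mul_apply]
    apply Commute.sum_right
    intro x _
    apply Commute.mul_right
    · exact ih (fun h' => h (List.mem_cons_of_mem _ h')) _ _
    · rw [Lmat_eq, Lmat_eq]
      exact rho_commute φ j k (fun h' => h (by simp [h'])) _ _

/-- The scalar by which the quantum determinant of one factor acts. -/
def chi (Λ : Fin n → Fin N → ℤ) (u : ℂ) (j : Fin n) : ℂ :=
  ∏ k : Fin N, (1 + (u - z j - (k : ℕ))⁻¹ * (Λ j k : ℂ))

lemma rd_TR (Λ : Fin n → Fin N → ℤ) (hrel : GlRel V E) (hhw : IsHW V E Λ) (u : ℂ)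
    (hu : Good N z u) (js : List (Fin n)) (hjs : js.Nodup) :
    rd (fun k : Fin N => TR E φ z js (u - (k : ℕ))) id =
      (js.map (chi z Λ u)).prod • (1 : Module.End ℂ M) := by
  induction js with
  | nil =>
    simp only [TR_nil, List.map_nil, List.prod_nil, one_smul]
    have h := rd_hw (N := N) (V := M) (fun _ _ => 0) 0 (fun _ => 0)
    ext w
    have h := h w (by simp) (by simp)
    have h2 : ∀ x : ℂ, LL (R := Module.End ℂ M) (N := N) (fun _ _ => 0) x = 1 := by
      intro x; ext a b : 2; simp [LL, Matrix.one_apply]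
    simpa [h2] using h
  | cons j js ih =>
    rw [List.nodup_cons] at hjs
    have hx : ∀ k : ℕ, k < N → u - z j - k ≠ 0 := by
      intro k hk h
      apply hu j k hk
      linear_combination h
    have hGl : GlR (R := Module.End ℂ (V j)) (E j) := fun a b c d => hrel j a b c d
    obtain ⟨v, -, h1, h2, h3⟩ := hhw j
    have hL := rd_scalar (V := V j) (E j) hGl (u - z j) hx (fun k => (Λ j k : ℂ)) v h1 h2 h3
    have hLm : (fun k : Fin N => Lmat V M E φ z j (u - (k : ℕ))) =
        fun k : Fin N => (LL (R := Module.End ℂ (V j)) (E j) (u - z j - (k : ℕ))).map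
          (rhoHom φ j) := by
      funext k
      rw [Lmat_eq, sub_right_comm]
    simp only [TR_cons]
    rw [rd_mul, ih hjs.2, hLm, rd_map, hL, map_smul, map_one, List.map_cons, List.prod_cons,
      smul_mul_smul_comm, one_mul, mul_comm]
    · rfl
    · rw [hLm]
      intro i k hik a b c d
      have := maninFam_LL (R := Module.End ℂ (V j)) (E j) hGl (u - z j) hx i k hik a b c d
      simp only [Matrix.map_apply, ← map_mul, ← map_add]
      rw [this]
    · intro i k a b c d
      exact Lmat_commute_TR E φ z j js hjs.1 _ _ _ _ _ _

end Tensor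

section Coeffs

variable {N n : ℕ} {M : Type*} [AddCommGroup M] [Module ℂ M]

/-- Coefficient of `τ^{-k}` in the ordered product of the `X_{a,σ(a)}`, `a` in the list. -/
def CC (Q : Fin N → ℂ) (T : ℂ → Matrix (Fin N) (Fin N) (Module.End ℂ M))
    (σ : Equiv.Perm (Fin N)) : List (Fin N) → ℕ → ℂ → Module.End ℂ M
  | [], 0, _ => 1
  | [], _ + 1, _ => 0
  | a :: l, 0, u => if a = σ a then CC Q T σ l 0 u else 0
  | a :: l, k + 1, u => (if a = σ a then CC Q T σ l (k + 1) u else 0) -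
      Q a • (T u a (σ a) * CC Q T σ l k (u - 1))

/-- Ordered shifted product. -/
def PT (T : ℂ → Matrix (Fin N) (Fin N) (Module.End ℂ M))
    (σ : Equiv.Perm (Fin N)) : List (Fin N) → ℂ → Module.End ℂ M
  | [], _ => 1
  | a :: l, u => T u a (σ a) * PT T σ l (u - 1)

variable (Q : Fin N → ℂ) (T : ℂ → Matrix (Fin N) (Fin N) (Module.End ℂ M))
  (σ : Equiv.Perm (Fin N))

lemma CC_gt (l : List (Fin N)) : ∀ (k : ℕ) (u : ℂ), l.length < k → CC Q T σ l k u = 0 := by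
  induction l with
  | nil =>
    intro k u hk
    cases k with
    | zero => simp at hk
    | succ k => rfl
  | cons a l ih =>
    intro k u hk
    cases k with
    | zero => simp at hk
    | succ k =>
      simp only [List.length_cons] at hk
      rw [CC, ih (k + 1) u (by omega), ih k _ (by omega)]
      simp

lemma CC_top (l : List (Fin N)) : ∀ (u : ℂ), CC Q T σ l l.length u =
    ((-1) ^ l.length * (l.map Q).prod) • PT T σ l u := by
  induction l with
  | nil => intro u; simp [CC, PT]
  | cons a l ih =>
    intro u
    rw [List.length_cons, CC, CC_gt Q T σ l _ _ (Nat.lt_succ_self _), ih, PT]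
    simp only [ite_self, zero_sub, mul_smul_comm, smul_smul, ← neg_smul, List.map_cons,
      List.prod_cons]
    congr 1
    ring

lemma PT_ofFn {m : ℕ} (g : Fin m → Fin N) : ∀ u : ℂ, PT T σ (List.ofFn g) u =
    (List.ofFn fun i : Fin m => T (u - (i : ℕ)) (g i) (σ (g i))).prod := by
  induction m with
  | zero => intro u; simp [PT]
  | succ m ih =>
    intro u
    rw [List.ofFn_succ, PT, ih, List.ofFn_succ, List.prod_cons]
    simp only [Fin.val_zero, Nat.cast_zero, sub_zero, Fin.val_succ, Nat.cast_add, Nat.cast_one,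
      sub_sub, add_comm (1 : ℂ)]

end Coeffs

section Extract

variable {N n : ℕ} {V : Fin n → Type*} [∀ i, AddCommGroup (V i)] [∀ i, Module ℂ (V i)]
  {M : Type*} [AddCommGroup M] [Module ℂ M]
  (E : ∀ i : Fin n, Fin N → Fin N → (V i →ₗ[ℂ] V i)) (φ : M ≃ₗ[ℂ] PiTensorProduct ℂ V)
  (z : Fin n → ℂ) (Q : Fin N → ℂ)

lemma fold_eq (σ : Equiv.Perm (Fin N)) (f : ℂ → M) (l : List (Fin N)) : ∀ u : ℂ,
    ((l.map fun a => Xop V M E φ z (Matrix.diagonal Q) a (σ a)).foldr (· ∘ ·) id) f u =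
    ∑ k ∈ Finset.range (l.length + 1), CC Q (Tmat V M E φ z) σ l k u (f (u - (k : ℂ))) := by
  induction l with
  | nil => intro u; simp [CC]
  | cons a l ih =>
    intro u
    rw [List.map_cons, List.foldr_cons, Function.comp_apply, Xop, ih, ih]
    have hsum : ∑ c : Fin N, Matrix.diagonal Q a c • (Tmat V M E φ z u c (σ a))
        (∑ k ∈ Finset.range (l.length + 1),
          CC Q (Tmat V M E φ z) σ l k (u - 1) (f (u - 1 - (k : ℂ)))) =
        ∑ k ∈ Finset.range (l.length + 1),
          (Q a • (Tmat V M E φ z u a (σ a) * CC Q (Tmat V M E φ z) σ l k (u - 1)))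
            (f (u - ((k + 1 : ℕ) : ℂ))) := by
      rw [Finset.sum_eq_single a]
      · rw [Matrix.diagonal_apply_eq, map_sum, Finset.smul_sum]
        refine Finset.sum_congr rfl fun k _ => ?_
        rw [LinearMap.smul_apply, Module.End.mul_apply]
        congr 4
        push_cast
        ring
      · intro c _ hc
        rw [Matrix.diagonal_apply_ne _ hc.symm, zero_smul]
      · simp
    rw [hsum, List.length_cons, Finset.sum_range_succ' _ (l.length + 1)]
    simp only [CC, LinearMap.sub_apply, Finset.sum_sub_distrib]
    have h2 : (if a = σ a then ∑ k ∈ Finset.range (l.length + 1),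
          CC Q (Tmat V M E φ z) σ l k u (f (u - (k : ℂ))) else 0) =
        ∑ k ∈ Finset.range (l.length + 1), (if a = σ a then
          CC Q (Tmat V M E φ z) σ l (k + 1) u else 0) (f (u - ((k + 1 : ℕ) : ℂ))) +
        (if a = σ a then CC Q (Tmat V M E φ z) σ l 0 u else 0) (f (u - ((0 : ℕ) : ℂ))) := by
      split_ifs
      · rw [← Finset.sum_range_succ'
          (fun k => CC Q (Tmat V M E φ z) σ l k u (f (u - (k : ℂ)))),
          Finset.sum_range_succ _ (l.length + 1), CC_gt _ _ _ _ _ _ (Nat.lt_succ_self _)]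
        simp
      · simp
    rw [h2]
    abel

lemma TT_eq (𝕋 : ℕ → ℂ → Module.End ℂ M)
    (h𝕋 : ∀ (f : ℂ → M) (u : ℂ), Good N z u →
      Dop V M E φ z (Matrix.diagonal Q) f u =
        ∑ k ∈ Finset.range (N + 1), ((-1 : ℤ) ^ k) • 𝕋 k u (f (u - (k : ℂ))))
    (k : ℕ) (hk : k ≤ N) (u : ℂ) (hu : Good N z u) :
    𝕋 k u = ((-1 : ℂ) ^ k) • ∑ σ : Equiv.Perm (Fin N), ((Equiv.Perm.sign σ : ℤˣ) : ℤ) •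
      CC Q (Tmat V M E φ z) σ (List.finRange N) k u := by
  ext w
  have h := h𝕋 (fun y => if y = u - (k : ℂ) then w else 0) u hu
  have hinj : ∀ j : ℕ, (u - (j : ℂ) = u - (k : ℂ)) ↔ j = k := by
    intro j
    rw [sub_right_inj, Nat.cast_inj]
  simp only [Dop, List.ofFn_eq_map, fold_eq, hinj, List.length_finRange] at h
  have hs : ∀ g : ℕ → Module.End ℂ M, ∑ j ∈ Finset.range (N + 1),
      g j (if j = k then w else 0) = g k w := by
    intro g
    rw [Finset.sum_eq_single k]
    · simp
    · intro j _ hj; simp [hj]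
    · intro h'; exact absurd (Finset.mem_range.2 (by omega)) h'
  have hs2 := hs (fun j => ((-1 : ℤ) ^ j) • 𝕋 j u)
  simp only [LinearMap.smul_apply] at hs2
  simp only [hs, hs2] at h
  have hz : ((-1 : ℤ) ^ k) • 𝕋 k u w = ((-1 : ℂ) ^ k) • 𝕋 k u w := by
    rw [← Int.cast_smul_eq_zsmul ℂ]
    push_cast
    rfl
  rw [hz] at h
  rw [LinearMap.smul_apply, LinearMap.sum_apply]
  simp only [LinearMap.smul_apply]
  rw [h, smul_smul, ← pow_add, ← two_mul, pow_mul]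
  simp

lemma TT_top (Λ : Fin n → Fin N → ℤ) (hrel : GlRel V E) (hhw : IsHW V E Λ) (u : ℂ)
    (hu : Good N z u) :
    ((-1 : ℂ) ^ N) • ∑ σ : Equiv.Perm (Fin N), ((Equiv.Perm.sign σ : ℤˣ) : ℤ) •
      CC Q (Tmat V M E φ z) σ (List.finRange N) N u =
    ((∏ i, Q i) * ∏ s : Fin n, chi z Λ u s) • (1 : Module.End ℂ M) := by
  have h1 : ∀ σ : Equiv.Perm (Fin N), CC Q (Tmat V M E φ z) σ (List.finRange N) N u =
      ((-1) ^ N * ∏ i, Q i) • (List.ofFn fun k : Fin N =>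
        TR E φ z (List.finRange n) (u - (k : ℕ)) (id k) (σ k)).prod := by
    intro σ
    have h := CC_top Q (Tmat V M E φ z) σ (List.finRange N) u
    rw [List.length_finRange] at h
    rw [h, ← List.ofFn_eq_map, List.prod_ofFn, ← List.ofFn_id, PT_ofFn]
    simp only [Tmat_eq, id]
  simp only [h1]
  have h2 := rd_TR E φ z Λ hrel hhw u hu (List.finRange n) (List.nodup_finRange n)
  rw [rd, ← List.ofFn_eq_map, List.prod_ofFn] at h2
  simp only [smul_comm _ ((-1 : ℂ) ^ N * ∏ i, Q i)]
  rw [← Finset.smul_sum, h2, smul_smul, smul_smul]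
  congr 1
  have : ((-1 : ℂ) ^ N) * (-1) ^ N = 1 := by rw [← pow_add, ← two_mul, pow_mul]; simp
  linear_combination ((∏ i, Q i) * ∏ i, chi z Λ u i) * this

end Extract

section PolyPart

variable {N n : ℕ} {R : Type*} [Ring R] [Algebra ℂ R]

/-- Polynomial functions of degree at most `d`. -/
def PF (R : Type*) [Ring R] [Algebra ℂ R] (d : ℕ) : Submodule ℂ (ℂ → R) :=
  Submodule.span ℂ {F | ∃ p : Polynomial ℂ, p.natDegree ≤ d ∧ ∃ c : R, F = fun u => p.eval u • c}

lemma PF_mono {d d' : ℕ} (h : d ≤ d') : PF R d ≤ PF R d' := by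
  apply Submodule.span_mono
  rintro F ⟨p, hp, c, rfl⟩
  exact ⟨p, hp.trans h, c, rfl⟩

lemma PF_basic {d : ℕ} (p : Polynomial ℂ) (hp : p.natDegree ≤ d) (c : R) :
    (fun u => p.eval u • c) ∈ PF R d :=
  Submodule.subset_span ⟨p, hp, c, rfl⟩

lemma PF_mul {d d' : ℕ} {F G : ℂ → R} (hF : F ∈ PF R d) (hG : G ∈ PF R d') :
    (fun u => F u * G u) ∈ PF R (d + d') := by
  induction hF using Submodule.span_induction with
  | mem F hF =>
    obtain ⟨p, hp, c, rfl⟩ := hF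
    induction hG using Submodule.span_induction with
    | mem G hG =>
      obtain ⟨q, hq, c', rfl⟩ := hG
      have := PF_basic (d := d + d') (p * q)
        (Polynomial.natDegree_mul_le.trans (by omega)) (c * c')
      simpa only [smul_mul_smul_comm, Polynomial.eval_mul] using this
    | zero =>
      simp only [Pi.zero_apply, mul_zero, zero_mul]
      exact (PF R (d + d')).zero_mem
    | add x y _ _ hx hy =>
      simp only [Pi.add_apply, mul_add]
      exact (PF R (d + d')).add_mem hx hy
    | smul a x _ hx =>
      simp only [Pi.smul_apply, mul_smul_comm]
      exact (PF R (d + d')).smul_mem a hx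
  | zero =>
      simp only [Pi.zero_apply, mul_zero, zero_mul]
      exact (PF R (d + d')).zero_mem
  | add x y _ _ hx hy =>
      simp only [Pi.add_apply, add_mul]
      exact (PF R (d + d')).add_mem hx hy
  | smul a x _ hx =>
      simp only [Pi.smul_apply, smul_mul_assoc]
      exact (PF R (d + d')).smul_mem a hx

lemma PF_shift {d : ℕ} {F : ℂ → R} (hF : F ∈ PF R d) : (fun u => F (u - 1)) ∈ PF R d := by
  induction hF using Submodule.span_induction with
  | mem F hF =>
    obtain ⟨p, hp, c, rfl⟩ := hF
    have := PF_basic (d := d) (p.comp (Polynomial.X - Polynomial.C 1)) (by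
      rw [Polynomial.natDegree_comp, Polynomial.natDegree_X_sub_C]; simpa using hp) c
    simpa only [Polynomial.eval_comp, Polynomial.eval_sub, Polynomial.eval_X,
      Polynomial.eval_C] using this
  | zero =>
      simp only [Pi.zero_apply, mul_zero, zero_mul]
      exact (PF R d).zero_mem
  | add x y _ _ hx hy =>
      simp only [Pi.add_apply]
      exact (PF R d).add_mem hx hy
  | smul a x _ hx =>
      simp only [Pi.smul_apply]
      exact (PF R d).smul_mem a hx

lemma PF_toPoly {d : ℕ} {F : ℂ → R} (hF : F ∈ PF R d) :
    ∃ P : Polynomial R, P.natDegree ≤ d ∧ ∀ u : ℂ, P.eval (u • (1 : R)) = F u := by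
  induction hF using Submodule.span_induction with
  | mem F hF =>
    obtain ⟨p, hp, c, rfl⟩ := hF
    refine ⟨Polynomial.C c * p.map (algebraMap ℂ R),
      (Polynomial.natDegree_C_mul_le _ _).trans ((Polynomial.natDegree_map_le).trans hp), ?_⟩
    intro u
    rw [Polynomial.eval_C_mul, ← Algebra.algebraMap_eq_smul_one, Polynomial.eval_map,
      Polynomial.eval₂_at_apply, ← Algebra.commutes]
    exact (Algebra.smul_def _ _).symm
  | zero => exact ⟨0, by simp, by simp⟩
  | add x y _ _ hx hy =>
    obtain ⟨P, h1, h2⟩ := hx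
    obtain ⟨P', h1', h2'⟩ := hy
    exact ⟨P + P', (Polynomial.natDegree_add_le _ _).trans (max_le h1 h1'), fun u => by
      rw [Polynomial.eval_add, h2, h2']; rfl⟩
  | smul a x _ hx =>
    obtain ⟨P, h1, h2⟩ := hx
    refine ⟨Polynomial.C (algebraMap ℂ R a) * P, (Polynomial.natDegree_C_mul_le _ _).trans h1,
      fun u => ?_⟩
    rw [Polynomial.eval_C_mul, h2, Pi.smul_apply, Algebra.smul_def]

end PolyPart

section PolyT

variable {N n : ℕ} {V : Fin n → Type*} [∀ i, AddCommGroup (V i)] [∀ i, Module ℂ (V i)]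
  {M : Type*} [AddCommGroup M] [Module ℂ M]
  (E : ∀ i : Fin n, Fin N → Fin N → (V i →ₗ[ℂ] V i)) (φ : M ≃ₗ[ℂ] PiTensorProduct ℂ V)
  (z : Fin n → ℂ) (Q : Fin N → ℂ)

lemma Lmat_poly (j : Fin n) (a b : Fin N) : ∃ F ∈ PF (Module.End ℂ M) 1, ∀ u : ℂ,
    u ≠ z j → (u - z j) • Lmat V M E φ z j u a b = F u := by
  refine ⟨(fun u => (Polynomial.X - Polynomial.C (z j)).eval u •
    (if a = b then (1 : Module.End ℂ M) else 0)) +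
    fun u => (Polynomial.C (1 : ℂ)).eval u • EE V M E φ j b a,
    Submodule.add_mem _ (PF_basic _ (by simp) _) (PF_basic _ (by simp) _), ?_⟩
  intro u hu
  have : u - z j ≠ 0 := sub_ne_zero.2 hu
  simp only [Lmat, Pi.add_apply, Polynomial.eval_sub, Polynomial.eval_X, Polynomial.eval_C,
    smul_add, smul_smul, mul_inv_cancel₀ this]

lemma TR_poly (js : List (Fin n)) : ∀ (a b : Fin N), ∃ F ∈ PF (Module.End ℂ M) js.length,
    ∀ u : ℂ, (∀ j ∈ js, u ≠ z j) → (js.map fun j => u - z j).prod • TR E φ z js u a b = F u := by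
  induction js with
  | nil =>
    intro a b
    refine ⟨fun u => (Polynomial.C (1 : ℂ)).eval u • ((1 : Matrix _ _ (Module.End ℂ M)) a b),
      PF_basic _ (by simp) _, ?_⟩
    intro u _
    simp [TR_nil]
  | cons j js ih =>
    intro a b
    choose F hF hF2 using ih
    choose G hG hG2 using Lmat_poly E φ z j
    refine ⟨∑ c, fun u => F a c u * G c b u, Submodule.sum_mem _ fun c _ => ?_, ?_⟩
    · exact PF_mul (hF a c) (hG c b)
    · intro u hu
      rw [TR_cons, Matrix.mul_apply, Finset.sum_apply, Finset.smul_sum]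
      refine Finset.sum_congr rfl fun c _ => ?_
      rw [← hF2 a c u (fun k hk => hu k (List.mem_cons_of_mem _ hk)),
        ← hG2 c b u (hu j List.mem_cons_self), smul_mul_smul_comm, List.map_cons, List.prod_cons,
        mul_comm (u - z j)]

lemma CC_poly (σ : Equiv.Perm (Fin N)) (l : List (Fin N)) : ∀ k : ℕ,
    ∃ F ∈ PF (Module.End ℂ M) (n * k), ∀ u : ℂ,
    (∀ i < k, ∀ s, u - (i : ℕ) ≠ z s) →
    (∏ i ∈ Finset.range k, ∏ s : Fin n, (u - z s - (i : ℕ))) •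
      CC Q (Tmat V M E φ z) σ l k u = F u := by
  induction l with
  | nil =>
    intro k
    cases k with
    | zero => exact ⟨_, PF_basic (Polynomial.C (1 : ℂ)) (by simp) 1, fun u _ => by simp [CC]⟩
    | succ k => exact ⟨0, Submodule.zero_mem _, fun u _ => by simp [CC]⟩
  | cons a l ih =>
    intro k
    cases k with
    | zero =>
      obtain ⟨F, hF, hF2⟩ := ih 0
      by_cases h : a = σ a
      · refine ⟨F, hF, fun u hu => ?_⟩
        rw [CC, if_pos h, hF2 u hu]
      · refine ⟨0, Submodule.zero_mem _, fun u hu => ?_⟩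
        rw [CC, if_neg h, smul_zero, Pi.zero_apply]
    | succ k =>
      obtain ⟨F, hF, hF2⟩ := ih (k + 1)
      obtain ⟨G, hG, hG2⟩ := ih k
      obtain ⟨H, hH, hH2⟩ := TR_poly E φ z (List.finRange n) a (σ a)
      have hHG : (fun u => H u * G (u - 1)) ∈ PF (Module.End ℂ M) (n * (k + 1)) := by
        have := PF_mul hH (PF_shift hG)
        refine PF_mono ?_ this
        rw [List.length_finRange]
        ring_nf
        rfl
      refine ⟨(if a = σ a then F else 0) - Q a • (fun u => H u * G (u - 1)),
        Submodule.sub_mem _ ?_ (Submodule.smul_mem _ _ hHG), ?_⟩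
      · split_ifs
        · exact hF
        · exact Submodule.zero_mem _
      · intro u hu
        rw [CC, smul_sub, Pi.sub_apply]
        congr 1
        · split_ifs
          · exact hF2 u hu
          · simp
        · have hT := hH2 u (fun s _ => by
            have := hu 0 (Nat.succ_pos _) s
            simpa using this)
          rw [← List.ofFn_eq_map, List.prod_ofFn] at hT
          have hC := hG2 (u - 1) (fun i hi s => by
            have := hu (i + 1) (by omega) s
            intro h'
            apply this
            rw [← h']
            push_cast
            ring)
          have hp : (∏ i ∈ Finset.range (k + 1), ∏ s : Fin n, (u - z s - (i : ℕ))) =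
              (∏ s : Fin n, (u - z s)) *
              ∏ i ∈ Finset.range k, ∏ s : Fin n, (u - 1 - z s - (i : ℕ)) := by
            rw [Finset.prod_range_succ', mul_comm]
            congr 1
            · simp
            · refine Finset.prod_congr rfl fun i _ => Finset.prod_congr rfl fun s _ => ?_
              push_cast
              ring
          rw [hp, smul_comm, Tmat_eq, ← smul_mul_smul_comm, hT, hC]
          rfl

end PolyT

section Asym

open Filter Topology

variable {M : Type*} [NormedAddCommGroup M] [NormedSpace ℂ M]

/-- First order asymptotics at infinity. -/
def VA (g : ℂ → M) (g0 g1 : M) : Prop :=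
  Tendsto g (Bornology.cobounded ℂ) (𝓝 g0) ∧
  Tendsto (fun u : ℂ => u • (g u - g0)) (Bornology.cobounded ℂ) (𝓝 g1)

lemma VA_const (w : M) : VA (fun _ => w) w 0 := by
  refine ⟨tendsto_const_nhds, ?_⟩
  simp

lemma VA_add {f g : ℂ → M} {f0 f1 g0 g1 : M} (hf : VA f f0 f1) (hg : VA g g0 g1) :
    VA (fun u => f u + g u) (f0 + g0) (f1 + g1) := by
  refine ⟨hf.1.add hg.1, (hf.2.add hg.2).congr fun u => ?_⟩
  rw [← smul_add]
  congr 1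
  exact sub_add_sub_comm (f u) f0 (g u) g0

lemma VA_smul {f : ℂ → M} {f0 f1 : M} (c : ℂ) (hf : VA f f0 f1) :
    VA (fun u => c • f u) (c • f0) (c • f1) := by
  refine ⟨hf.1.const_smul c, (hf.2.const_smul c).congr fun u => ?_⟩
  rw [smul_comm, smul_sub]

lemma VA_sum {ι : Type*} (s : Finset ι) {f : ι → ℂ → M} {f0 f1 : ι → M}
    (h : ∀ i, VA (f i) (f0 i) (f1 i)) :
    VA (fun u => ∑ i ∈ s, f i u) (∑ i ∈ s, f0 i) (∑ i ∈ s, f1 i) := by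
  classical
  induction s using Finset.induction_on with
  | empty => simpa using VA_const (0 : M)
  | insert a s ha ih =>
    simp only [Finset.sum_insert ha]
    exact VA_add (h a) ih

lemma VA_shift {f : ℂ → M} {f0 f1 : M} (hf : VA f f0 f1) :
    VA (fun u => f (u - 1)) f0 f1 := by
  have ht : Tendsto (fun u : ℂ => u - 1) (Bornology.cobounded ℂ) (Bornology.cobounded ℂ) :=
    tendsto_sub_const_cobounded 1
  have h1 := hf.1.comp ht
  refine ⟨h1, ?_⟩
  have h2 := (hf.2.comp ht).add (h1.sub_const f0)
  rw [sub_self, add_zero] at h2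
  refine h2.congr fun u => ?_
  simp only [Function.comp_apply, sub_smul, one_smul]
  abel

lemma VA_inv {f : ℂ → M} {f0 f1 : M} (c : ℂ) (hf : VA f f0 f1) :
    VA (fun u => (u - c)⁻¹ • f u) 0 f0 := by
  have ht : Tendsto (fun u : ℂ => u - c) (Bornology.cobounded ℂ) (Bornology.cobounded ℂ) :=
    tendsto_sub_const_cobounded c
  have hi : Tendsto (fun u : ℂ => (u - c)⁻¹) (Bornology.cobounded ℂ) (𝓝 0) :=
    tendsto_inv₀_cobounded.comp ht
  refine ⟨by simpa using hi.smul hf.1, ?_⟩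
  have h1 : Tendsto (fun u : ℂ => (1 + c * (u - c)⁻¹) • f u) (Bornology.cobounded ℂ) (𝓝 f0) := by
    simpa using ((hi.const_mul c).const_add 1).smul hf.1
  refine h1.congr' ?_
  have hne : ∀ᶠ u : ℂ in Bornology.cobounded ℂ, u ≠ c := Bornology.eventually_ne_cobounded c
  filter_upwards [hne] with u hu
  have : u - c ≠ 0 := sub_ne_zero.2 hu
  rw [sub_zero, smul_smul]
  congr 1
  field_simp
  ring

lemma VA_linear [FiniteDimensional ℂ M] {f : ℂ → M} {f0 f1 : M} (A : Module.End ℂ M)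
    (hf : VA f f0 f1) : VA (fun u => A (f u)) (A f0) (A f1) := by
  have hc : Continuous A := LinearMap.continuous_of_finiteDimensional A
  refine ⟨(hc.tendsto _).comp hf.1, ((hc.tendsto _).comp hf.2).congr fun u => ?_⟩
  simp

lemma VA_congr {f : ℂ → M} {f0 f1 g0 g1 : M} (hf : VA f f0 f1) (h0 : f0 = g0) (h1 : f1 = g1) :
    VA f g0 g1 := by
  subst h0 h1; exact hf

end Asym

section AsymT

variable {N n : ℕ} {V : Fin n → Type*} [∀ i, AddCommGroup (V i)] [∀ i, Module ℂ (V i)]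
  {M : Type*} [NormedAddCommGroup M] [NormedSpace ℂ M] [FiniteDimensional ℂ M]
  (E : ∀ i : Fin n, Fin N → Fin N → (V i →ₗ[ℂ] V i)) (φ : M ≃ₗ[ℂ] PiTensorProduct ℂ V)
  (z : Fin n → ℂ) (Q : Fin N → ℂ)

lemma Lmat_VA (j : Fin n) (a b : Fin N) (g : ℂ → M) (g0 g1 : M) (hg : VA g g0 g1) :
    VA (fun u => Lmat V M E φ z j u a b (g u)) (if a = b then g0 else 0)
      ((if a = b then g1 else 0) + EE V M E φ j b a g0) := by
  have h1 := VA_inv (z j) (VA_linear (EE V M E φ j b a) hg)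
  by_cases hab : a = b
  · have := VA_add hg h1
    rw [add_zero] at this
    simpa [Lmat, hab] using this
  · simpa [Lmat, hab] using h1

lemma TR_VA (js : List (Fin n)) : ∀ (a b : Fin N) (g : ℂ → M) (g0 g1 : M), VA g g0 g1 →
    VA (fun u => TR E φ z js u a b (g u)) (if a = b then g0 else 0)
      ((if a = b then g1 else 0) + (js.map fun j => EE V M E φ j b a g0).sum) := by
  induction js with
  | nil =>
    intro a b g g0 g1 hg
    by_cases hab : a = b
    · subst hab; simpa [TR_nil] using hg
    · simpa [TR_nil, hab] using VA_const (0 : M)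
  | cons j js ih =>
    intro a b g g0 g1 hg
    have h := VA_sum Finset.univ (fun c => ih a c _ _ _ (Lmat_VA E φ z j c b g g0 g1 hg))
    have he : (fun u => TR E φ z (j :: js) u a b (g u)) = fun u =>
        ∑ c, TR E φ z js u a c (Lmat V M E φ z j u c b (g u)) := by
      funext u
      rw [TR_cons, Matrix.mul_apply, LinearMap.sum_apply]
      rfl
    rw [he]
    refine VA_congr h ?_ ?_
    · rw [Finset.sum_eq_single a] <;> simp +contextual [eq_comm]
    · rw [Finset.sum_add_distrib]
      have e1 : ∑ c, (if a = c then ((if c = b then g1 else 0) + EE V M E φ j b c g0) else 0) =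
          (if a = b then g1 else 0) + EE V M E φ j b a g0 := by
        rw [Finset.sum_ite_eq]; simp
      have e2 : ∑ c, (js.map fun k => EE V M E φ k c a (if c = b then g0 else 0)).sum =
          (js.map fun k => EE V M E φ k b a g0).sum := by
        rw [Finset.sum_eq_single b]
        · simp
        · intro c _ hc; simp [hc]
        · simp
      rw [e1, e2, List.map_cons, List.sum_cons, add_assoc]

/-- Total action of `e_{ab}`. -/
def Etot (a b : Fin N) : Module.End ℂ M := ∑ j : Fin n, EE V M E φ j a b

lemma Tmat_VA (a b : Fin N) (g : ℂ → M) (g0 g1 : M) (hg : VA g g0 g1) :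
    VA (fun u => Tmat V M E φ z u a b (g u)) (if a = b then g0 else 0)
      ((if a = b then g1 else 0) + Etot E φ b a g0) := by
  have := TR_VA E φ z (List.finRange n) a b g g0 g1 hg
  simp only [← Tmat_eq] at this
  rw [← List.ofFn_eq_map, List.sum_ofFn, ← LinearMap.sum_apply] at this
  exact this

lemma CC_step (σ : Equiv.Perm (Fin N)) (a : Fin N) (l : List (Fin N)) (k : ℕ) (w p0 p1 q0 q1 : M)
    (hp : VA (fun u => CC Q (Tmat V M E φ z) σ l (k + 1) u w) p0 p1)
    (hq : VA (fun u => CC Q (Tmat V M E φ z) σ l k u w) q0 q1) :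
    VA (fun u => CC Q (Tmat V M E φ z) σ (a :: l) (k + 1) u w)
      ((if a = σ a then p0 else 0) + (-Q a) • (if a = σ a then q0 else 0))
      ((if a = σ a then p1 else 0) + (-Q a) • ((if a = σ a then q1 else 0) +
        Etot E φ (σ a) a q0)) := by
  have h2 := VA_smul (-Q a) (Tmat_VA E φ z a (σ a) _ _ _ (VA_shift hq))
  have h1 : VA (fun u => (if a = σ a then CC Q (Tmat V M E φ z) σ l (k + 1) u else 0) w)
      (if a = σ a then p0 else 0) (if a = σ a then p1 else 0) := by
    split_ifs
    · exact hp
    · simpa using VA_const (0 : M)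
  have h := VA_add h1 h2
  have he : (fun u => CC Q (Tmat V M E φ z) σ (a :: l) (k + 1) u w) = fun u =>
      (if a = σ a then CC Q (Tmat V M E φ z) σ l (k + 1) u else 0) w +
      (-Q a) • (Tmat V M E φ z u a (σ a)) (CC Q (Tmat V M E φ z) σ l k (u - 1) w) := by
    funext u
    rw [CC, LinearMap.sub_apply, LinearMap.smul_apply, Module.End.mul_apply, neg_smul,
      sub_eq_add_neg]
  rw [he]
  exact h

lemma CC_step0 (σ : Equiv.Perm (Fin N)) (a : Fin N) (l : List (Fin N)) (w p0 p1 : M)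
    (hp : VA (fun u => CC Q (Tmat V M E φ z) σ l 0 u w) p0 p1) :
    VA (fun u => CC Q (Tmat V M E φ z) σ (a :: l) 0 u w)
      (if a = σ a then p0 else 0) (if a = σ a then p1 else 0) := by
  simp only [CC]
  split_ifs
  · exact hp
  · simpa using VA_const (0 : M)

lemma CC_VA0 (σ : Equiv.Perm (Fin N)) (w : M) (l : List (Fin N)) : ∀ k : ℕ, ∃ g0 g1 : M,
    VA (fun u => CC Q (Tmat V M E φ z) σ l k u w) g0 g1 := by
  induction l with
  | nil =>
    intro k
    cases k with
    | zero => exact ⟨w, 0, by simpa [CC] using VA_const w⟩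
    | succ k => exact ⟨0, 0, by simpa [CC] using VA_const (0 : M)⟩
  | cons a l ih =>
    intro k
    cases k with
    | zero =>
      obtain ⟨p0, p1, hp⟩ := ih 0
      exact ⟨_, _, CC_step0 E φ z Q σ a l w p0 p1 hp⟩
    | succ k =>
      obtain ⟨p0, p1, hp⟩ := ih (k + 1)
      obtain ⟨q0, q1, hq⟩ := ih k
      exact ⟨_, _, CC_step E φ z Q σ a l k w p0 p1 q0 q1 hp hq⟩

lemma CC_VA1 (σ : Equiv.Perm (Fin N)) (w : M) (l : List (Fin N)) (hl : ∃ a ∈ l, a ≠ σ a) :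
    ∀ k : ℕ, ∃ g1 : M, VA (fun u => CC Q (Tmat V M E φ z) σ l k u w) 0 g1 := by
  induction l with
  | nil => simp at hl
  | cons a l ih =>
    intro k
    by_cases ha : a = σ a
    · have hl' : ∃ a ∈ l, a ≠ σ a := by
        obtain ⟨b, hb, hb2⟩ := hl
        rcases List.mem_cons.1 hb with rfl | hb
        · exact absurd ha hb2
        · exact ⟨b, hb, hb2⟩
      cases k with
      | zero =>
        obtain ⟨p1, hp⟩ := ih hl' 0
        exact ⟨_, VA_congr (CC_step0 E φ z Q σ a l w 0 p1 hp) (by simp) rfl⟩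
      | succ k =>
        obtain ⟨p1, hp⟩ := ih hl' (k + 1)
        obtain ⟨q1, hq⟩ := ih hl' k
        exact ⟨_, VA_congr (CC_step E φ z Q σ a l k w 0 p1 0 q1 hp hq) (by simp) rfl⟩
    · cases k with
      | zero =>
        obtain ⟨p0, p1, hp⟩ := CC_VA0 E φ z Q σ w l 0
        exact ⟨_, VA_congr (CC_step0 E φ z Q σ a l w p0 p1 hp) (by simp [ha]) rfl⟩
      | succ k =>
        obtain ⟨p0, p1, hp⟩ := CC_VA0 E φ z Q σ w l (k + 1)
        obtain ⟨q0, q1, hq⟩ := CC_VA0 E φ z Q σ w l k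
        exact ⟨_, VA_congr (CC_step E φ z Q σ a l k w p0 p1 q0 q1 hp hq) (by simp [ha]) rfl⟩

lemma CC_VA2 (σ : Equiv.Perm (Fin N)) (w : M) (l : List (Fin N))
    (hl : ∃ a ∈ l, ∃ b ∈ l, a ≠ b ∧ a ≠ σ a ∧ b ≠ σ b) :
    ∀ k : ℕ, VA (fun u => CC Q (Tmat V M E φ z) σ l k u w) 0 0 := by
  induction l with
  | nil => simp at hl
  | cons a l ih =>
    intro k
    by_cases ha : a = σ a
    · have hl' : ∃ a ∈ l, ∃ b ∈ l, a ≠ b ∧ a ≠ σ a ∧ b ≠ σ b := by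
        obtain ⟨b, hb, c, hc, h1, h2, h3⟩ := hl
        refine ⟨b, ?_, c, ?_, h1, h2, h3⟩
        · rcases List.mem_cons.1 hb with rfl | hb
          · exact absurd ha h2
          · exact hb
        · rcases List.mem_cons.1 hc with rfl | hc
          · exact absurd ha h3
          · exact hc
      cases k with
      | zero =>
        exact VA_congr (CC_step0 E φ z Q σ a l w 0 0 (ih hl' 0)) (by simp) (by simp)
      | succ k =>
        exact VA_congr (CC_step E φ z Q σ a l k w 0 0 0 0 (ih hl' (k + 1)) (ih hl' k))
          (by simp) (by simp)
    · have hl' : ∃ b ∈ l, b ≠ σ b := by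
        obtain ⟨b, hb, c, hc, h1, h2, h3⟩ := hl
        rcases List.mem_cons.1 hb with rfl | hb
        · rcases List.mem_cons.1 hc with rfl | hc
          · exact absurd rfl h1
          · exact ⟨c, hc, h3⟩
        · exact ⟨b, hb, h2⟩
      cases k with
      | zero =>
        obtain ⟨p1, hp⟩ := CC_VA1 E φ z Q σ w l hl' 0
        exact VA_congr (CC_step0 E φ z Q σ a l w 0 p1 hp) (by simp) (by simp [ha])
      | succ k =>
        obtain ⟨p1, hp⟩ := CC_VA1 E φ z Q σ w l hl' (k + 1)
        obtain ⟨q1, hq⟩ := CC_VA1 E φ z Q σ w l hl' k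
        exact VA_congr (CC_step E φ z Q σ a l k w 0 p1 0 q1 hp hq) (by simp) (by simp [ha])

/-- Leading coefficients. -/
def al (Q : Fin N → ℂ) : List (Fin N) → ℕ → ℂ
  | [], 0 => 1
  | [], _ + 1 => 0
  | _ :: l, 0 => al Q l 0
  | a :: l, k + 1 => al Q l (k + 1) - Q a * al Q l k

/-- Subleading coefficients. -/
def be (Q : Fin N → ℂ) (m : Fin N → ℤ) : List (Fin N) → ℕ → ℂ
  | [], _ => 0
  | _ :: l, 0 => be Q m l 0
  | a :: l, k + 1 => be Q m l (k + 1) - Q a * (be Q m l k + m a * al Q l k)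

lemma CC_VAid (m : Fin N → ℤ) (w : M) (hw : w ∈ Wt V M E φ m) (l : List (Fin N)) :
    ∀ k : ℕ, VA (fun u => CC Q (Tmat V M E φ z) 1 l k u w) (al Q l k • w) (be Q m l k • w) := by
  have hE : ∀ a, Etot E φ a a w = (m a : ℂ) • w := by
    intro a
    have := (Submodule.mem_iInf _).1 hw a
    rw [LinearMap.mem_ker, LinearMap.sub_apply, sub_eq_zero] at this
    simpa [Etot] using this
  induction l with
  | nil =>
    intro k
    cases k with
    | zero => simpa [CC, al, be] using VA_const w
    | succ k => simpa [CC, al, be] using VA_const (0 : M)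
  | cons a l ih =>
    intro k
    cases k with
    | zero => exact VA_congr (CC_step0 E φ z Q 1 a l w _ _ (ih 0)) (by simp [al]) (by simp [be])
    | succ k =>
      refine VA_congr (CC_step E φ z Q 1 a l k w _ _ _ _ (ih (k + 1)) (ih k)) ?_ ?_
      · simp only [al, Equiv.Perm.one_apply, if_true]
        module
      · simp only [be, Equiv.Perm.one_apply, if_true, map_smul, hE]
        module

lemma sum_VA (m : Fin N → ℤ) (w : M) (hw : w ∈ Wt V M E φ m) (k : ℕ) :
    VA (fun u => (((-1 : ℂ) ^ k) • ∑ σ : Equiv.Perm (Fin N), ((Equiv.Perm.sign σ : ℤˣ) : ℤ) •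
      CC Q (Tmat V M E φ z) σ (List.finRange N) k u) w)
      (((-1 : ℂ) ^ k * al Q (List.finRange N) k) • w)
      (((-1 : ℂ) ^ k * be Q m (List.finRange N) k) • w) := by
  have h : ∀ σ : Equiv.Perm (Fin N),
      VA (fun u => (((Equiv.Perm.sign σ : ℤˣ) : ℤ) : ℂ) •
        CC Q (Tmat V M E φ z) σ (List.finRange N) k u w)
      (if σ = 1 then al Q (List.finRange N) k • w else 0)
      (if σ = 1 then be Q m (List.finRange N) k • w else 0) := by
    intro σ
    by_cases hσ : σ = 1
    · subst hσ
      simpa using CC_VAid E φ z Q m w hw (List.finRange N) k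
    · have h2 : 1 < σ.support.card := Equiv.Perm.one_lt_card_support_of_ne_one hσ
      obtain ⟨a, ha, b, hb, hab⟩ := Finset.one_lt_card.1 h2
      rw [Equiv.Perm.mem_support] at ha hb
      have := VA_smul (((Equiv.Perm.sign σ : ℤˣ) : ℤ) : ℂ)
        (CC_VA2 E φ z Q σ w (List.finRange N)
        ⟨a, List.mem_finRange a, b, List.mem_finRange b, hab, ha.symm, hb.symm⟩ k)
      simpa [hσ] using this
  have h2 := VA_smul ((-1 : ℂ) ^ k) (VA_sum Finset.univ h)
  simp only [Finset.sum_ite_eq', Finset.mem_univ, if_true, smul_smul] at h2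
  have he : ∀ u, (((-1 : ℂ) ^ k) • ∑ σ : Equiv.Perm (Fin N), ((Equiv.Perm.sign σ : ℤˣ) : ℤ) •
      CC Q (Tmat V M E φ z) σ (List.finRange N) k u) w =
      ((-1 : ℂ) ^ k) • ∑ σ : Equiv.Perm (Fin N), (((Equiv.Perm.sign σ : ℤˣ) : ℤ) : ℂ) •
        CC Q (Tmat V M E φ z) σ (List.finRange N) k u w := by
    intro u
    rw [LinearMap.smul_apply, LinearMap.sum_apply]
    simp only [LinearMap.smul_apply, Int.cast_smul_eq_zsmul]
  simp only [he]
  exact h2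

lemma al_gt (l : List (Fin N)) : ∀ k, l.length < k → al Q l k = 0 := by
  induction l with
  | nil => intro k hk; cases k with
    | zero => simp at hk
    | succ k => rfl
  | cons a l ih =>
    intro k hk
    cases k with
    | zero => simp at hk
    | succ k =>
      simp only [List.length_cons] at hk
      rw [al, ih _ (by omega), ih _ (by omega)]
      simp

lemma be_gt (m : Fin N → ℤ) (l : List (Fin N)) : ∀ k, l.length < k → be Q m l k = 0 := by
  induction l with
  | nil => intro k hk; cases k <;> rfl
  | cons a l ih =>
    intro k hk
    cases k with
    | zero => simp at hk
    | succ k =>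
      simp only [List.length_cons] at hk
      rw [be, ih _ (by omega), ih _ (by omega), al_gt Q l _ (by omega)]
      simp

lemma al_zero (l : List (Fin N)) : al Q l 0 = 1 := by
  induction l with
  | nil => rfl
  | cons a l ih => rw [al, ih]

lemma be_zero (m : Fin N → ℤ) (l : List (Fin N)) : be Q m l 0 = 0 := by
  induction l with
  | nil => rfl
  | cons a l ih => rw [be, ih]

lemma hom_up (f : ℕ → ℂ) (d : ℕ) (x : ℂ) (hf : f (d + 1) = 0) :
    ∑ k ∈ Finset.range (d + 1 + 1), f k * x ^ (d + 1 - k) =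
      x * ∑ k ∈ Finset.range (d + 1), f k * x ^ (d - k) := by
  rw [Finset.sum_range_succ, hf, zero_mul, add_zero, Finset.mul_sum]
  refine Finset.sum_congr rfl fun k hk => ?_
  have : d + 1 - k = (d - k) + 1 := by have := Finset.mem_range.1 hk; omega
  rw [this, pow_succ]
  ring

lemma hom_rec (f g h : ℕ → ℂ) (q : ℂ) (d : ℕ) (x : ℂ) (hf : f (d + 1) = 0) (h0 : h 0 = f 0)
    (hs : ∀ k, h (k + 1) = f (k + 1) - q * g k) :
    ∑ k ∈ Finset.range (d + 1 + 1), h k * x ^ (d + 1 - k) =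
      x * ∑ k ∈ Finset.range (d + 1), f k * x ^ (d - k)
      - q * ∑ k ∈ Finset.range (d + 1), g k * x ^ (d - k) := by
  rw [← hom_up f d x hf, Finset.sum_range_succ', Finset.sum_range_succ' _ (d + 1), h0,
    Finset.mul_sum]
  have : ∀ k ∈ Finset.range (d + 1), h (k + 1) * x ^ (d + 1 - (k + 1)) =
      f (k + 1) * x ^ (d + 1 - (k + 1)) - q * (g k * x ^ (d - k)) := by
    intro k _
    rw [hs, Nat.add_sub_add_right]
    ring
  rw [Finset.sum_congr rfl this, Finset.sum_sub_distrib]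
  ring

lemma al_hom (x : ℂ) (l : List (Fin N)) (hl : l.Nodup) :
    ∑ k ∈ Finset.range (l.length + 1), al Q l k * x ^ (l.length - k) =
      ∏ i ∈ l.toFinset, (x - Q i) := by
  induction l with
  | nil => simp [al]
  | cons a l ih =>
    rw [List.nodup_cons] at hl
    rw [List.length_cons, hom_rec (al Q l) (al Q l) (al Q (a :: l)) (Q a) l.length x (al_gt Q l _ (Nat.lt_succ_self _))
      rfl (fun k => rfl), ih hl.2, List.toFinset_cons,
      Finset.prod_insert (by simpa using hl.1)]
    ring

lemma be_hom (m : Fin N → ℤ) (x : ℂ) (l : List (Fin N)) (hl : l.Nodup) :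
    ∑ k ∈ Finset.range (l.length + 1), be Q m l k * x ^ (l.length - k) =
      - ∑ j ∈ l.toFinset, (m j : ℂ) * Q j * ∏ i ∈ l.toFinset.erase j, (x - Q i) := by
  induction l with
  | nil => simp [be]
  | cons a l ih =>
    rw [List.nodup_cons] at hl
    have ha : a ∉ l.toFinset := by simpa using hl.1
    rw [List.length_cons, hom_rec (be Q m l) (fun k => be Q m l k + m a * al Q l k) (be Q m (a :: l))
      (Q a) l.length x
      (be_gt Q m l _ (Nat.lt_succ_self _)) rfl (fun k => rfl)]
    simp only [add_mul, Finset.sum_add_distrib, mul_assoc, ← Finset.mul_sum]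
    simp only [mul_assoc] at ih
    rw [al_hom Q x l hl.2, ih hl.2, List.toFinset_cons, Finset.sum_insert ha,
      Finset.erase_insert ha]
    have : ∀ j ∈ l.toFinset, (m j : ℂ) * (Q j * ∏ i ∈ (insert a l.toFinset).erase j, (x - Q i)) =
        (x - Q a) * ((m j : ℂ) * (Q j * ∏ i ∈ l.toFinset.erase j, (x - Q i))) := by
      intro j hj
      have hja : a ≠ j := by rintro rfl; exact ha hj
      rw [Finset.erase_insert_of_ne hja, Finset.prod_insert (by
        intro h'; exact ha (Finset.mem_of_mem_erase h'))]
      ring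
    rw [Finset.sum_congr rfl this, ← Finset.mul_sum]
    ring

lemma good_eventually : ∀ᶠ u : ℂ in Bornology.cobounded ℂ, Good N z u := by
  have h : ∀ᶠ u : ℂ in Bornology.cobounded ℂ, ∀ j : Fin n, ∀ k : Fin N, u ≠ z j + ((k : ℕ) : ℂ) :=
    Filter.eventually_all.2 fun j => Filter.eventually_all.2 fun k =>
      Bornology.eventually_ne_cobounded _
  filter_upwards [h] with u hu j k hk h'
  exact hu j ⟨k, hk⟩ (by rw [← h']; simp)

end AsymT

lemma chi_eq {N n : ℕ} (hN : 2 ≤ N) (z : Fin n → ℂ) (Λ : Fin n → Fin N → ℤ)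
    (hlast : ∀ i, Λ i ⟨N - 1, by omega⟩ = 0) (u : ℂ) (hu : Good N z u) (s : Fin n) :
    chi z Λ u s = ∏ j : Fin (N - 1),
      (u - z s + (Λ s (Fin.castLE (by omega) j) : ℂ) - (j : ℕ)) / (u - z s - (j : ℕ)) := by
  obtain ⟨N', rfl⟩ : ∃ N', N = N' + 1 := ⟨N - 1, by omega⟩
  have hl : Λ s (Fin.last N') = 0 := hlast s
  rw [chi, Fin.prod_univ_castSucc, hl, Int.cast_zero, mul_zero, add_zero, mul_one]
  refine Finset.prod_congr rfl fun j _ => ?_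
  have hj : u - z s - ((j : ℕ) : ℂ) ≠ 0 := by
    intro h
    refine hu s j (by omega) ?_
    linear_combination h
  have e : (Fin.castLE (by omega) j : Fin (N' + 1)) = Fin.castSucc j := rfl
  rw [e, Fin.val_castSucc]
  field_simp
  ring

/-- Properties of the XXX transfer matrices `𝕋_k(u)` (the coefficients of
the universal difference operator `D_{Q,M}(u,τ) = ∑ (−1)^k 𝕋_k(u) τ^{−k}` for diagonal
invertible `Q`), restricted to the weight subspace `M[m]`:
(i) the limits `𝕋_{k,0} = lim_{u→∞} 𝕋_k(u)` and `𝕋_{k,1} = lim_{u→∞} u(𝕋_k(u) − 𝕋_{k,0})`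
exist and are scalar operators `t0 k`, `t1 k` satisfying
`x^N + ∑ (−1)^k t0_k x^{N−k} = ∏ (x − Q_i)` and
`∑ (−1)^k t1_k x^{N−k} = −∑_j m_j Q_j ∏_{i≠j} (x − Q_i)`;
(ii) `𝕋_N(u)` is the explicit scalar function, and for `1 ≤ k ≤ N−1` the function
`∏_{i=1}^k ∏_s (u − z_s − i + 1) · 𝕋_k(u)` is a polynomial in `u` of degree at most `nk`. -/
theorem statement_2
    {N n : ℕ} (hN : 2 ≤ N) (hn : 1 ≤ n)
    (V : Fin n → Type*) [∀ i, AddCommGroup (V i)] [∀ i, Module ℂ (V i)]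
    [∀ i, FiniteDimensional ℂ (V i)]
    (M : Type*) [NormedAddCommGroup M] [NormedSpace ℂ M] [FiniteDimensional ℂ M]
    (Λ : Fin n → Fin N → ℤ)
    (hdom : ∀ i, ∀ a b : Fin N, a ≤ b → Λ i b ≤ Λ i a)
    (hpoly : ∀ i a, 0 ≤ Λ i a)
    (hlast : ∀ i, Λ i ⟨N - 1, by omega⟩ = 0)
    (E : ∀ i : Fin n, Fin N → Fin N → (V i →ₗ[ℂ] V i))
    (hrel : GlRel V E)
    (hhw : IsHW V E Λ)
    (φ : M ≃ₗ[ℂ] PiTensorProduct ℂ V)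
    (z : Fin n → ℂ)
    (Q : Fin N → ℂ) (hQ : ∀ i, Q i ≠ 0)
    (m : Fin N → ℤ)
    -- `𝕋 k` are the XXX transfer matrices:
    (𝕋 : ℕ → ℂ → Module.End ℂ M)
    (h𝕋 : ∀ (f : ℂ → M) (u : ℂ), Good N z u →
      Dop V M E φ z (Matrix.diagonal Q) f u =
        ∑ k ∈ Finset.range (N + 1), ((-1 : ℤ) ^ k) • 𝕋 k u (f (u - (k : ℂ)))) :
    ∃ (t0 t1 : ℕ → ℂ) (P : ℕ → Polynomial (Module.End ℂ M)),
      -- (i) the limits exist and are the scalar operators `t0 k`, `t1 k` on `M[m]`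
      (∀ k, 1 ≤ k → k ≤ N → ∀ w ∈ Wt V M E φ m,
        Filter.Tendsto (fun u : ℂ => 𝕋 k u w) (Bornology.cobounded ℂ)
          (nhds (t0 k • w)) ∧
        Filter.Tendsto (fun u : ℂ => u • (𝕋 k u w - t0 k • w)) (Bornology.cobounded ℂ)
          (nhds (t1 k • w))) ∧
      (∀ x : ℂ, x ^ N + ∑ k ∈ Finset.Icc 1 N, (-1 : ℂ) ^ k * t0 k * x ^ (N - k) =
        ∏ i : Fin N, (x - Q i)) ∧
      (∀ x : ℂ, ∑ k ∈ Finset.Icc 1 N, (-1 : ℂ) ^ k * t1 k * x ^ (N - k) =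
        - ∑ j : Fin N, (m j : ℂ) * Q j * ∏ i ∈ Finset.univ.erase j, (x - Q i)) ∧
      -- (ii) the explicit form of `𝕋_N(u)` on `M[m]` …
      (∀ u : ℂ, Good N z u → ∀ w ∈ Wt V M E φ m,
        𝕋 N u w = ((∏ i : Fin N, Q i) * ∏ s : Fin n, ∏ j : Fin (N - 1),
          (u - z s + (Λ s (Fin.castLE (by omega) j) : ℂ) - (j : ℕ)) /
            (u - z s - (j : ℕ))) • w) ∧
      -- … and `∏_{i=1}^{k} ∏_s (u − z_s − i + 1) 𝕋_k(u)` is polynomial of degree ≤ nk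
      (∀ k, 1 ≤ k → k < N →
        (P k).natDegree ≤ n * k ∧
        ∀ u : ℂ, Good N z u → ∀ w ∈ Wt V M E φ m,
          (∏ i ∈ Finset.range k, ∏ s : Fin n, (u - z s - (i : ℕ))) • 𝕋 k u w =
            (P k).eval (u • (1 : Module.End ℂ M)) w) := by
  have hPk : ∀ k : ℕ, ∃ P : Polynomial (Module.End ℂ M), k ≤ N → P.natDegree ≤ n * k ∧
      ∀ u : ℂ, Good N z u →
        (∏ i ∈ Finset.range k, ∏ s : Fin n, (u - z s - (i : ℕ))) • 𝕋 k u =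
          P.eval (u • (1 : Module.End ℂ M)) := by
    intro k
    by_cases hk : k ≤ N
    · choose F hF hF2 using fun σ => CC_poly E φ z Q σ (List.finRange N) k
      have hsum : (((-1 : ℂ) ^ k) • ∑ σ : Equiv.Perm (Fin N),
          (((Equiv.Perm.sign σ : ℤˣ) : ℤ) : ℂ) • F σ) ∈ PF (Module.End ℂ M) (n * k) :=
        Submodule.smul_mem _ _ (Submodule.sum_mem _ fun σ _ => Submodule.smul_mem _ _ (hF σ))
      obtain ⟨P, hP, hP2⟩ := PF_toPoly hsum
      refine ⟨P, fun _ => ⟨hP, fun u hu => ?_⟩⟩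
      rw [hP2, TT_eq E φ z Q 𝕋 h𝕋 k hk u hu, smul_comm]
      simp only [Pi.smul_apply, Finset.sum_apply]
      congr 1
      rw [Finset.smul_sum]
      refine Finset.sum_congr rfl fun σ _ => ?_
      rw [smul_comm, hF2 σ u (fun i hi s => hu s i (by omega)), Int.cast_smul_eq_zsmul]
    · exact ⟨0, fun h => absurd h hk⟩
  choose P hP using hPk
  have hsq : ∀ k : ℕ, (-1 : ℂ) ^ k * (-1 : ℂ) ^ k = 1 := fun k => by
    rw [← mul_pow]; simp
  have hrange : Finset.range (N + 1) = insert 0 (Finset.Icc 1 N) := by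
    ext i; simp only [Finset.mem_range, Finset.mem_insert, Finset.mem_Icc]; omega
  have h0 : (0 : ℕ) ∉ Finset.Icc 1 N := by simp
  have huniv : (List.finRange N).toFinset = Finset.univ := by ext; simp
  refine ⟨fun k => (-1 : ℂ) ^ k * al Q (List.finRange N) k,
    fun k => (-1 : ℂ) ^ k * be Q m (List.finRange N) k, P, ?_, ?_, ?_, ?_, ?_⟩
  · intro k _ hk w hw
    have h := sum_VA E φ z Q m w hw k
    have he := good_eventually (N := N) z
    refine ⟨h.1.congr' ?_, h.2.congr' ?_⟩
    · filter_upwards [he] with u hu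
      rw [TT_eq E φ z Q 𝕋 h𝕋 k hk u hu]
    · filter_upwards [he] with u hu
      rw [TT_eq E φ z Q 𝕋 h𝕋 k hk u hu]
  · intro x
    have h := al_hom Q x (List.finRange N) (List.nodup_finRange N)
    rw [List.length_finRange, huniv, hrange, Finset.sum_insert h0, al_zero] at h
    rw [← h, one_mul, Nat.sub_zero]
    congr 1
    refine Finset.sum_congr rfl fun k _ => ?_
    rw [← mul_assoc, hsq, one_mul]
  · intro x
    have h := be_hom Q m x (List.finRange N) (List.nodup_finRange N)
    rw [List.length_finRange, huniv, hrange, Finset.sum_insert h0, be_zero, zero_mul,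
      zero_add] at h
    rw [← h]
    refine Finset.sum_congr rfl fun k _ => ?_
    rw [← mul_assoc, hsq, one_mul]
  · intro u hu w _
    rw [TT_eq E φ z Q 𝕋 h𝕋 N le_rfl u hu, TT_top E φ z Q Λ hrel hhw u hu,
      LinearMap.smul_apply, Module.End.one_apply]
    congr 2
    refine Finset.prod_congr rfl fun s _ => ?_
    exact chi_eq hN z Λ hlast u hu s
  · intro k _ hk
    refine ⟨(hP k hk.le).1, fun u hu w _ => ?_⟩
    rw [← (hP k hk.le).2 u hu, LinearMap.smul_apply]

end XXXModel
end
end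

section
/- Assume Q is the identity matrix. Define End(sing M[m])-valued functions S_k(u), k = 0,…,N, by the operator identity D_{Q=1,M}(u,τ) τ^N = Σ_{k=0}^N (−1)^k S_k(u) (τ − 1)^{N−k} on sing M[m]-valued functions. Then: (i) S_0(u) = 1; (ii) for each k = 1,…,N the limit S_{k,0} = lim_{u→∞} u^k S_k(u) exists and is a scalar operator; (iii) for every d ∈ ℂ, Σ_{k=0}^N (−1)^k S_{k,0} ∏_{j=0}^{N−k−1} (d − j) = ∏_{s=1}^N (d − m_s − N + s) · Id. -/
noncomputable section

namespace XXXModel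

/-! ### Asymptotic expansions at infinity -/

section Asymptotics

open Filter Topology

variable {M : Type*} [NormedAddCommGroup M] [NormedSpace ℂ M]

/-- `g` has an expansion `u^d (c + O(1/u))` at infinity, given by an analytic function
of `1/u`. -/
def Asy (d : ℤ) (g : ℂ → M) (c : M) : Prop :=
  ∃ h : ℂ → M, AnalyticAt ℂ h 0 ∧ h 0 = c ∧
    ∀ᶠ u in Bornology.cobounded ℂ, g u = u ^ d • h u⁻¹

lemma ev_ne (t : ℂ) : ∀ᶠ u in Bornology.cobounded ℂ, u ≠ t :=
  Bornology.eventually_ne_cobounded t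

lemma Asy.congr {d : ℤ} {g g' : ℂ → M} {c : M} (hg : Asy d g c)
    (e : ∀ᶠ u in Bornology.cobounded ℂ, g' u = g u) : Asy d g' c := by
  obtain ⟨h, h1, h2, h3⟩ := hg
  refine ⟨h, h1, h2, ?_⟩
  filter_upwards [h3, e] with u a b
  rw [b, a]

lemma Asy.zero (d : ℤ) : Asy d (fun _ => (0 : M)) 0 :=
  ⟨fun _ => 0, analyticAt_const, rfl, by simp⟩

lemma Asy.add {d : ℤ} {g g' : ℂ → M} {c c' : M} (hg : Asy d g c) (hg' : Asy d g' c') :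
    Asy d (fun u => g u + g' u) (c + c') := by
  obtain ⟨h, h1, h2, h3⟩ := hg
  obtain ⟨k, k1, k2, k3⟩ := hg'
  refine ⟨fun s => h s + k s, h1.add k1, by simp [h2, k2], ?_⟩
  filter_upwards [h3, k3] with u a b
  rw [a, b, smul_add]

lemma Asy.sum {d : ℤ} {ι : Type*} (s : Finset ι) {g : ι → ℂ → M} {c : ι → M}
    (hg : ∀ i ∈ s, Asy d (g i) (c i)) :
    Asy d (fun u => ∑ i ∈ s, g i u) (∑ i ∈ s, c i) := by
  classical
  induction s using Finset.induction_on with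
  | empty => simpa using Asy.zero d
  | insert a s ha ih =>
    simp only [Finset.sum_insert ha]
    exact (hg a (by simp)).add (ih fun i hi => hg i (by simp [hi]))

lemma Asy.smul {d e : ℤ} {p : ℂ → ℂ} {g : ℂ → M} {b : ℂ} {c : M} (hp : Asy d p b)
    (hg : Asy e g c) : Asy (d + e) (fun u => p u • g u) (b • c) := by
  obtain ⟨h, h1, h2, h3⟩ := hp
  obtain ⟨k, k1, k2, k3⟩ := hg
  refine ⟨fun s => h s • k s, h1.smul k1, by simp [h2, k2], ?_⟩
  filter_upwards [h3, k3, ev_ne 0] with u a b hu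
  rw [a, b, zpow_add₀ hu, smul_eq_mul, smul_smul, smul_smul]
  congr 1; ring

lemma Asy.pow (d : ℕ) : Asy (d : ℤ) (fun u : ℂ => u ^ d) (1 : ℂ) :=
  ⟨fun _ => 1, analyticAt_const, rfl, by simp⟩

lemma Asy.const (w : M) : Asy 0 (fun _ : ℂ => w) w :=
  ⟨fun _ => w, analyticAt_const, rfl, by simp⟩

lemma Asy.const_smul {d : ℤ} {g : ℂ → M} {c : M} (b : ℂ) (hg : Asy d g c) :
    Asy d (fun u => b • g u) (b • c) := by
  simpa using (Asy.const b).smul hg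

lemma Asy.sub {d : ℤ} {g g' : ℂ → M} {c c' : M} (hg : Asy d g c) (hg' : Asy d g' c') :
    Asy d (fun u => g u - g' u) (c - c') := by
  simpa [sub_eq_add_neg] using hg.add (hg'.const_smul (-1))

lemma Asy.weaken {d : ℤ} {g : ℂ → M} {c : M} (hg : Asy (d - 1) g c) : Asy d g 0 := by
  obtain ⟨h, h1, h2, h3⟩ := hg
  refine ⟨fun s => s • h s, analyticAt_id.smul h1, by simp, ?_⟩
  filter_upwards [h3, ev_ne 0] with u a hu
  rw [a, zpow_sub_one₀ hu, smul_smul]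

lemma Asy.lin [FiniteDimensional ℂ M] {d : ℤ} {g : ℂ → M} {c : M} (A : Module.End ℂ M)
    (hg : Asy d g c) : Asy d (fun u => A (g u)) (A c) := by
  obtain ⟨h, h1, h2, h3⟩ := hg
  refine ⟨fun s => A (h s), ?_, by simp [h2], ?_⟩
  · exact ((LinearMap.toContinuousLinearMap A).analyticAt _).comp h1
  · filter_upwards [h3] with u a
    rw [a, map_smul]

lemma shift_analytic (t : ℂ) (d : ℤ) {h : ℂ → M} (h1 : AnalyticAt ℂ h 0) :
    AnalyticAt ℂ (fun s : ℂ => (1 + t * s) ^ d • h (s * (1 + t * s)⁻¹)) 0 := by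
  have a1 : AnalyticAt ℂ (fun s : ℂ => 1 + t * s) 0 := by fun_prop
  have a2 : AnalyticAt ℂ (fun s : ℂ => s * (1 + t * s)⁻¹) 0 :=
    analyticAt_id.mul (a1.inv (by simp))
  refine (a1.zpow (by simp)).smul ?_
  exact AnalyticAt.fun_comp (by simpa using h1) a2

lemma shift_eq (t : ℂ) (d : ℤ) (h : ℂ → M) {u : ℂ} (hu : u ≠ 0) :
    (u + t) ^ d • h (u + t)⁻¹ = u ^ d • ((1 + t * u⁻¹) ^ d • h (u⁻¹ * (1 + t * u⁻¹)⁻¹)) := by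
  have e : u + t = u * (1 + t * u⁻¹) := by field_simp
  rw [e, mul_zpow, mul_inv, smul_smul]

lemma tendsto_add_cobounded (t : ℂ) :
    Tendsto (fun u : ℂ => u + t) (Bornology.cobounded ℂ) (Bornology.cobounded ℂ) := by
  rw [← tendsto_norm_atTop_iff_cobounded]
  refine tendsto_atTop_mono (f := fun u : ℂ => ‖u‖ - ‖t‖) ?_ ?_
  · intro u
    have := norm_sub_norm_le u (-t)
    simpa using this
  · exact tendsto_atTop_add_const_right _ _ tendsto_norm_cobounded_atTop

lemma Asy.shift {d : ℤ} {g : ℂ → M} {c : M} (t : ℂ) (hg : Asy d g c) :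
    Asy d (fun u => g (u + t)) c := by
  obtain ⟨h, h1, h2, h3⟩ := hg
  refine ⟨_, shift_analytic t d h1, by simp [h2], ?_⟩
  filter_upwards [(tendsto_add_cobounded t).eventually h3, ev_ne 0] with u a hu
  rw [a, shift_eq t d h hu]

lemma Asy.diff {d : ℤ} {g : ℂ → M} {c : M} (hg : Asy d g c) :
    Asy (d - 1) (fun u => g u - g (u - 1)) ((d : ℂ) • c) := by
  obtain ⟨h, h1, h2, h3⟩ := hg
  set k : ℂ → M := fun s => h s - (1 + (-1) * s) ^ d • h (s * (1 + (-1) * s)⁻¹) with hk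
  have ka : AnalyticAt ℂ k 0 := h1.sub (shift_analytic (-1) d h1)
  have k0 : k 0 = 0 := by simp [hk]
  have kd : HasDerivAt k ((d : ℂ) • c) 0 := by
    have e1 : HasDerivAt (fun s : ℂ => 1 + (-1) * s) (-1) 0 := by
      simpa using ((hasDerivAt_id (0 : ℂ)).const_mul (-1)).const_add 1
    have e2 : HasDerivAt (fun s : ℂ => (1 + (-1) * s) ^ d) (-(d : ℂ)) 0 := by
      have := (hasDerivAt_zpow d (1 + (-1) * (0 : ℂ)) (Or.inl (by simp))).comp (0 : ℂ) e1
      exact HasDerivAt.congr_deriv this (by simp)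
    have e3 : HasDerivAt (fun s : ℂ => s * (1 + (-1) * s)⁻¹) 1 0 := by
      have := (hasDerivAt_id (0 : ℂ)).mul (e1.inv (by simp))
      exact HasDerivAt.congr_deriv this (by simp)
    have e4 : HasDerivAt h (deriv h 0) 0 := h1.differentiableAt.hasDerivAt
    have e5 : HasDerivAt (fun s : ℂ => h (s * (1 + (-1) * s)⁻¹)) (deriv h 0) 0 := by
      have e4' : HasDerivAt h (deriv h 0) ((0 : ℂ) * (1 + (-1) * 0)⁻¹) := by
        rw [zero_mul]; exact e4
      exact HasDerivAt.congr_deriv (HasDerivAt.scomp (0 : ℂ) e4' e3) (by simp)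
    have := e4.sub (e2.smul e5)
    exact HasDerivAt.congr_deriv this (by simp [h2])
  have da : AnalyticAt ℂ (dslope k 0) 0 := by
    obtain ⟨p, hp⟩ := ka
    exact ⟨_, hp.has_fpower_series_dslope_fslope⟩
  refine ⟨dslope k 0, da, by rw [dslope_same, kd.deriv], ?_⟩
  filter_upwards [h3, (tendsto_add_cobounded (-1)).eventually h3, ev_ne 0] with u a b hu
  have e : k u⁻¹ = u⁻¹ • dslope k 0 u⁻¹ := by
    have := sub_smul_dslope k 0 u⁻¹
    simpa [k0] using this.symm
  rw [zpow_sub_one₀ hu, mul_smul, ← e, hk, smul_sub, ← shift_eq (-1) d h hu, a,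
    sub_eq_add_neg u 1, b]

lemma Asy.diff' {d : ℤ} {g : ℂ → M} {c : M} (hg : Asy d g c) :
    Asy (d - 1) (fun u => g (u + 1) - g u) ((d : ℂ) • c) := by
  simpa using hg.diff.shift 1

lemma Asy.tendsto {k : ℕ} {g : ℂ → M} {c : M} (hg : Asy (-(k : ℤ)) g c) :
    Tendsto (fun u : ℂ => u ^ k • g u) (Bornology.cobounded ℂ) (𝓝 c) := by
  obtain ⟨h, h1, h2, h3⟩ := hg
  have : Tendsto (fun u : ℂ => h u⁻¹) (Bornology.cobounded ℂ) (𝓝 c) := by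
    rw [← h2]
    exact h1.continuousAt.tendsto.comp tendsto_inv₀_cobounded
  refine this.congr' ?_
  filter_upwards [h3, ev_ne 0] with u a hu
  rw [a, smul_smul, zpow_neg, zpow_natCast, mul_inv_cancel₀ (pow_ne_zero _ hu), one_smul]

lemma Asy.iter (d l : ℕ) :
    Asy ((d : ℤ) - l) ((fwdDiff (1 : ℂ))^[l] (fun x : ℂ => x ^ d))
      (∏ j ∈ Finset.range l, ((d : ℂ) - (j : ℕ))) := by
  induction l with
  | zero => simpa using Asy.pow d
  | succ l ih =>
    rw [Function.iterate_succ_apply', Finset.prod_range_succ]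
    have := ih.diff'
    have e : ((d : ℤ) - l - 1) = (d : ℤ) - (l + 1 : ℕ) := by push_cast; ring
    rw [e] at this
    rw [smul_eq_mul, mul_comm] at this
    push_cast at this ⊢
    exact this

/-- Matrices of operators of the form `1 + e/u + …`. -/
def MAsy {N : ℕ} (A : ℂ → Matrix (Fin N) (Fin N) (Module.End ℂ M))
    (e : Matrix (Fin N) (Fin N) (Module.End ℂ M)) : Prop :=
  ∀ (a b : Fin N) (d : ℤ) (g : ℂ → M) (c : M), Asy d g c →
    Asy (d - 1) (fun u => A u a b (g u) - (if a = b then g u else 0)) (e a b c)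

lemma MAsy.one {N : ℕ} :
    MAsy (M := M) (fun _ => (1 : Matrix (Fin N) (Fin N) (Module.End ℂ M))) 0 := by
  intro a b d g c hg
  by_cases h : a = b
  · subst h
    simpa using Asy.zero (M := M) (d - 1)
  · simpa [h] using Asy.zero (M := M) (d - 1)

lemma MAsy.mul {N : ℕ} {A B : ℂ → Matrix (Fin N) (Fin N) (Module.End ℂ M)}
    {e f : Matrix (Fin N) (Fin N) (Module.End ℂ M)} (hA : MAsy A e) (hB : MAsy B f) :
    MAsy (fun u => A u * B u) (e + f) := by
  intro a b d g c hg
  have key : ∀ x : Fin N, Asy (d - 1)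
      (fun u => A u a x (B u x b (g u)) - (if a = x then (if x = b then g u else 0) else 0))
      ((if x = b then e a x c else 0) + (if a = x then f x b c else 0)) := by
    intro x
    have h1 := hB x b d g c hg
    have h2 := (hA a x _ _ _ h1).weaken
    have h3 := hA a x d g c hg
    have h4 := ((h2.add (h1.const_smul (if a = x then 1 else 0))).add
      (h3.const_smul (if x = b then 1 else 0)))
    convert h4 using 1
    · funext u
      by_cases p : a = x <;> by_cases q : x = b <;> simp [p, q, map_sub]
    · by_cases p : a = x <;> by_cases q : x = b <;> simp [p, q, add_comm]
  have := Asy.sum Finset.univ (fun x _ => key x)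
  convert this using 1
  · funext u
    simp [Matrix.mul_apply, Finset.sum_sub_distrib]
  · simp [Finset.sum_add_distrib]

lemma MAsy.list {N : ℕ} {ι : Type*} {A : ι → ℂ → Matrix (Fin N) (Fin N) (Module.End ℂ M)}
    {e : ι → Matrix (Fin N) (Fin N) (Module.End ℂ M)} (hA : ∀ i, MAsy (A i) (e i))
    (l : List ι) : MAsy (fun u => (l.map fun i => A i u).prod) (l.map e).sum := by
  induction l with
  | nil => simpa using MAsy.one
  | cons a l ih => simpa using (hA a).mul ih

end Asymptotics

section Operators

variable {N n : ℕ} (V : Fin n → Type*) [∀ i, AddCommGroup (V i)] [∀ i, Module ℂ (V i)]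
  (M : Type*) [NormedAddCommGroup M] [NormedSpace ℂ M] [FiniteDimensional ℂ M]
  (E : ∀ i : Fin n, Fin N → Fin N → (V i →ₗ[ℂ] V i))
  (φ : M ≃ₗ[ℂ] PiTensorProduct ℂ V) (z : Fin n → ℂ)

lemma asy_Lmat (j : Fin n) :
    MAsy (Lmat V M E φ z j) (fun a b => EE V M E φ j b a) := by
  intro a b d g c hg
  have h1 : Asy (-1) (fun u : ℂ => (u - z j)⁻¹) (1 : ℂ) := by
    have : Asy (-1) (fun u : ℂ => u⁻¹) (1 : ℂ) :=
      ⟨fun _ => 1, analyticAt_const, rfl, by simp⟩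
    simpa [sub_eq_add_neg] using this.shift (-z j)
  have h2 := h1.smul (hg.lin (EE V M E φ j b a))
  rw [show (-1 : ℤ) + d = d - 1 by ring, one_smul] at h2
  convert h2 using 1
  funext u
  by_cases p : a = b <;> simp [Lmat, p]

lemma asy_Tmat :
    MAsy (Tmat V M E φ z) (fun a b => ∑ j : Fin n, EE V M E φ j b a) := by
  have := MAsy.list (asy_Lmat V M E φ z) (List.finRange n).reverse
  have eT : Tmat V M E φ z = fun u => ((List.finRange n).reverse.map
      fun i => Lmat V M E φ z i u).prod := by
    funext u
    simp [Tmat, List.ofFn_eq_map]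
  have eE : (fun a b => ∑ j : Fin n, EE V M E φ j b a : Matrix (Fin N) (Fin N) (Module.End ℂ M)) =
      ((List.finRange n).reverse.map
        fun j => (fun a b => EE V M E φ j b a : Matrix (Fin N) (Fin N) (Module.End ℂ M))).sum := by
    rw [List.map_reverse, List.sum_reverse, ← List.ofFn_eq_map, List.sum_ofFn]
    funext a b
    simp
  rw [eT, eE]
  exact this

lemma Xop_one (a b : Fin N) (f : ℂ → M) (u : ℂ) :
    Xop V M E φ z 1 a b f u =
      (if a = b then f u else 0) - Tmat V M E φ z u a b (f (u - 1)) := by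
  simp [Xop, Matrix.one_apply]

lemma asy_Xop (a b : Fin N) {d : ℤ} {g : ℂ → M} {c : M} (hg : Asy d g c) :
    Asy (d - 1) (Xop V M E φ z 1 a b g)
      ((if a = b then (d : ℂ) • c else 0) - (∑ j : Fin n, EE V M E φ j b a) c) := by
  have h0 : Asy d (fun u => g (u - 1)) c := by
    simpa [sub_eq_add_neg] using hg.shift (-1)
  have h1 := asy_Tmat V M E φ z a b d _ c h0
  have h2 := (hg.diff.const_smul (if a = b then 1 else 0)).sub h1
  convert h2 using 1
  · funext u
    rw [Xop_one]
    by_cases p : a = b <;> simp [p]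
  · by_cases p : a = b <;> simp [p]

variable {V M E φ} in
lemma singWt_lt {m : Fin N → ℤ} {w : M} (hw : w ∈ SingWt V M E φ m) {a b : Fin N}
    (h : a < b) : (∑ j : Fin n, EE V M E φ j a b) w = 0 := by
  have := hw.2
  simp only [SetLike.mem_coe, Submodule.mem_iInf, LinearMap.mem_ker] at this
  exact this a b h

variable {V M E φ} in
lemma singWt_eq {m : Fin N → ℤ} {w : M} (hw : w ∈ SingWt V M E φ m) (a : Fin N) :
    (∑ j : Fin n, EE V M E φ j a a) w = (m a : ℂ) • w := by
  have := hw.1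
  simp only [Wt, SetLike.mem_coe, Submodule.mem_iInf, LinearMap.mem_ker] at this
  have h := this a
  rw [LinearMap.sub_apply, sub_eq_zero] at h
  simpa using h

lemma asy_foldr {m : Fin N → ℤ} {w : M} (hw : w ∈ SingWt V M E φ m)
    (σ : Equiv.Perm (Fin N)) {d : ℤ} {f : ℂ → M} (hf : Asy d f w) (k : ℕ) (hk : k ≤ N) :
    Asy (d - k)
      ((((List.ofFn fun a : Fin N => Xop V M E φ z 1 a (σ a)).drop (N - k)).foldr
        (· ∘ ·) id) f)
      ((if ∀ a : Fin N, N - k ≤ a → σ a = a then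
        ∏ s : Fin N, (if N - k ≤ s then ((d : ℂ) - m s - N + ((s : ℕ) + 1 : ℕ)) else 1)
        else 0) • w) := by
  induction k with
  | zero =>
    have e1 : ∀ a : Fin N, ¬ N ≤ a := fun a => by omega
    simpa [e1, List.drop_eq_nil_of_le] using hf
  | succ k ih =>
    have ih := ih (by omega)
    have hlt : N - (k + 1) < N := by omega
    set a : Fin N := ⟨N - (k + 1), hlt⟩ with ha
    have e0 : (List.ofFn fun a : Fin N => Xop V M E φ z 1 a (σ a)).drop (N - (k + 1)) =
        Xop V M E φ z 1 a (σ a) ::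
          (List.ofFn fun a : Fin N => Xop V M E φ z 1 a (σ a)).drop (N - k) := by
      rw [List.drop_eq_getElem_cons (by simpa using hlt)]
      have : N - (k + 1) + 1 = N - k := by omega
      simp [this, ha]
    rw [e0, List.foldr_cons]
    have h1 := asy_Xop V M E φ z a (σ a) ih
    have e1 : d - (k : ℤ) - 1 = d - (k + 1 : ℕ) := by push_cast; ring
    rw [e1] at h1
    rw [Function.comp_apply]
    convert h1 using 1
    have step : ∀ b : Fin N, N - (k + 1) ≤ b ↔ (b = a ∨ N - k ≤ b) := by
      intro b
      rw [Fin.ext_iff, ha]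
      simp only
      omega
    by_cases H : ∀ b : Fin N, N - k ≤ b → σ b = b
    · rw [if_pos H]
      by_cases q : σ a = a
      · rw [if_pos, if_pos q.symm, q, map_smul, singWt_eq hw, smul_smul, smul_smul, ← sub_smul]
        · congr 1
          have e2 : ∏ s : Fin N, (if N - (k + 1) ≤ s then
              ((d : ℂ) - m s - N + ((s : ℕ) + 1 : ℕ)) else 1) =
              ((d : ℂ) - m a - N + ((a : ℕ) + 1 : ℕ)) * ∏ s : Fin N, (if N - k ≤ s then
              ((d : ℂ) - m s - N + ((s : ℕ) + 1 : ℕ)) else 1) := by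
            rw [← Finset.mul_prod_erase _ _ (Finset.mem_univ a),
              ← Finset.mul_prod_erase (Finset.univ : Finset (Fin N))
                (fun s : Fin N => if N - k ≤ s then
                  ((d : ℂ) - m s - N + ((s : ℕ) + 1 : ℕ)) else 1) (Finset.mem_univ a)]
            rw [if_pos ((step a).2 (Or.inl rfl)), if_neg (by rw [ha]; simp only; omega), one_mul]
            congr 1
            refine Finset.prod_congr rfl fun s hs => ?_
            have : s ≠ a := (Finset.mem_erase.1 hs).1
            simp [step, this]
          rw [e2]
          have e3 : (((a : ℕ) + 1 : ℕ) : ℂ) = N - k := by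
            rw [← Nat.cast_sub (by omega)]
            congr 1
            rw [ha]; simp only; omega
          rw [e3]
          push_cast
          ring
        · intro b hb
          rcases (step b).1 hb with rfl | h
          · exact q
          · exact H b h
      · rw [if_neg, if_neg (Ne.symm q)]
        · have hlt' : σ a < a := by
            by_contra hc
            have h2 : a < σ a := lt_of_le_of_ne (not_lt.1 hc) (Ne.symm q)
            have h3 := H (σ a) (by
              have : (a : ℕ) < (σ a : ℕ) := h2
              have h4 : (a : ℕ) = N - (k + 1) := rfl
              omega)
            exact q (σ.injective h3)
          rw [map_smul, singWt_lt hw hlt']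
          simp
        · intro h
          exact q (h a ((step a).2 (Or.inl rfl)))
    · rw [if_neg H, if_neg]
      · simp
      · intro h
        exact H fun b hb => h b ((step b).2 (Or.inr hb))

lemma asy_Dop {m : Fin N → ℤ} {w : M} (hw : w ∈ SingWt V M E φ m)
    {d : ℤ} {f : ℂ → M} (hf : Asy d f w) :
    Asy (d - N) (Dop V M E φ z 1 f)
      ((∏ s : Fin N, ((d : ℂ) - m s - N + ((s : ℕ) + 1 : ℕ))) • w) := by
  have h := Asy.sum (Finset.univ : Finset (Equiv.Perm (Fin N))) (fun σ _ =>
    (asy_foldr V M E φ z hw σ hf N le_rfl).const_smul (((Equiv.Perm.sign σ : ℤˣ) : ℤ) : ℂ))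
  convert h using 1
  · funext u
    simp [Dop, Int.cast_smul_eq_zsmul]
  · rw [Finset.sum_eq_single (1 : Equiv.Perm (Fin N))]
    · simp
    · intro σ _ hσ
      rw [if_neg]
      · simp
      · intro h
        exact hσ (Equiv.ext fun a => h a (by simp))
    · simp

lemma foldr_point (σ : Fin N → Fin N) (l : List (Fin N)) (f : ℂ → M) (u : ℂ)
    (hf : ∀ k : ℕ, f (u - ((k + 1 : ℕ) : ℂ)) = 0) :
    (∀ k : ℕ, (((l.map fun a : Fin N => Xop V M E φ z 1 a (σ a)).foldr (· ∘ ·) id) f)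
      (u - ((k + 1 : ℕ) : ℂ)) = 0) ∧
    (((l.map fun a : Fin N => Xop V M E φ z 1 a (σ a)).foldr (· ∘ ·) id) f) u =
      if ∀ a ∈ l, a = σ a then f u else 0 := by
  induction l with
  | nil => simpa using hf
  | cons a l ih =>
    obtain ⟨i1, i2⟩ := ih
    simp only [List.map_cons, List.foldr_cons, Function.comp_apply, Xop_one]
    have i3 := i1 0
    simp only [zero_add, Nat.cast_one] at i3
    constructor
    · intro k
      have i4 := i1 (k + 1)
      rw [i1 k, sub_sub, show (((k + 1 : ℕ) : ℂ) + 1) = ((k + 1 + 1 : ℕ) : ℂ) by push_cast; ring,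
        i4]
      simp
    · rw [i2, i3]
      by_cases p : a = σ a
      · simp [← p]
      · simp [p]

lemma Dop_point (f : ℂ → M) (u : ℂ) (hf : ∀ k : ℕ, f (u - ((k + 1 : ℕ) : ℂ)) = 0) :
    Dop V M E φ z 1 f u = f u := by
  unfold Dop
  rw [Finset.sum_eq_single (1 : Equiv.Perm (Fin N))]
  · rw [List.ofFn_eq_map,
      (foldr_point V M E φ z (1 : Equiv.Perm (Fin N)) (List.finRange N) f u hf).2]
    simp
  · intro σ _ hσ
    rw [List.ofFn_eq_map, (foldr_point V M E φ z σ (List.finRange N) f u hf).2, if_neg]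
    · simp
    · intro h
      exact hσ (Equiv.ext fun a => (h a (by simp)).symm)
  · simp

lemma good_ev : ∀ᶠ u in Bornology.cobounded ℂ, Good N z u := by
  unfold Good
  rw [Filter.eventually_all]
  intro j
  have : ∀ᶠ u in Bornology.cobounded ℂ, ∀ k ∈ Finset.range N, u - (k : ℂ) ≠ z j := by
    rw [Filter.eventually_all_finset]
    intro k _
    filter_upwards [ev_ne (z j + k)] with u hu h
    exact hu (by rw [← h]; ring)
  filter_upwards [this] with u hu k hk
  exact hu k (Finset.mem_range.2 hk)

end Operators

/-- Newton expansion of a monic polynomial. -/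
lemma newton (N : ℕ) (a : Fin N → ℂ) : ∃ c : ℕ → ℂ, c 0 = 1 ∧ ∀ d : ℂ,
    ∑ k ∈ Finset.range (N + 1), c k * ∏ j ∈ Finset.range (N - k), (d - (j : ℕ)) =
      ∏ s : Fin N, (d - a s) := by
  induction N with
  | zero => exact ⟨fun _ => 1, rfl, by simp⟩
  | succ N ih =>
    obtain ⟨c, c0, hc⟩ := ih (fun s => a s.succ)
    set c' : ℕ → ℂ := fun k => if k ≤ N then c k else 0 with hc'
    refine ⟨fun k => c' k + (match k with
      | 0 => 0
      | k + 1 => ((N : ℂ) - k - a 0) * c' k), by simp [hc', c0], fun d => ?_⟩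
    rw [Fin.prod_univ_succ, ← hc d]
    simp only [add_mul, Finset.sum_add_distrib]
    rw [Finset.sum_range_succ, Finset.sum_range_succ' (n := N + 1), Finset.mul_sum]
    have z1 : c' (N + 1) = 0 := by simp [hc']
    simp only [z1, zero_mul, add_zero]
    rw [← Finset.sum_add_distrib]
    refine Finset.sum_congr rfl fun k hk => ?_
    have hk' : k ≤ N := by have := Finset.mem_range.1 hk; omega
    have e : N + 1 - k = N - k + 1 := by omega
    have e2 : N + 1 - (k + 1) = N - k := by omega
    have e3 : c' k = c k := by simp [hc', hk']
    rw [e, e2, e3, Finset.prod_range_succ, Nat.cast_sub hk']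
    ring

/-- Let `Q` be the identity matrix and let `S_k(u)` be the coefficients in
`D_{Q=1,M}(u,τ) τ^N = ∑_{k=0}^N (−1)^k S_k(u) (τ − 1)^{N−k}` acting on
`sing M[m]`-valued functions.  Then (i) `S_0(u) = 1`; (ii) for `k = 1, …, N` the limit
`S_{k,0} = lim_{u→∞} u^k S_k(u)` exists and is a scalar operator `s0 k`; and (iii) for every
`d ∈ ℂ`, `∑_{k=0}^N (−1)^k s0_k ∏_{j=0}^{N−k−1} (d − j) = ∏_{s=1}^N (d − m_s − N + s)`. -/
theorem statement_3
    {N n : ℕ} (hN : 2 ≤ N) (hn : 1 ≤ n)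
    (V : Fin n → Type*) [∀ i, AddCommGroup (V i)] [∀ i, Module ℂ (V i)]
    [∀ i, FiniteDimensional ℂ (V i)]
    (M : Type*) [NormedAddCommGroup M] [NormedSpace ℂ M] [FiniteDimensional ℂ M]
    (Λ : Fin n → Fin N → ℤ)
    (hdom : ∀ i, ∀ a b : Fin N, a ≤ b → Λ i b ≤ Λ i a)
    (hpoly : ∀ i a, 0 ≤ Λ i a)
    (hlast : ∀ i, Λ i ⟨N - 1, by omega⟩ = 0)
    (E : ∀ i : Fin n, Fin N → Fin N → (V i →ₗ[ℂ] V i))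
    (hrel : GlRel V E)
    (hhw : IsHW V E Λ)
    (φ : M ≃ₗ[ℂ] PiTensorProduct ℂ V)
    (z : Fin n → ℂ)
    (m : Fin N → ℤ)
    -- the operators `S_k(u)`, defined by the expansion of `D_{Q=1,M}(u,τ) τ^N`
    -- in powers of `τ − 1` on `sing M[m]`-valued functions:
    (S : ℕ → ℂ → Module.End ℂ M)
    (hS : ∀ f : ℂ → M, (∀ x, f x ∈ SingWt V M E φ m) → ∀ u : ℂ, Good N z u →
      Dop V M E φ z (1 : Matrix (Fin N) (Fin N) ℂ) (fun x => f (x + (N : ℂ))) u =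
        ∑ k ∈ Finset.range (N + 1), ((-1 : ℤ) ^ k) •
          S k u (∑ i ∈ Finset.range (N - k + 1),
            (((-1 : ℂ) ^ (N - k - i)) * ((N - k).choose i : ℂ)) • f (u + (i : ℂ)))) :
    -- (i) `S_0(u) = 1`
    (∀ u : ℂ, Good N z u → ∀ w ∈ SingWt V M E φ m, S 0 u w = w) ∧
    -- (ii), (iii)
    ∃ s0 : ℕ → ℂ, s0 0 = 1 ∧
      (∀ k, 1 ≤ k → k ≤ N → ∀ w ∈ SingWt V M E φ m,
        Filter.Tendsto (fun u : ℂ => (u ^ k) • S k u w) (Bornology.cobounded ℂ)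
          (nhds (s0 k • w))) ∧
      (∀ d : ℂ, ∑ k ∈ Finset.range (N + 1),
          (-1 : ℂ) ^ k * s0 k * ∏ j ∈ Finset.range (N - k), (d - (j : ℕ)) =
        ∏ s : Fin N, (d - (m s : ℂ) - (N : ℂ) + ((s : ℕ) + 1 : ℕ))) := by
  have fd : ∀ (l d : ℕ) (u : ℂ) (w : M),
      (∑ i ∈ Finset.range (l + 1), (((-1 : ℂ) ^ (l - i)) * (l.choose i : ℂ)) •
        ((u + (i : ℂ)) ^ d • w)) = ((fwdDiff (1 : ℂ))^[l] (fun x : ℂ => x ^ d) u) • w := by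
    intro l d u w
    rw [fwdDiff_iter_eq_sum_shift, Finset.sum_smul]
    refine Finset.sum_congr rfl fun i _ => ?_
    rw [smul_smul]
    congr 1
    simp
  refine ⟨?_, ?_⟩
  · intro u hu w hw
    have h := hS (fun x => if x = u + N then w else 0)
      (fun x => by split_ifs; exacts [hw, Submodule.zero_mem _]) u hu
    rw [Dop_point] at h
    · rw [Finset.sum_range_succ', Finset.sum_eq_zero] at h
      · simp only [if_true, pow_zero, one_smul, zero_add, Nat.sub_zero] at h
        rw [Finset.sum_range_succ, Finset.sum_eq_zero] at h
        · simpa using h.symm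
        · intro i hi
          have : (i : ℂ) ≠ N := by
            have := Finset.mem_range.1 hi
            exact_mod_cast this.ne
          simp [this]
      · intro k hk
        rw [Finset.sum_eq_zero]
        · simp
        · intro i hi
          have : (i : ℂ) ≠ N := by
            have h1 := Finset.mem_range.1 hi
            have h2 := Finset.mem_range.1 hk
            have : i ≠ N := by omega
            exact_mod_cast this
          simp [this]
    · intro k
      rw [if_neg]
      intro h
      have h2 : ((k + 1 : ℕ) : ℂ) = 0 := by linear_combination -h
      exact absurd (Nat.cast_eq_zero.1 h2) (by omega)
  · obtain ⟨c, c0, hc⟩ := newton N (fun s => (m s : ℂ) + N - ((s : ℕ) + 1 : ℕ))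
    have sq : ∀ k : ℕ, (-1 : ℂ) ^ k * (-1) ^ k = 1 := fun k => by
      rw [← mul_pow]; simp
    have hc2 : ∀ d : ℂ, ∑ k ∈ Finset.range (N + 1),
          (-1 : ℂ) ^ k * ((-1) ^ k * c k) * ∏ j ∈ Finset.range (N - k), (d - (j : ℕ)) =
        ∏ s : Fin N, (d - (m s : ℂ) - (N : ℂ) + ((s : ℕ) + 1 : ℕ)) := by
      intro d
      have h := hc d
      simp only [← mul_assoc, sq, one_mul]
      rw [h]
      exact Finset.prod_congr rfl fun s _ => by ring
    refine ⟨fun k => (-1) ^ k * c k, by simp [c0], ?_, hc2⟩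
    intro k hk1 hkN w hw
    have main : ∀ l, l ≤ N → Asy ((l : ℤ) - N) (fun u => S (N - l) u w)
        (((-1) ^ (N - l) * c (N - l)) • w) := by
      intro l
      induction l using Nat.strong_induction_on with
      | _ d ih =>
      intro hd
      have hf : Asy (d : ℤ) (fun x : ℂ => (x + N) ^ d • w) w := by
        simpa using (((Asy.pow d).smul (Asy.const w)).shift (N : ℂ))
      have hD := asy_Dop V M E φ z hw hf
      have hlow : Asy ((d : ℤ) - N) (fun u => ∑ l ∈ Finset.range d,
          (-1 : ℂ) ^ (N - l) • ((fwdDiff (1 : ℂ))^[l] (fun x : ℂ => x ^ d) u) • S (N - l) u w)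
          (∑ l ∈ Finset.range d, (-1 : ℂ) ^ (N - l) •
            (∏ j ∈ Finset.range l, ((d : ℂ) - (j : ℕ))) •
              (((-1) ^ (N - l) * c (N - l)) • w)) := by
        refine Asy.sum _ fun l hl => ?_
        have hl' := Finset.mem_range.1 hl
        have h1 := (Asy.iter d l).smul (ih l hl' (by omega))
        rw [show (d : ℤ) - l + (l - N) = d - N by ring] at h1
        exact h1.const_smul _
      have hfin := (hD.sub hlow).const_smul ((-1 : ℂ) ^ (N - d) * ((d.factorial : ℂ))⁻¹)
      have fne : (d.factorial : ℂ) ≠ 0 := by exact_mod_cast d.factorial_ne_zero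
      have split : ∀ F : ℕ → M, (∀ l, d < l → l ≤ N → F l = 0) →
          ∑ l ∈ Finset.range (N + 1), F l = ∑ l ∈ Finset.range d, F l + F d := by
        intro F hF
        rw [← Finset.sum_range_succ]
        symm
        refine Finset.sum_subset (fun x hx => ?_) (fun x hx hx' => ?_)
        · have := Finset.mem_range.1 hx
          exact Finset.mem_range.2 (by omega)
        · have h1 := Finset.mem_range.1 hx
          have h2 : ¬ x < d + 1 := fun h => hx' (Finset.mem_range.2 h)
          exact hF x (by omega) (by omega)
      have pfac : ∏ j ∈ Finset.range d, ((d : ℂ) - (j : ℕ)) = d.factorial := by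
        rw [← Nat.descFactorial_self, Nat.descFactorial_eq_prod_range, Nat.cast_prod]
        refine Finset.prod_congr rfl fun j hj => ?_
        rw [Nat.cast_sub (Finset.mem_range.1 hj).le]
      have hconst : ((-1 : ℂ) ^ (N - d) * ((d.factorial : ℂ))⁻¹) •
          ((∏ s : Fin N, (((d : ℤ) : ℂ) - m s - N + ((s : ℕ) + 1 : ℕ))) • w -
          (∑ l ∈ Finset.range d, (-1 : ℂ) ^ (N - l) •
            (∏ j ∈ Finset.range l, ((d : ℂ) - (j : ℕ))) •
              (((-1) ^ (N - l) * c (N - l)) • w))) = ((-1) ^ (N - d) * c (N - d)) • w := by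
        rw [Int.cast_natCast, ← hc2 d, ← Finset.sum_range_reflect, Finset.sum_smul,
          split]
        · rw [Finset.sum_congr rfl (g := fun l => (-1 : ℂ) ^ (N - l) •
            (∏ j ∈ Finset.range l, ((d : ℂ) - (j : ℕ))) •
              (((-1) ^ (N - l) * c (N - l)) • w)), add_sub_cancel_left]
          · rw [show N + 1 - 1 - d = N - d by omega, show N - (N - d) = d by omega, pfac,
              smul_smul]
            congr 1
            have := sq (N - d)
            have hfi := mul_inv_cancel₀ fne
            linear_combination (c (N - d) * (-1) ^ (N - d) * (d.factorial : ℂ) *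
              (d.factorial : ℂ)⁻¹) * this + (c (N - d) * (-1) ^ (N - d)) * hfi
          · intro l hl
            have hl' := Finset.mem_range.1 hl
            rw [show N + 1 - 1 - l = N - l by omega, show N - (N - l) = l by omega,
              smul_smul, smul_smul]
            congr 1
            ring
        · intro l h1 h2
          rw [show N - (N + 1 - 1 - l) = l by omega, Finset.prod_eq_zero (Finset.mem_range.2 h1)]
          · simp
          · simp
      rw [hconst] at hfin
      refine hfin.congr ?_
      filter_upwards [good_ev (N := N) z] with u hu
      have h := hS (fun x => x ^ d • w) (fun x => Submodule.smul_mem _ _ hw) u hu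
      rw [h]
      simp only [fd, map_smul]
      rw [← Finset.sum_range_reflect, split]
      · rw [Finset.sum_congr rfl (g := fun l => (-1 : ℂ) ^ (N - l) •
          ((fwdDiff (1 : ℂ))^[l] (fun x : ℂ => x ^ d) u) • S (N - l) u w), add_sub_cancel_left]
        · rw [show N + 1 - 1 - d = N - d by omega, show N - (N - d) = d by omega,
            fwdDiff_iter_eq_factorial, ← Int.cast_smul_eq_zsmul ℂ, smul_smul, smul_smul]
          have := sq (N - d)
          have e : ((-1 : ℂ) ^ (N - d) * ((d.factorial : ℂ))⁻¹) *
              ((((-1 : ℤ) ^ (N - d) : ℤ) : ℂ) * (d.factorial : ℂ)) = 1 := by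
            push_cast
            field_simp
            linear_combination this
          have e' : (((d.factorial : ℂ → ℂ)) u) = (d.factorial : ℂ) := rfl
          rw [e', mul_assoc ((-1 : ℂ) ^ (N - d) * ((d.factorial : ℂ))⁻¹)]
          rw [e, one_smul]
        · intro l hl
          have hl' := Finset.mem_range.1 hl
          rw [show N + 1 - 1 - l = N - l by omega, show N - (N - l) = l by omega,
            ← Int.cast_smul_eq_zsmul ℂ]
          push_cast
          rfl
      · intro l h1 h2
        rw [show N - (N + 1 - 1 - l) = l by omega, fwdDiff_iter_pow_eq_zero_of_lt h1]
        simp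
    have := main (N - k) (by omega)
    rw [show N - (N - k) = k by omega,
      show ((N - k : ℕ) : ℤ) - N = -(k : ℤ) by rw [Nat.cast_sub hkN]; ring] at this
    exact this.tendsto

end XXXModel
end
end

section
/- Let A_k(u,ε), k = 0,…,N, be End(V)-valued functions which are rational in u for each ε ∈ [0,1) and depend analytically on ε, with A_0 = 1, and set D_ε = Σ_{k=0}^N A_k(u,ε) τ^{−k}. Assume: (a) for every ε ∈ [0,1) the operator D_ε is admissible at infinity; (b) for every ε ∈ (0,1) the kernel of D_ε is generated by quasi-exponentials; (c) there exists a natural number m such that for every ε ∈ (0,1) the generating quasi-exponentials can be chosen of degree less than m. Then the kernel of D_0 is generated by quasi-exponentials. -/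
noncomputable section

/-- `g` is meromorphic at the point `x`. -/
def MeromAt (g : ℂ → ℂ) (x : ℂ) : Prop :=
  ∃ k : ℕ, AnalyticAt ℂ (fun z => (z - x) ^ k * g z) x

/-- Linear independence of a family of functions over the field of one-periodic
meromorphic functions on `ℂ`. -/
def IndepPeriodic {M : Type*} [AddCommGroup M] [Module ℂ M] {ι : Type*} [Fintype ι]
    (F : ι → ℂ → M) : Prop :=
  ∀ c : ι → ℂ → ℂ,
    (∀ i x, MeromAt (c i) x) →
    (∀ i x, c i (x + 1) = c i x) →
    (∀ x : ℂ, (∀ i, AnalyticAt ℂ (c i) x) → ∑ i, c i x • F i x = 0) →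
    ∀ i x, AnalyticAt ℂ (c i) x → c i x = 0

/-- `V`-valued quasi-exponential of degree less than `m`:
a finite sum of functions `Q^u p(u) = e^{(ln Q) u} p(u)` with `p` of degree `< m`. -/
def IsQEdeg {V : Type*} [AddCommGroup V] [Module ℂ V] (m : ℕ) (f : ℂ → V) : Prop :=
  ∃ (k : ℕ) (lam : Fin k → ℂ) (v : Fin k → Fin m → V),
    ∀ u : ℂ, f u = ∑ i : Fin k, ∑ j : Fin m,
      (Complex.exp (lam i * u) * u ^ (j : ℕ)) • v i j

/-- `V`-valued quasi-exponential. -/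
def IsQE {V : Type*} [AddCommGroup V] [Module ℂ V] (f : ℂ → V) : Prop :=
  ∃ m : ℕ, IsQEdeg m f

/-- The kernel of the difference operator `∑_{k=0}^N B_k(u) τ^{−k}` is generated by
`N · dim V` quasi-exponentials satisfying the property `P`, lying in the kernel (away from
the finitely many singular points of the rational coefficients), and linearly independent
over the field of one-periodic meromorphic functions. -/
def DiffKerGen {V : Type*} [AddCommGroup V] [Module ℂ V]
    (N : ℕ) (B : ℕ → ℂ → Module.End ℂ V) (P : (ℂ → V) → Prop) : Prop :=
  ∃ (F : Fin (N * Module.finrank ℂ V) → ℂ → V) (S : Finset ℂ),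
    (∀ i, P (F i)) ∧
    (∀ i, ∀ u : ℂ, u ∉ S →
      ∑ k ∈ Finset.range (N + 1), B k u (F i (u - (k : ℂ))) = 0) ∧
    IndepPeriodic F


open Polynomial in
/-- `V`-valued polynomial function of degree less than `m`. -/
def PolyV {V : Type*} [AddCommGroup V] [Module ℂ V] (m : ℕ) (g : ℂ → V) : Prop :=
  ∀ φ : Module.Dual ℂ V, ∃ p : ℂ[X], p.degree < m ∧ ∀ x, φ (g x) = p.eval x

section Part1
open Polynomial
variable {V : Type*} [AddCommGroup V] [Module ℂ V]

lemma dual_sep {v : V} (h : ∀ φ : Module.Dual ℂ V, φ v = 0) : v = 0 :=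
  (Module.forall_dual_apply_eq_zero_iff ℂ v).1 h

lemma PolyV.mono {m m' : ℕ} (h : m ≤ m') {g : ℂ → V} (hg : PolyV m g) : PolyV m' g := by
  intro φ
  obtain ⟨p, hp, h2⟩ := hg φ
  exact ⟨p, lt_of_lt_of_le hp (by exact_mod_cast h), h2⟩

lemma PolyV.zero {m : ℕ} : PolyV m (fun _ => (0 : V)) := fun φ =>
  ⟨0, by simp, by simp⟩

lemma PolyV.add {m : ℕ} {g g' : ℂ → V} (hg : PolyV m g) (hg' : PolyV m g') :
    PolyV m (fun x => g x + g' x) := by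
  intro φ
  obtain ⟨p, hp, h2⟩ := hg φ
  obtain ⟨p', hp', h2'⟩ := hg' φ
  exact ⟨p + p', lt_of_le_of_lt (degree_add_le _ _) (max_lt hp hp'), by simp [h2, h2']⟩

lemma PolyV.smul {m : ℕ} {g : ℂ → V} (c : ℂ) (hg : PolyV m g) :
    PolyV m (fun x => c • g x) := by
  intro φ
  obtain ⟨p, hp, h2⟩ := hg φ
  exact ⟨c • p, lt_of_le_of_lt (degree_smul_le _ _) hp, by simp [h2]⟩

lemma PolyV.sum {m : ℕ} {ι : Type*} (s : Finset ι) (g : ι → ℂ → V) (hg : ∀ i ∈ s, PolyV m (g i)) :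
    PolyV m (fun x => ∑ i ∈ s, g i x) := by
  classical
  induction s using Finset.induction_on with
  | empty => simpa using PolyV.zero
  | insert a s ha ih =>
    simp only [Finset.sum_insert ha]
    exact (hg a (by simp)).add (ih fun i hi => hg i (by simp [hi]))

lemma PolyV.shift {m : ℕ} {g : ℂ → V} (c : ℂ) (hg : PolyV m g) :
    PolyV m (fun x => g (x + c)) := by
  intro φ
  obtain ⟨p, hp, h2⟩ := hg φ
  exact ⟨taylor c p, by rwa [degree_taylor], by simp [h2, taylor_eval]⟩

lemma PolyV.mono_term {m : ℕ} (j : Fin m) (v : V) : PolyV m (fun x => x ^ (j : ℕ) • v) := by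
  intro φ
  refine ⟨C (φ v) * X ^ (j : ℕ), lt_of_le_of_lt (degree_C_mul_X_pow_le _ _) ?_, fun x => ?_⟩
  · exact_mod_cast j.2
  · rw [map_smul, smul_eq_mul, eval_mul, eval_C, eval_pow, eval_X, mul_comm]

lemma PolyV.scalar (p : ℂ[X]) : PolyV (p.natDegree + 1) (fun x => p.eval x) := by
  intro φ
  refine ⟨φ 1 • p, lt_of_le_of_lt (degree_smul_le _ _) ?_, fun x => ?_⟩
  · refine lt_of_le_of_lt degree_le_natDegree ?_
    exact_mod_cast Nat.lt_succ_self _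
  · have : φ (p.eval x) = φ (p.eval x • (1 : ℂ)) := by simp
    rw [this, map_smul]; simp [mul_comm]

lemma PolyV.diff {m : ℕ} {g : ℂ → V} (hg : PolyV (m + 1) g) :
    PolyV m (fun x => g (x + 1) - g x) := by
  intro φ
  obtain ⟨p, hp, h2⟩ := hg φ
  refine ⟨taylor 1 p - p, ?_, by simp [h2, taylor_eval]⟩
  by_cases h0 : p = 0
  · simp [h0]
  · have h1 : (taylor 1 p - p).degree < p.degree := by
      have := degree_sub_lt_left (p := taylor 1 p) (q := p) (degree_taylor p 1)
        (by simpa using h0) (leadingCoeff_taylor 1 p)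
      rwa [degree_taylor] at this
    have h3 : p.degree ≤ m := by
      rw [degree_eq_natDegree h0] at hp ⊢
      norm_cast at hp ⊢
      omega
    exact lt_of_lt_of_le h1 h3

lemma PolyV.zero_eq {g : ℂ → V} (hg : PolyV 0 g) (x : ℂ) : g x = 0 := by
  apply dual_sep
  intro φ
  obtain ⟨p, hp, h2⟩ := hg φ
  have : p = 0 := by
    rw [← degree_eq_bot]
    simpa using Nat.WithBot.lt_zero_iff.1 hp
  simp [h2, this]

lemma PolyV.explicit [FiniteDimensional ℂ V] {m : ℕ} {g : ℂ → V} (hg : PolyV m g) :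
    ∃ v : Fin m → V, ∀ x, g x = ∑ j : Fin m, x ^ (j : ℕ) • v j := by
  let b := Module.finBasis ℂ V
  choose p hp h2 using fun s => hg (b.coord s)
  refine ⟨fun j => ∑ s, (p s).coeff j • b s, fun x => ?_⟩
  conv_lhs => rw [← b.sum_repr (g x)]
  simp only [Finset.smul_sum]
  rw [Finset.sum_comm]
  refine Finset.sum_congr rfl fun s _ => ?_
  have h3 : b.repr (g x) s = (p s).eval x := h2 s x
  rw [h3]
  have h4 : (p s).eval x = ∑ j : Fin m, (p s).coeff j * x ^ (j : ℕ) := by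
    rw [Fin.sum_univ_eq_sum_range (fun j => (p s).coeff j * x ^ j)]
    by_cases h0 : p s = 0
    · simp [h0]
    · have := hp s
      rw [degree_eq_natDegree h0] at this
      exact eval_eq_sum_range' (by exact_mod_cast this) x
  rw [h4, Finset.sum_smul]
  refine Finset.sum_congr rfl fun j _ => ?_
  rw [smul_smul, mul_comm]

/-- A polynomial function vanishing at large naturals vanishes. -/
lemma PolyV.eq_zero {m : ℕ} {g : ℂ → V} (hg : PolyV m g) (n0 : ℕ)
    (h : ∀ n : ℕ, n0 ≤ n → g n = 0) (x : ℂ) : g x = 0 := by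
  apply dual_sep
  intro φ
  obtain ⟨p, hp, h2⟩ := hg φ
  have : p = 0 := by
    apply eq_zero_of_infinite_isRoot
    refine Set.Infinite.mono (s := (fun n : ℕ => (n : ℂ)) '' Set.Ici n0) ?_ ?_
    · rintro _ ⟨n, hn, rfl⟩
      simp only [Set.mem_ofPred_eq, IsRoot, ← h2]
      simp [h n hn]
    · exact (Set.Ici_infinite n0).image (Nat.cast_injective.injOn)
  simp [h2, this]

variable (V) in
/-- The shift operator on sequences. -/
def shiftS : Module.End ℂ (ℕ → V) := LinearMap.funLeft ℂ V Nat.succ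

@[simp] lemma shiftS_apply (f : ℕ → V) (n : ℕ) : shiftS V f n = f (n + 1) := rfl

lemma shiftS_pow_apply (k : ℕ) (f : ℕ → V) (n : ℕ) : (shiftS V ^ k) f n = f (n + k) := by
  induction k generalizing f with
  | zero => rfl
  | succ k ih => rw [pow_succ, Module.End.mul_apply, ih]; simp [add_assoc]

lemma kill_V (Q : ℂ) {m : ℕ} {g : ℂ → V} (hg : PolyV m g) :
    ((shiftS V - algebraMap ℂ _ Q) ^ m) (fun n : ℕ => Q ^ n • g n) = 0 := by
  induction m generalizing g with
  | zero =>
    ext n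
    simp [hg.zero_eq]
  | succ m ih =>
    rw [pow_succ, Module.End.mul_apply]
    rw [← ih (hg.diff.smul Q)]
    congr 1
    ext n
    simp [Module.algebraMap_end_apply, smul_smul, pow_succ, smul_sub]
    simp [mul_comm]

lemma mem_gen (Q : ℂ) {m : ℕ} {g : ℂ → V} (hg : PolyV m g) :
    (fun n : ℕ => Q ^ n • g n) ∈ (shiftS V).maxGenEigenspace Q := by
  rw [Module.End.mem_maxGenEigenspace]
  exact ⟨m, by simpa [Algebra.algebraMap_eq_smul_one] using kill_V Q hg⟩

lemma gen_indep (Λ : Finset ℂ) (f : ℂ → ℕ → V)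
    (hf : ∀ Q ∈ Λ, f Q ∈ (shiftS V).maxGenEigenspace Q) (h : ∑ Q ∈ Λ, f Q = 0) :
    ∀ Q ∈ Λ, f Q = 0 := by
  have := (iSupIndep_iff_finsetSum_eq_zero_imp_eq_zero _).1
    (shiftS V).independent_maxGenEigenspace
  exact this Λ f hf h

lemma key (Λ : Finset ℂ) (h0 : (0 : ℂ) ∉ Λ) (g : ℂ → ℂ → V) (hg : ∀ Q ∈ Λ, ∃ m, PolyV m (g Q))
    (n0 : ℕ) (h : ∀ n : ℕ, n0 ≤ n → ∑ Q ∈ Λ, Q ^ n • g Q n = 0) :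
    ∀ Q ∈ Λ, ∀ x, g Q x = 0 := by
  have h1 := gen_indep Λ (fun Q n => Q ^ n • (Q ^ n0 • g Q (n + n0))) ?_ ?_
  · intro Q hQ x
    obtain ⟨m, hm⟩ := hg Q hQ
    have hQ0 : Q ≠ 0 := fun h => h0 (h ▸ hQ)
    refine hm.eq_zero n0 (fun n hn => ?_) x
    obtain ⟨k, rfl⟩ := Nat.exists_eq_add_of_le' hn
    have := congrFun (h1 Q hQ) k
    simpa [hQ0] using this
  · intro Q hQ
    obtain ⟨m, hm⟩ := hg Q hQ
    exact mem_gen Q ((hm.shift n0).smul (Q ^ n0))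
  · ext n
    have := h (n + n0) (by omega)
    simpa [Finset.sum_apply, smul_smul, pow_add] using this

/-- Sequences killed by a power of `S - Q`. -/
lemma poly_of_kill (Q : ℂ) (hQ : Q ≠ 0) (m : ℕ) (f : ℕ → V)
    (hf : ((shiftS V - algebraMap ℂ _ Q) ^ m) f = 0) :
    ∃ g : ℂ → V, PolyV m g ∧ ∀ n : ℕ, f n = Q ^ n • g n := by
  have hit : ∀ (m : ℕ) (g : ℕ → V), (fwdDiff 1)^[m] g =
      fun n => (Q⁻¹) ^ (n + m) • ((shiftS V - algebraMap ℂ _ Q) ^ m) (fun n => Q ^ n • g n) n := by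
    intro m
    induction m with
    | zero => intro g; ext n; simp [smul_smul, hQ]
    | succ m ih =>
      intro g
      rw [Function.iterate_succ_apply, ih]
      ext n
      rw [pow_succ (shiftS V - _), Module.End.mul_apply]
      have : (shiftS V - algebraMap ℂ _ Q) (fun n => Q ^ n • g n)
          = Q • fun n => Q ^ n • (fwdDiff 1 g n) := by
        ext n
        simp [Module.algebraMap_end_apply, fwdDiff, smul_smul, pow_succ, smul_sub, mul_comm]
      rw [this, map_smul, Pi.smul_apply, smul_smul, ← add_assoc, pow_succ Q⁻¹, mul_assoc,
        inv_mul_cancel₀ hQ, mul_one]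
  set g : ℕ → V := fun n => (Q⁻¹) ^ n • f n with hgdef
  have hgf : (fun n => Q ^ n • g n) = f := by ext n; simp [hgdef, smul_smul, hQ]
  have hz : ∀ k, m ≤ k → (fwdDiff 1)^[k] g = 0 := by
    intro k hk
    obtain ⟨l, rfl⟩ := Nat.exists_eq_add_of_le' hk
    rw [hit, hgf, pow_add, Module.End.mul_apply, hf]
    ext; simp
  refine ⟨fun x => ∑ j : Fin m, ((descPochhammer ℂ j).eval x / (j : ℕ).factorial) •
    (fwdDiff 1)^[j] g 0, ?_, ?_⟩
  · refine PolyV.sum _ _ fun j _ φ => ?_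
    refine ⟨((φ ((fwdDiff 1)^[j] g 0)) / ((j : ℕ).factorial : ℂ)) • descPochhammer ℂ j, ?_, ?_⟩
    · refine lt_of_le_of_lt (degree_smul_le _ _) (lt_of_le_of_lt degree_le_natDegree ?_)
      rw [descPochhammer_natDegree]
      exact_mod_cast j.2
    · intro x
      simp
      ring
  · intro n
    rw [← hgf]
    change Q ^ n • g n = _
    congr 1
    have h1 := shift_eq_sum_fwdDiff_iter (1 : ℕ) g n 0
    simp only [zero_add, smul_eq_mul, mul_one] at h1
    rw [h1]
    simp only [← Nat.cast_choose_eq_descPochhammer_div]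
    rw [Fin.sum_univ_eq_sum_range (fun j => ((n.choose j : ℕ) : ℂ) • (fwdDiff 1)^[j] g 0)]
    simp only [Nat.cast_smul_eq_nsmul]
    have e1 : ∀ M, n + 1 ≤ M → m ≤ M ∨ True → ∑ k ∈ Finset.range (n + 1), n.choose k • (fwdDiff 1)^[k] g 0
        = ∑ k ∈ Finset.range M, n.choose k • (fwdDiff 1)^[k] g 0 := by
      intro M hM _
      refine Finset.sum_subset (Finset.range_mono hM) fun k _ hk => ?_
      rw [Nat.choose_eq_zero_of_lt (by simpa using hk), zero_smul]
    have e2 : ∀ M, m ≤ M → ∑ k ∈ Finset.range m, n.choose k • (fwdDiff 1)^[k] g 0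
        = ∑ k ∈ Finset.range M, n.choose k • (fwdDiff 1)^[k] g 0 := by
      intro M hM
      refine Finset.sum_subset (Finset.range_mono hM) fun k _ hk => ?_
      rw [hz k (by simpa using hk)]; simp
    rw [e1 (n + 1 + m) (by omega) (by simp), e2 (n + 1 + m) (by omega)]

lemma ker_prod (Λ : Finset ℂ) (e : ℂ → ℕ) (f : ℕ → V)
    (hf : aeval (shiftS V) (∏ Q ∈ Λ, (X - C Q) ^ e Q) f = 0) :
    ∃ h : ℂ → ℕ → V, (∀ Q ∈ Λ, ((shiftS V - algebraMap ℂ _ Q) ^ e Q) (h Q) = 0) ∧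
      f = ∑ Q ∈ Λ, h Q := by
  classical
  induction Λ using Finset.induction_on generalizing f with
  | empty => exact ⟨0, by simp, by simpa using hf⟩
  | insert a s ha ih =>
    rw [Finset.prod_insert ha] at hf
    have hc : IsCoprime ((X - C a) ^ e a) (∏ Q ∈ s, (X - C Q) ^ e Q) := by
      refine IsCoprime.prod_right fun Q hQ => ?_
      refine IsCoprime.pow ?_
      apply isCoprime_X_sub_C_of_isUnit_sub
      rw [isUnit_iff_ne_zero, sub_ne_zero]
      rintro rfl; exact ha hQ
    have hm := sup_ker_aeval_eq_ker_aeval_mul_of_coprime (shiftS V) hc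
    have : f ∈ LinearMap.ker (aeval (shiftS V) ((X - C a) ^ e a * ∏ Q ∈ s, (X - C Q) ^ e Q)) := hf
    rw [← hm, Submodule.mem_sup] at this
    obtain ⟨y, hy, z, hz, rfl⟩ := this
    obtain ⟨h, h1, h2⟩ := ih z hz
    have hne : ∀ Q ∈ s, Q ≠ a := by rintro Q hQ rfl; exact ha hQ
    refine ⟨Function.update h a y, ?_, ?_⟩
    · intro Q hQ
      rcases Finset.mem_insert.1 hQ with rfl | hQ
      · simpa using hy
      · rw [Function.update_of_ne (hne Q hQ)]; exact h1 Q hQ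
    · rw [Finset.sum_insert ha, Function.update_self]
      congr 1
      rw [h2]
      exact Finset.sum_congr rfl fun Q hQ => by rw [Function.update_of_ne (hne Q hQ)]

/-- Structure of sequences killed by `χ(S)`. -/
lemma struct (χ : ℂ[X]) (hχ : χ ≠ 0) (f : ℕ → V) (hf : aeval (shiftS V) χ f = 0) :
    ∃ (n0 : ℕ) (m : ℕ) (g : ℂ → ℂ → V), (∀ Q, PolyV m (g Q)) ∧
      ∀ n, n0 ≤ n → f n = ∑ Q ∈ χ.roots.toFinset.erase 0, Q ^ n • g Q n := by
  classical
  have hsp := IsAlgClosed.splits χ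
  have e1 := hsp.eq_prod_roots
  have e2 : (χ.roots.map (fun a => X - C a)).prod
    = ∏ Q ∈ χ.roots.toFinset, (X - C Q) ^ χ.rootMultiplicity Q := prod_multiset_root_eq_finset_root
  rw [e2] at e1
  have hf2 : aeval (shiftS V) (∏ Q ∈ χ.roots.toFinset, (X - C Q) ^ χ.rootMultiplicity Q) f = 0 := by
    rw [e1, map_mul, aeval_C, Module.End.mul_apply, Module.algebraMap_end_apply] at hf
    exact (smul_eq_zero.1 hf).resolve_left (by simpa using hχ)
  obtain ⟨h, h1, h2⟩ := ker_prod _ _ f hf2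
  have h3 : ∀ Q ∈ χ.roots.toFinset.erase 0, ∃ g : ℂ → V, PolyV (χ.rootMultiplicity Q) g ∧
      ∀ n : ℕ, h Q n = Q ^ n • g n := fun Q hQ =>
    poly_of_kill Q (Finset.ne_of_mem_erase hQ) _ _ (h1 Q (Finset.mem_of_mem_erase hQ))
  choose! g hg hgh using h3
  refine ⟨χ.rootMultiplicity 0, χ.roots.toFinset.sup fun Q => χ.rootMultiplicity Q,
    fun Q => if Q ∈ χ.roots.toFinset.erase 0 then g Q else fun _ => 0, ?_, ?_⟩
  · intro Q
    dsimp only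
    split_ifs with hQ
    · exact (hg Q hQ).mono (Finset.le_sup (f := fun Q => χ.rootMultiplicity Q)
        (Finset.mem_of_mem_erase hQ))
    · exact PolyV.zero
  · intro n hn
    have h4 : ∑ Q ∈ χ.roots.toFinset.erase 0,
        Q ^ n • (if Q ∈ χ.roots.toFinset.erase 0 then g Q else fun _ => 0) (n : ℂ)
        = ∑ Q ∈ χ.roots.toFinset.erase 0, h Q n :=
      Finset.sum_congr rfl fun Q hQ => by rw [if_pos hQ, hgh Q hQ]
    rw [h4, h2, Finset.sum_apply]
    by_cases h0 : (0 : ℂ) ∈ χ.roots.toFinset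
    · rw [← Finset.add_sum_erase _ _ h0]
      have := h1 0 h0
      rw [map_zero, sub_zero] at this
      obtain ⟨k, rfl⟩ := Nat.exists_eq_add_of_le' hn
      have h5 := congrFun this k
      rw [shiftS_pow_apply] at h5
      rw [h5]; simp
    · rw [Finset.erase_eq_of_notMem h0]

end Part1

section Part2
open Polynomial
variable {V : Type*} [AddCommGroup V] [Module ℂ V]

/-- Sequence solutions of the recursion with coefficients `a`. -/
def Sol (N : ℕ) (a : ℕ → ℂ → Module.End ℂ V) : Submodule ℂ (ℕ → V) where
  carrier := {f | ∀ n : ℕ, ∑ k ∈ Finset.range (N + 1), a k n (f (n + k)) = 0}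
  add_mem' := by
    intro f g hf hg n
    simp [Finset.sum_add_distrib, hf n, hg n]
  zero_mem' := by intro n; simp
  smul_mem' := by
    intro c f hf n
    simp [← Finset.smul_sum, hf n]

lemma mem_Sol {N : ℕ} {a : ℕ → ℂ → Module.End ℂ V} {f : ℕ → V} :
    f ∈ Sol N a ↔ ∀ n : ℕ, ∑ k ∈ Finset.range (N + 1), a k n (f (n + k)) = 0 := Iff.rfl

/-- The solution with given initial values. -/
def solOf (N : ℕ) (a : ℕ → ℂ → Module.End ℂ V) (w : Fin N → V) (n : ℕ) : V :=
  if h : n < N then w ⟨n, h⟩ else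
    - ∑ k : Fin N, a k ((n - N : ℕ) : ℂ) (solOf N a w (n - N + k))
termination_by n
decreasing_by omega

lemma solOf_init (N : ℕ) (a : ℕ → ℂ → Module.End ℂ V) (w : Fin N → V) (k : Fin N) :
    solOf N a w k = w k := by
  rw [solOf, dif_pos k.2]

lemma solOf_step (N : ℕ) (a : ℕ → ℂ → Module.End ℂ V) (w : Fin N → V) (n : ℕ) :
    solOf N a w (n + N) = - ∑ k : Fin N, a k (n : ℂ) (solOf N a w (n + k)) := by
  rw [solOf, dif_neg (by omega)]
  simp

lemma solOf_mem (N : ℕ) (a : ℕ → ℂ → Module.End ℂ V) (ha : ∀ x, a N x = LinearMap.id)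
    (w : Fin N → V) : solOf N a w ∈ Sol N a := by
  intro n
  rw [Finset.sum_range_succ, ha, LinearMap.id_apply, solOf_step,
    Fin.sum_univ_eq_sum_range (fun k => a k (n : ℂ) (solOf N a w (n + k)))]
  simp

lemma Sol_step {N : ℕ} {a : ℕ → ℂ → Module.End ℂ V} (ha : ∀ x, a N x = LinearMap.id)
    {f : ℕ → V} (hf : f ∈ Sol N a) (n : ℕ) :
    f (n + N) = - ∑ k ∈ Finset.range N, a k n (f (n + k)) := by
  have := hf n
  rw [Finset.sum_range_succ, ha, LinearMap.id_apply] at this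
  rw [eq_neg_iff_add_eq_zero, add_comm, this]

lemma Sol_eq_zero {N : ℕ} {a : ℕ → ℂ → Module.End ℂ V} (ha : ∀ x, a N x = LinearMap.id)
    {f : ℕ → V} (hf : f ∈ Sol N a) (h0 : ∀ k < N, f k = 0) (n : ℕ) : f n = 0 := by
  induction n using Nat.strong_induction_on with
  | _ n ih =>
    by_cases hn : n < N
    · exact h0 n hn
    · obtain ⟨k, rfl⟩ := Nat.exists_eq_add_of_le' (not_lt.1 hn)
      rw [Sol_step ha hf, Finset.sum_eq_zero, neg_zero]
      intro j hj
      rw [ih _ (by have := Finset.mem_range.1 hj; omega), map_zero]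

/-- Solutions are parametrized by initial values. -/
def solEquiv (N : ℕ) (a : ℕ → ℂ → Module.End ℂ V) (ha : ∀ x, a N x = LinearMap.id) :
    Sol N a ≃ₗ[ℂ] (Fin N → V) :=
  LinearEquiv.ofBijective
    ({ toFun := fun f k => f.1 k
       map_add' := fun _ _ => rfl
       map_smul' := fun _ _ => rfl } : Sol N a →ₗ[ℂ] (Fin N → V)) (by
    constructor
    · rw [← LinearMap.ker_eq_bot, LinearMap.ker_eq_bot']
      intro f hf
      ext n
      exact Sol_eq_zero ha f.2 (fun k hk => congrFun hf ⟨k, hk⟩) n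
    · intro w
      refine ⟨⟨solOf N a w, solOf_mem N a ha w⟩, ?_⟩
      ext k
      exact solOf_init N a w k)

lemma Sol_eq_solOf {N : ℕ} {a : ℕ → ℂ → Module.End ℂ V} (ha : ∀ x, a N x = LinearMap.id)
    {f : ℕ → V} (hf : f ∈ Sol N a) : f = solOf N a (fun k => f k) := by
  have h := (Sol N a).sub_mem hf (solOf_mem N a ha (fun k => f k))
  ext n
  have := Sol_eq_zero ha h (fun k hk => by
    have := solOf_init N a (fun k => f k) ⟨k, hk⟩
    simp only at this
    simp [this]) n
  simpa [sub_eq_zero] using this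

/-- Rationality of the coefficients with common denominator `q`. -/
def RatC (N : ℕ) (a : ℕ → ℂ → Module.End ℂ V) (q : ℂ[X]) : Prop :=
  (∀ n : ℕ, q.eval (n : ℂ) ≠ 0) ∧ ∀ k ≤ N, ∀ (v : V) (φ : Module.Dual ℂ V),
    ∃ p : ℂ[X], ∀ x, q.eval x ≠ 0 → q.eval x * φ (a k x v) = p.eval x

variable [FiniteDimensional ℂ V]

lemma Sol_finite (N : ℕ) (a : ℕ → ℂ → Module.End ℂ V) (ha : ∀ x, a N x = LinearMap.id) :
    FiniteDimensional ℂ (Sol N a) := (solEquiv N a ha).symm.finiteDimensional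

lemma Sol_finrank (N : ℕ) (a : ℕ → ℂ → Module.End ℂ V) (ha : ∀ x, a N x = LinearMap.id) :
    Module.finrank ℂ (Sol N a) = N * Module.finrank ℂ V := by
  rw [(solEquiv N a ha).finrank_eq, Module.finrank_pi_fintype]
  simp

lemma RatC.term {N : ℕ} {a : ℕ → ℂ → Module.End ℂ V} {q : ℂ[X]} (hq : RatC N a q)
    {m : ℕ} {g : ℂ → V} (hg : PolyV m g) (φ : Module.Dual ℂ V) (k : ℕ) (hk : k ≤ N) :
    ∃ R : ℂ[X], ∀ x, q.eval x ≠ 0 → q.eval x * φ (a k x (g (x + k))) = R.eval x := by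
  let b := Module.finBasis ℂ V
  choose p hp h2 using fun s => (hg.shift (k : ℂ)) (b.coord s)
  choose r hr using fun s => hq.2 k hk (b s) φ
  refine ⟨∑ s, p s * r s, fun x hx => ?_⟩
  conv_lhs => rw [← b.sum_repr (g (x + k))]
  rw [map_sum, map_sum, Finset.mul_sum, eval_finsetSum]
  refine Finset.sum_congr rfl fun s _ => ?_
  rw [map_smul, map_smul, eval_mul, ← hr s x hx, ← h2 s x, smul_eq_mul, Module.Basis.coord_apply]
  ring

/-- Components of an exponential-polynomial solution are solutions. -/
lemma component {N : ℕ} {a : ℕ → ℂ → Module.End ℂ V} {q : ℂ[X]} (hq : RatC N a q)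
    (Λ : Finset ℂ) (h0 : (0 : ℂ) ∉ Λ) (m : ℕ) (g : ℂ → ℂ → V) (hg : ∀ Q ∈ Λ, PolyV m (g Q))
    (n0 : ℕ) (h : ∀ n : ℕ, n0 ≤ n →
      ∑ k ∈ Finset.range (N + 1), a k n (∑ Q ∈ Λ, Q ^ (n + k) • g Q (n + k)) = 0) :
    ∀ Q ∈ Λ, ∀ x, q.eval x ≠ 0 →
      ∑ k ∈ Finset.range (N + 1), a k x (Q ^ k • g Q (x + k)) = 0 := by
  have main : ∀ φ : Module.Dual ℂ V, ∀ Q ∈ Λ, ∀ x, q.eval x ≠ 0 →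
      φ (∑ k ∈ Finset.range (N + 1), a k x (Q ^ k • g Q (x + k))) = 0 := by
    intro φ
    have h1 : ∀ Q ∈ Λ, ∀ k ∈ Finset.range (N + 1), ∃ R : ℂ[X], ∀ x, q.eval x ≠ 0 →
        q.eval x * φ (a k x (g Q (x + k))) = R.eval x := fun Q hQ k hk =>
      hq.term (hg Q hQ) φ k (by have := Finset.mem_range.1 hk; omega)
    choose! R hR using h1
    let T : ℂ → ℂ[X] := fun Q => ∑ k ∈ Finset.range (N + 1), C (Q ^ k) * R Q k
    have hT : ∀ Q ∈ Λ, ∀ x, q.eval x ≠ 0 → (T Q).eval x =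
        q.eval x * φ (∑ k ∈ Finset.range (N + 1), a k x (Q ^ k • g Q (x + k))) := by
      intro Q hQ x hx
      simp only [T, eval_finsetSum, map_sum, Finset.mul_sum]
      refine Finset.sum_congr rfl fun k hk => ?_
      rw [eval_mul, eval_C, ← hR Q hQ k hk x hx, map_smul, map_smul, smul_eq_mul]
      ring
    have hz := key Λ h0 (fun Q x => (T Q).eval x) (fun Q _ => ⟨_, PolyV.scalar (T Q)⟩) n0 ?_
    · intro Q hQ x hx
      have := hT Q hQ x hx
      rw [hz Q hQ x] at this
      exact (mul_eq_zero.1 this.symm).resolve_left hx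
    · intro n hn
      have h3 := congrArg (fun v => q.eval (n : ℂ) * φ v) (h n hn)
      simp only [map_zero, mul_zero] at h3
      rw [← h3]
      have h4 : ∑ k ∈ Finset.range (N + 1), a k (n : ℂ) (∑ Q ∈ Λ, Q ^ (n + k) • g Q (n + k))
        = ∑ Q ∈ Λ, Q ^ n • ∑ k ∈ Finset.range (N + 1), a k (n : ℂ) (Q ^ k • g Q (n + k)) := by
        simp only [map_sum, Finset.smul_sum]
        rw [Finset.sum_comm]
        simp only [map_smul, smul_smul, pow_add]
      rw [h4, map_sum, Finset.mul_sum]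
      refine Finset.sum_congr rfl fun Q hQ => ?_
      rw [hT Q hQ n (hq.1 n), map_smul, smul_eq_mul, smul_eq_mul]
      ring
  exact fun Q hQ x hx => dual_sep fun φ => main φ Q hQ x hx

lemma exists_chi {N : ℕ} {a : ℕ → ℂ → Module.End ℂ V} (ha : ∀ x, a N x = LinearMap.id)
    {q : ℂ[X]} (hq : RatC N a q)
    (Λ : Finset ℂ) (h0 : (0 : ℂ) ∉ Λ) (m : ℕ)
    (G : Fin (N * Module.finrank ℂ V) → ℕ → V) (hG : LinearIndependent ℂ G)
    (hS : ∀ i, G i ∈ Sol N a)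
    (g : Fin (N * Module.finrank ℂ V) → ℂ → ℂ → V) (hg : ∀ i, ∀ Q ∈ Λ, PolyV m (g i Q))
    (hGg : ∀ i (n : ℕ), G i n = ∑ Q ∈ Λ, Q ^ n • g i Q n) :
    ∃ χ : ℂ[X], χ ≠ 0 ∧ χ.natDegree ≤ N * Module.finrank ℂ V * m ∧
      ∀ f ∈ Sol N a, aeval (shiftS V) χ f = 0 := by
  classical
  have := Sol_finite N a ha
  let E : Fin (N * Module.finrank ℂ V) → ℂ → ℕ → V := fun i Q n => Q ^ n • g i Q n
  have hES : ∀ i, ∀ Q ∈ Λ, E i Q ∈ Sol N a := by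
    intro i Q hQ n
    have := component hq Λ h0 m (g i) (hg i) 0 (fun n _ => by
      have h1 := hS i n
      simp only [hGg] at h1
      push_cast at h1
      exact h1) Q hQ n (hq.1 n)
    have h2 := congrArg (fun v => Q ^ n • v) this
    simp only [Finset.smul_sum, smul_zero] at h2
    rw [← h2]
    refine Finset.sum_congr rfl fun k _ => ?_
    simp [E, smul_smul, pow_add]
  have hEg : ∀ i, ∀ Q ∈ Λ, E i Q ∈ (shiftS V).maxGenEigenspace Q := fun i Q hQ =>
    mem_gen Q (hg i Q hQ)
  let Λ' := Λ.filter fun Q => ∃ i, E i Q ≠ 0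
  have hΛ' : ∀ Q : Λ', Q.1 ∈ Λ := fun Q => (Finset.mem_filter.1 Q.2).1
  have hcard : Λ'.card ≤ N * Module.finrank ℂ V := by
    choose i hi using fun Q : Λ' => (Finset.mem_filter.1 Q.2).2
    have h1 : LinearIndependent ℂ (fun Q : Λ' => E (i Q) Q.1) :=
      iSupIndep.linearIndependent (fun Q : Λ' => (shiftS V).maxGenEigenspace Q.1)
        ((shiftS V).independent_maxGenEigenspace.comp Subtype.val_injective)
        (fun Q => hEg _ _ (hΛ' Q)) (fun Q => hi Q)
    have h2 : LinearIndependent ℂ (fun Q : Λ' => (⟨E (i Q) Q.1, hES _ _ (hΛ' Q)⟩ : Sol N a)) :=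
      LinearIndependent.of_comp (Sol N a).subtype h1
    have h3 := h2.fintype_card_le_finrank
    rw [Sol_finrank N a ha] at h3
    simpa using h3
  refine ⟨∏ Q ∈ Λ', (X - C Q) ^ m, ?_, ?_, ?_⟩
  · exact Finset.prod_ne_zero_iff.2 fun Q _ => pow_ne_zero _ (X_sub_C_ne_zero Q)
  · rw [natDegree_prod _ _ fun Q _ => pow_ne_zero _ (X_sub_C_ne_zero Q)]
    simp only [natDegree_pow, natDegree_X_sub_C, mul_one, Finset.sum_const, smul_eq_mul]
    exact Nat.mul_le_mul_right _ hcard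
  · have hkE : ∀ i, ∀ Q ∈ Λ, aeval (shiftS V) (∏ Q ∈ Λ', (X - C Q) ^ m) (E i Q) = 0 := by
      intro i Q hQ
      by_cases hQ' : Q ∈ Λ'
      · rw [← Finset.prod_erase_mul _ _ hQ', map_mul, Module.End.mul_apply]
        have := kill_V Q (hg i Q hQ)
        have h2 : aeval (shiftS V) ((X - C Q) ^ m) (E i Q) = 0 := by
          simpa using this
        rw [h2, map_zero]
      · have : E i Q = 0 := by
          by_contra hne
          exact hQ' (Finset.mem_filter.2 ⟨hQ, i, hne⟩)
        rw [this, map_zero]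
    have hkG : ∀ i, aeval (shiftS V) (∏ Q ∈ Λ', (X - C Q) ^ m) (G i) = 0 := by
      intro i
      have : G i = ∑ Q ∈ Λ, E i Q := by
        ext n
        rw [hGg, Finset.sum_apply]
      rw [this, map_sum, Finset.sum_eq_zero fun Q hQ => hkE i Q hQ]
    let G' : Fin (N * Module.finrank ℂ V) → Sol N a := fun i => ⟨G i, hS i⟩
    have hG' : LinearIndependent ℂ G' := LinearIndependent.of_comp (Sol N a).subtype hG
    have hspan := hG'.span_eq_top_of_card_eq_finrank' (by simp [Sol_finrank N a ha])
    have hle : (⊤ : Submodule ℂ (Sol N a)) ≤ LinearMap.ker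
        ((aeval (shiftS V) (∏ Q ∈ Λ', (X - C Q) ^ m)).comp (Sol N a).subtype) := by
      rw [← hspan, Submodule.span_le]
      rintro _ ⟨i, rfl⟩
      exact hkG i
    intro f hf
    exact hle (Submodule.mem_top (x := (⟨f, hf⟩ : Sol N a)))

end Part2

section Part3
open Polynomial Filter Topology

lemma apply_tendsto {V : Type*} [NormedAddCommGroup V] [NormedSpace ℂ V] [FiniteDimensional ℂ V]
    {T : ℕ → Module.End ℂ V} {T0 : Module.End ℂ V}
    (hT : ∀ v, Tendsto (fun j => T j v) atTop (𝓝 (T0 v)))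
    {f : ℕ → V} {f0 : V} (hf : Tendsto f atTop (𝓝 f0)) :
    Tendsto (fun j => T j (f j)) atTop (𝓝 (T0 f0)) := by
  let b := Module.finBasis ℂ V
  have h1 : ∀ (S : Module.End ℂ V) (v : V), S v = ∑ s, b.coord s v • S (b s) := by
    intro S v
    conv_lhs => rw [← b.sum_repr v]
    simp only [map_sum, map_smul, Module.Basis.coord_apply]
  rw [h1 T0 f0, show (fun j => T j (f j)) = fun j => ∑ s, b.coord s (f j) • T j (b s) from
    funext fun j => h1 _ _]
  refine tendsto_finsetSum _ fun s _ => ?_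
  refine Tendsto.smul ?_ (hT _)
  exact ((LinearMap.continuous_of_finiteDimensional (b.coord s)).tendsto f0).comp hf

lemma solOf_tendsto {V : Type*} [NormedAddCommGroup V] [NormedSpace ℂ V] [FiniteDimensional ℂ V]
    {N : ℕ} {aj : ℕ → ℕ → ℂ → Module.End ℂ V} {a : ℕ → ℂ → Module.End ℂ V}
    (h : ∀ k < N, ∀ (n : ℕ) (v : V), Tendsto (fun j => aj j k n v) atTop (𝓝 (a k n v)))
    (w : Fin N → V) (n : ℕ) :
    Tendsto (fun j => solOf N (aj j) w n) atTop (𝓝 (solOf N a w n)) := by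
  induction n using Nat.strong_induction_on with
  | _ n ih =>
    by_cases hn : n < N
    · have h1 : ∀ a : ℕ → ℂ → Module.End ℂ V, solOf N a w n = w ⟨n, hn⟩ :=
        fun a => solOf_init N a w ⟨n, hn⟩
      simp only [h1]
      exact tendsto_const_nhds
    · obtain ⟨k, rfl⟩ := Nat.exists_eq_add_of_le' (not_lt.1 hn)
      simp only [solOf_step]
      refine Tendsto.neg (tendsto_finsetSum _ fun s _ => ?_)
      exact apply_tendsto (h s s.2 k) (ih _ (by omega))

lemma aeval_shift_apply {V : Type*} [AddCommGroup V] [Module ℂ V] (χ : ℂ[X]) (M : ℕ)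
    (hM : χ.natDegree ≤ M) (f : ℕ → V) (n : ℕ) :
    aeval (shiftS V) χ f n = ∑ l : Fin (M + 1), χ.coeff l • f (n + l) := by
  rw [aeval_eq_sum_range' (Nat.lt_succ_of_le hM),
    Fin.sum_univ_eq_sum_range (fun l => χ.coeff l • f (n + l)), LinearMap.sum_apply,
    Finset.sum_apply]
  refine Finset.sum_congr rfl fun l _ => ?_
  rw [LinearMap.smul_apply, Pi.smul_apply, shiftS_pow_apply]

lemma limit_chi {V : Type*} [NormedAddCommGroup V] [NormedSpace ℂ V] [FiniteDimensional ℂ V]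
    {N : ℕ} {aj : ℕ → ℕ → ℂ → Module.End ℂ V} {a : ℕ → ℂ → Module.End ℂ V}
    (h : ∀ k < N, ∀ (n : ℕ) (v : V), Tendsto (fun j => aj j k n v) atTop (𝓝 (a k n v)))
    (M : ℕ) (hχ : ∀ j, ∃ χ : ℂ[X], χ ≠ 0 ∧ χ.natDegree ≤ M ∧
      ∀ w, aeval (shiftS V) χ (solOf N (aj j) w) = 0) :
    ∃ χ : ℂ[X], χ ≠ 0 ∧ ∀ w, aeval (shiftS V) χ (solOf N a w) = 0 := by
  choose χ h0 hdeg hk using hχ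
  let c : ℕ → Fin (M + 1) → ℂ := fun j l => (χ j).coeff l
  have hc : ∀ j, c j ≠ 0 := by
    intro j hj
    have := congrFun hj ⟨(χ j).natDegree, Nat.lt_succ_of_le (hdeg j)⟩
    simp [c] at this
    exact h0 j this
  let e : ℕ → Fin (M + 1) → ℂ := fun j => ((‖c j‖⁻¹ : ℝ) : ℂ) • c j
  have he : ∀ j, e j ∈ Metric.sphere (0 : Fin (M + 1) → ℂ) 1 := by
    intro j
    have : ‖c j‖ ≠ 0 := norm_ne_zero_iff.2 (hc j)
    simp [e, norm_smul, this]
  obtain ⟨e0, he0, ψ, hψ, hlim⟩ := (isCompact_sphere (0 : Fin (M + 1) → ℂ) 1).tendsto_subseq he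
  have hz : ∀ j w n, ∑ l : Fin (M + 1), e j l • solOf N (aj j) w (n + l) = 0 := by
    intro j w n
    have := congrFun (hk j w) n
    rw [aeval_shift_apply _ M (hdeg j)] at this
    simp only [e, Pi.smul_apply, smul_assoc, ← Finset.smul_sum]
    rw [this]; simp
  have hz0 : ∀ w n, ∑ l : Fin (M + 1), e0 l • solOf N a w (n + l) = 0 := by
    intro w n
    have h1 : Tendsto (fun j => ∑ l : Fin (M + 1), e (ψ j) l • solOf N (aj (ψ j)) w (n + l)) atTop
        (𝓝 (∑ l : Fin (M + 1), e0 l • solOf N a w (n + l))) := by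
      refine tendsto_finsetSum _ fun l _ => Tendsto.smul ?_ ?_
      · exact ((continuous_apply l).tendsto e0).comp hlim
      · exact (solOf_tendsto h w (n + l)).comp hψ.tendsto_atTop
    simp only [hz] at h1
    exact (tendsto_nhds_unique h1 tendsto_const_nhds)
  let χ0 : ℂ[X] := ∑ l : Fin (M + 1), C (e0 l) * X ^ (l : ℕ)
  have hcoeff : ∀ l : Fin (M + 1), χ0.coeff l = e0 l := by
    intro l
    simp only [χ0, finsetSum_coeff, coeff_C_mul, coeff_X_pow]
    rw [Finset.sum_eq_single l]
    · simp
    · intro b _ hb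
      rw [if_neg (fun h => hb (Fin.ext h.symm)), mul_zero]
    · simp
  have hd0 : χ0.natDegree ≤ M := by
    refine natDegree_sum_le_of_forall_le _ _ fun l _ => ?_
    exact (natDegree_C_mul_X_pow_le _ _).trans (Nat.lt_succ_iff.1 l.2)
  refine ⟨χ0, ?_, ?_⟩
  · intro h
    have : e0 = 0 := by
      ext l
      rw [← hcoeff, h]; simp
    rw [this] at he0
    simp at he0
  · intro w
    ext n
    rw [aeval_shift_apply _ M hd0]
    simp only [hcoeff, hz0]
    rfl

end Part3

section Part4
open Polynomial

lemma right_inv {ι β : Type*} [Fintype ι] [Fintype β] [DecidableEq ι] (Φ : ι → β → ℂ[X])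
    (h : LinearIndependent ℂ[X] Φ) :
    ∃ r : ℂ[X], r ≠ 0 ∧ ∃ M : β → ι → ℂ[X], ∀ i i',
      ∑ b, Φ i b * M b i' = if i = i' then r else 0 := by
  classical
  let K := FractionRing ℂ[X]
  let Φ' : ι → β → K := fun i b => algebraMap ℂ[X] K (Φ i b)
  have h1 : LinearIndependent ℂ[X] Φ' := by
    refine h.map' (LinearMap.compLeft (Algebra.linearMap ℂ[X] K) β) ?_
    rw [LinearMap.ker_eq_bot]
    intro x y hxy
    ext1 b
    exact IsFractionRing.injective ℂ[X] K (congrFun hxy b)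
  have h2 : LinearIndependent K Φ' := (LinearIndependent.iff_fractionRing ℂ[X] K).1 h1
  have h3 : LinearMap.ker (Fintype.linearCombination K Φ') = ⊥ :=
    LinearMap.ker_eq_bot.2 (by
      intro x y hxy
      exact h2.fintypeLinearCombination_injective hxy)
  obtain ⟨L, hL⟩ := LinearMap.exists_leftInverse_of_injective _ h3
  let M' : β → ι → K := fun b i => L (Pi.single b 1) i
  have h4 : ∀ i i', ∑ b, Φ' i b * M' b i' = if i = i' then 1 else 0 := by
    intro i i'
    have e1 : Φ' i = ∑ b, Φ' i b • (Pi.single b 1 : β → K) := by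
      ext b; simp [Finset.sum_apply, Pi.single_apply]
    have e2 : L (Φ' i) = Pi.single i 1 := by
      have := LinearMap.congr_fun hL (Pi.single i 1)
      simpa [Fintype.linearCombination_apply, Pi.single_apply, ite_smul] using this
    have e3 := congrArg (fun v => L v i') e1
    simp only [e2, map_sum, map_smul, Finset.sum_apply, Pi.smul_apply, smul_eq_mul] at e3
    rw [← e3, Pi.single_apply]
    simp only [eq_comm]
  obtain ⟨r, hr⟩ := IsLocalization.exist_integer_multiples_of_finite (nonZeroDivisors ℂ[X])
    (fun p : β × ι => M' p.1 p.2)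
  choose M hM using hr
  refine ⟨r, nonZeroDivisors.coe_ne_zero r, fun b i => M (b, i), fun i i' => ?_⟩
  apply IsFractionRing.injective ℂ[X] K
  rw [map_sum]
  simp only [map_mul, hM, Algebra.smul_def]
  have : ∀ b, algebraMap ℂ[X] K (Φ i b) * (algebraMap ℂ[X] K r * M' b i')
      = algebraMap ℂ[X] K r * (Φ' i b * M' b i') := fun b => by simp only [Φ']; ring
  simp only [this, ← Finset.mul_sum, h4]
  split_ifs <;> simp

lemma B_indep {V : Type*} [AddCommGroup V] [Module ℂ V] {d : ℕ} (b : Module.Basis (Fin d) ℂ V)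
    (Λ : Finset ℂ) (h0 : (0 : ℂ) ∉ Λ) (μ : ℂ → ℂ) (hμ : ∀ Q ∈ Λ, Complex.exp (μ Q) = Q) (m : ℕ)
    (β : ℂ → Fin m → Fin d → ℂ) (u : ℂ)
    (h : ∀ n : ℕ, ∑ Q ∈ Λ, ∑ j, ∑ s, β Q j s •
      (Complex.exp (μ Q * (u + n)) * (u + n) ^ (j : ℕ)) • b s = 0) :
    ∀ Q ∈ Λ, ∀ j s, β Q j s = 0 := by
  have hk := key Λ h0 (fun Q x => Complex.exp (μ Q * u) • ∑ j : Fin m, ∑ s, β Q j s •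
      (x + u) ^ (j : ℕ) • b s) ?_ 0 ?_
  · intro Q hQ
    have h1 : ∀ y : ℂ, ∑ s, (∑ j : Fin m, β Q j s * y ^ (j : ℕ)) • b s = 0 := by
      intro y
      have := hk Q hQ (y - u)
      rw [smul_eq_zero] at this
      have := this.resolve_left (Complex.exp_ne_zero _)
      rw [Finset.sum_comm] at this
      simpa [Finset.sum_smul, smul_smul] using this
    have h2 : ∀ s (y : ℂ), ∑ j : Fin m, β Q j s * y ^ (j : ℕ) = 0 := fun s y =>
      Fintype.linearIndependent_iff.1 b.linearIndependent _ (h1 y) s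
    intro j s
    let p : ℂ[X] := ∑ j : Fin m, C (β Q j s) * X ^ (j : ℕ)
    have hp : p = 0 := by
      apply Polynomial.funext
      intro y
      simp [p, eval_finsetSum, h2 s y]
    have : p.coeff j = β Q j s := by
      simp only [p, finsetSum_coeff, coeff_C_mul, coeff_X_pow]
      rw [Finset.sum_eq_single j]
      · simp
      · intro b _ hb
        rw [if_neg (fun h => hb (Fin.ext h.symm)), mul_zero]
      · simp
    rw [← this, hp, coeff_zero]
  · intro Q _
    refine ⟨m, PolyV.smul _ (PolyV.sum _ _ fun j _ => PolyV.sum _ _ fun s _ => ?_)⟩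
    exact ((PolyV.mono_term j (b s)).shift u).smul _
  · intro n _
    rw [← h n]
    refine Finset.sum_congr rfl fun Q hQ => ?_
    rw [smul_smul, Finset.smul_sum]
    refine Finset.sum_congr rfl fun j _ => ?_
    rw [Finset.smul_sum]
    refine Finset.sum_congr rfl fun s _ => ?_
    simp only [smul_smul]
    have : Complex.exp (μ Q * (u + n)) = Q ^ n * Complex.exp (μ Q * u) := by
      rw [mul_add, Complex.exp_add, mul_comm (μ Q) (n : ℂ), Complex.exp_nat_mul, hμ Q hQ, mul_comm]
    rw [this, add_comm u]
    congr 1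
    ring

end Part4

section Part5
open Polynomial

/-- The basic one-periodic exponential. -/
def perE (u : ℂ) : ℂ := Complex.exp (2 * Real.pi * Complex.I * u)

lemma perE_add_nat (u : ℂ) (n : ℕ) : perE (u + n) = perE u := by
  unfold perE
  rw [Complex.exp_eq_exp_iff_exists_int]
  exact ⟨n, by push_cast; ring⟩

lemma perE_surj (z : ℂ) (hz : z ≠ 0) : ∃ u, perE u = z := by
  refine ⟨Complex.log z / (2 * Real.pi * Complex.I), ?_⟩
  unfold perE
  rw [mul_div_cancel₀ _ Complex.two_pi_I_ne_zero, Complex.exp_log hz]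

lemma perE_countable (r : ℂ[X]) (hr : r ≠ 0) : {u : ℂ | r.eval (perE u) = 0}.Countable := by
  have h1 : {u : ℂ | r.eval (perE u) = 0} ⊆ ⋃ ρ ∈ r.roots.toFinset, {u | perE u = ρ} := by
    intro u hu
    simp only [Set.mem_iUnion, Multiset.mem_toFinset, mem_roots hr]
    exact ⟨perE u, hu, rfl⟩
  refine Set.Countable.mono h1 (Set.Countable.biUnion (Finset.countable_toSet _) fun ρ _ => ?_)
  by_cases h : ∃ u0, perE u0 = ρ
  · obtain ⟨u0, h0⟩ := h
    refine Set.Countable.mono ?_ (Set.countable_range (fun n : ℤ => u0 + n))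
    intro u hu
    have hu : perE u = ρ := hu
    rw [← h0] at hu
    unfold perE at hu
    rw [Complex.exp_eq_exp_iff_exists_int] at hu
    obtain ⟨n, hn⟩ := hu
    refine ⟨n, ?_⟩
    have h2 : (2 * Real.pi * Complex.I) * u = (2 * Real.pi * Complex.I) * (u0 + n) := by
      rw [hn]; ring
    exact (mul_left_cancel₀ Complex.two_pi_I_ne_zero h2).symm
  · refine Set.Countable.mono ?_ Set.countable_empty
    intro u hu
    exact h ⟨u, hu⟩

lemma generic {V : Type*} [AddCommGroup V] [Module ℂ V] [FiniteDimensional ℂ V]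
    {ι : Type*} [Fintype ι] (m : ℕ) (F : ι → ℂ → V)
    (hF : ∀ i, IsQEdeg m (F i)) (hI : IndepPeriodic F) :
    ∃ (Z : Set ℂ) (Λ : Finset ℂ), Z.Countable ∧ (0 : ℂ) ∉ Λ ∧ ∀ u0 ∉ Z,
      LinearIndependent ℂ (fun i (n : ℕ) => F i (u0 + n)) ∧
      ∃ g : ι → ℂ → ℂ → V, (∀ i Q, PolyV m (g i Q)) ∧
        ∀ i (n : ℕ), F i (u0 + n) = ∑ Q ∈ Λ, Q ^ n • g i Q n := by
  classical
  choose k lam v hFv using hF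
  let Λ : Finset ℂ := Finset.univ.image fun p : (Σ i, Fin (k i)) => Complex.exp (lam p.1 p.2)
  have hΛmem : ∀ i l, Complex.exp (lam i l) ∈ Λ := fun i l =>
    Finset.mem_image.2 ⟨⟨i, l⟩, Finset.mem_univ _, rfl⟩
  have h0 : (0 : ℂ) ∉ Λ := by
    intro h
    obtain ⟨p, _, hp⟩ := Finset.mem_image.1 h
    exact Complex.exp_ne_zero _ hp
  have ht : ∀ p : (Σ i, Fin (k i)), ∃ t : ℤ, lam p.1 p.2 =
      Complex.log (Complex.exp (lam p.1 p.2)) + t * (2 * Real.pi * Complex.I) := by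
    intro p
    rw [← Complex.exp_eq_exp_iff_exists_int, Complex.exp_log (Complex.exp_ne_zero _)]
  choose t ht using ht
  obtain ⟨K, hK⟩ := (Set.finite_range t).bddBelow
  have hK : ∀ p, K ≤ t p := fun p => hK ⟨p, rfl⟩
  let e : (Σ i, Fin (k i)) → ℕ := fun p => (t p - K).toNat
  have he : ∀ p, ((e p : ℕ) : ℤ) = t p - K := fun p => Int.toNat_of_nonneg (by have := hK p; omega)
  let μ : ℂ → ℂ := fun Q => Complex.log Q + K * (2 * Real.pi * Complex.I)
  have hμ : ∀ Q ∈ Λ, Complex.exp (μ Q) = Q := by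
    intro Q hQ
    have hQ0 : Q ≠ 0 := fun h => h0 (h ▸ hQ)
    simp only [μ]
    rw [Complex.exp_add, Complex.exp_log hQ0, Complex.exp_int_mul_two_pi_mul_I, mul_one]
  have hexp : ∀ p u, Complex.exp (lam p.1 p.2 * u) =
      Complex.exp (μ (Complex.exp (lam p.1 p.2)) * u) * perE u ^ e p := by
    intro p u
    unfold perE
    rw [← Complex.exp_nat_mul, ← Complex.exp_add]
    congr 1
    have h1 : ((e p : ℕ) : ℂ) = t p - K := by
      have := congrArg (fun z : ℤ => (z : ℂ)) (he p)
      simpa using this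
    rw [h1]
    conv_lhs => rw [ht p]
    simp only [μ]
    ring
  let b := Module.finBasis ℂ V
  let Φ : ι → (Λ × Fin m × Fin (Module.finrank ℂ V)) → ℂ[X] := fun i x =>
    ∑ l : Fin (k i), if Complex.exp (lam i l) = x.1.1 then
      C (b.repr (v i l x.2.1) x.2.2) * X ^ e ⟨i, l⟩ else 0
  have hFΦ : ∀ i u, F i u = ∑ x : Λ × Fin m × Fin (Module.finrank ℂ V), (Φ i x).eval (perE u) •
      (Complex.exp (μ x.1.1 * u) * u ^ (x.2.1 : ℕ)) • b x.2.2 := by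
    intro i u
    rw [hFv]
    simp only [Φ, eval_finsetSum, Finset.sum_smul]
    conv_rhs => rw [Finset.sum_comm]
    refine Finset.sum_congr rfl fun l _ => ?_
    rw [Fintype.sum_prod_type, Finset.sum_eq_single (⟨_, hΛmem i l⟩ : Λ)]
    · rw [Fintype.sum_prod_type]
      refine Finset.sum_congr rfl fun j _ => ?_
      conv_lhs => rw [← b.sum_repr (v i l j)]
      rw [Finset.smul_sum]
      refine Finset.sum_congr rfl fun s _ => ?_
      simp only [if_true, eval_mul, eval_C, eval_pow, eval_X, smul_smul]
      congr 1
      rw [hexp ⟨i, l⟩ u]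
      ring
    · intro Q _ hQ
      refine Finset.sum_eq_zero fun y _ => ?_
      rw [if_neg fun h => hQ (Subtype.ext h.symm)]
      simp
    · simp
  have hrow : LinearIndependent ℂ[X] Φ := by
    rw [Fintype.linearIndependent_iff]
    intro r hr i
    have hc := hI (fun i u => (r i).eval (perE u)) ?_ ?_ ?_ i
    · have hz : ∀ z, (r i * X).eval z = 0 := by
        intro z
        by_cases hz : z = 0
        · simp [hz]
        · obtain ⟨u, rfl⟩ := perE_surj z hz
          have := hc u (by
            have h1 : Differentiable ℂ (fun u => (r i).eval (perE u)) := by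
              unfold perE
              exact (r i).differentiable.comp (by fun_prop)
            exact h1.analyticAt u)
          simp [this]
      have := Polynomial.funext (p := r i * X) (q := 0) (by simpa using hz)
      exact (mul_eq_zero.1 this).resolve_right X_ne_zero
    · intro i x
      refine ⟨0, ?_⟩
      have h1 : Differentiable ℂ (fun u => (r i).eval (perE u)) := by
        unfold perE
        exact (r i).differentiable.comp (by fun_prop)
      simpa using h1.analyticAt x
    · intro i x
      have := perE_add_nat x 1
      simp only [Nat.cast_one] at this
      simp only [this]
    · intro x _
      simp only [hFΦ, Finset.smul_sum]
      rw [Finset.sum_comm]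
      refine Finset.sum_eq_zero fun y _ => ?_
      simp only [smul_smul, ← Finset.sum_smul, ← mul_assoc, ← Finset.sum_mul]
      have h2 := congrArg (fun p => p.eval (perE x)) (congrFun hr y)
      simp only [Finset.sum_apply, Pi.smul_apply, smul_eq_mul, eval_finsetSum, eval_mul,
        Pi.zero_apply, eval_zero] at h2
      rw [h2]
      simp
  obtain ⟨r, hr0, M, hM⟩ := right_inv Φ hrow
  refine ⟨{u : ℂ | r.eval (perE u) = 0}, Λ, perE_countable r hr0, h0, fun u0 hu0 => ⟨?_, ?_⟩⟩
  · rw [Fintype.linearIndependent_iff]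
    intro α hα
    let β : ℂ → Fin m → Fin (Module.finrank ℂ V) → ℂ := fun Q j s =>
      if h : Q ∈ Λ then ∑ i, α i * (Φ i (⟨Q, h⟩, j, s)).eval (perE u0) else 0
    have hβ := B_indep b Λ h0 μ hμ m β u0 (by
      intro n
      have h1 := congrFun hα n
      simp only [Finset.sum_apply, Pi.smul_apply, Pi.zero_apply, hFΦ, perE_add_nat,
        Finset.smul_sum] at h1
      rw [Finset.sum_comm] at h1
      rw [← h1, Fintype.sum_prod_type, ← Finset.sum_coe_sort Λ]
      refine Finset.sum_congr rfl fun Q _ => ?_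
      rw [Fintype.sum_prod_type]
      refine Finset.sum_congr rfl fun j _ => Finset.sum_congr rfl fun s _ => ?_
      simp only [β, dif_pos Q.2]
      rw [Finset.sum_smul]
      exact Finset.sum_congr rfl fun i _ => by rw [smul_smul, smul_smul, smul_smul, mul_assoc])
    have hβ2 : ∀ x, ∑ i, α i * (Φ i x).eval (perE u0) = 0 := by
      rintro ⟨Q, j, s⟩
      have := hβ Q.1 Q.2 j s
      simpa only [β, dif_pos Q.2] using this
    intro i'
    have h3 : ∑ x, (∑ i, α i * (Φ i x).eval (perE u0)) * (M x i').eval (perE u0) = 0 := by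
      simp [hβ2]
    simp only [Finset.sum_mul] at h3
    rw [Finset.sum_comm] at h3
    simp only [mul_assoc, ← Finset.mul_sum] at h3
    have h4 : ∀ i, ∑ x, (Φ i x).eval (perE u0) * (M x i').eval (perE u0) =
        if i = i' then r.eval (perE u0) else 0 := by
      intro i
      have := congrArg (fun p => p.eval (perE u0)) (hM i i')
      simp only [eval_finsetSum, eval_mul] at this
      rw [this]
      split_ifs <;> simp
    simp only [h4, mul_ite, mul_zero, Finset.sum_ite_eq', Finset.mem_univ, if_true] at h3
    exact (mul_eq_zero.1 h3).resolve_right hu0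
  · refine ⟨fun i Q x => ∑ l : Fin (k i), if Complex.exp (lam i l) = Q then
      Complex.exp (lam i l * u0) • ∑ j : Fin m, (x + u0) ^ (j : ℕ) • v i l j else 0, ?_, ?_⟩
    · intro i Q
      refine PolyV.sum _ _ fun l _ => ?_
      split_ifs with h
      · exact PolyV.smul _ (PolyV.sum _ _ fun j _ => (PolyV.mono_term j _).shift u0)
      · exact PolyV.zero
    · intro i n
      rw [hFv]
      simp only [Finset.smul_sum]
      conv_rhs => rw [Finset.sum_comm]
      refine Finset.sum_congr rfl fun l _ => ?_
      rw [Finset.sum_eq_single (Complex.exp (lam i l))]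
      · rw [if_pos rfl, Finset.smul_sum]
        refine Finset.sum_congr rfl fun j _ => ?_
        simp only [smul_smul]
        rw [mul_add, Complex.exp_add, mul_comm (lam i l) (n : ℂ), Complex.exp_nat_mul, add_comm u0]
        congr 1
        ring
      · intro Q _ hQ
        rw [if_neg (Ne.symm hQ), smul_zero]
      · intro h
        exact absurd (hΛmem i l) h

end Part5

section Part6
open Polynomial Filter Topology

lemma indep_of_points {V : Type*} [AddCommGroup V] [Module ℂ V] {ι : Type*} [Fintype ι]
    (F : ι → ℂ → V)
    (h : ∀ (y : ℂ) (α : ι → ℂ), (∀ n : ℕ, ∑ i, α i • F i (y + n) = 0) → ∀ i, α i = 0) :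
    IndepPeriodic F := by
  intro c hmer hper hz i x hx
  have hpern : ∀ i (n : ℕ) z, c i (z + n) = c i z := by
    intro i n
    induction n with
    | zero => simp
    | succ n ih => intro z; rw [Nat.cast_succ, ← add_assoc, hper, ih]
  have key1 : ∀ y, (∀ j, AnalyticAt ℂ (c j) y) → c i y = 0 := by
    intro y hy
    refine h y (fun i => c i y) (fun n => ?_) i
    have h1 : ∀ j, AnalyticAt ℂ (c j) (y + n) := by
      intro j
      have e1 : c j = c j ∘ fun z => z - (n : ℂ) := by
        ext z
        have := hpern j n (z - n)
        simpa using this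
      rw [e1]
      apply AnalyticAt.comp
      · simpa using hy j
      · fun_prop
    have h2 := hz (y + n) h1
    simpa only [hpern] using h2
  have h2 : ∀ᶠ y in 𝓝[≠] x, ∀ j, AnalyticAt ℂ (c j) y := by
    rw [eventually_all]
    intro j
    have : MeromorphicAt (c j) x := hmer j x
    exact this.eventually_analyticAt
  have h3 : Tendsto (c i) (𝓝[≠] x) (𝓝 (c i x)) := hx.continuousAt.tendsto.mono_left inf_le_left
  have h4 : Tendsto (c i) (𝓝[≠] x) (𝓝 0) :=
    tendsto_const_nhds.congr' (h2.mono fun y hy => (key1 y hy).symm)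
  exact tendsto_nhds_unique h3 h4

lemma Sol_eventually_zero {V : Type*} [AddCommGroup V] [Module ℂ V] {N : ℕ}
    {a : ℕ → ℂ → Module.End ℂ V} (hinj : ∀ (n : ℕ) v, a 0 n v = 0 → v = 0)
    {f : ℕ → V} (hf : f ∈ Sol N a) (n0 : ℕ) (h : ∀ n, n0 ≤ n → f n = 0) : f = 0 := by
  induction n0 with
  | zero => ext n; exact h n (Nat.zero_le _)
  | succ n0 ih =>
    refine ih fun n hn => ?_
    rcases Nat.eq_or_lt_of_le hn with rfl | hn
    · have h1 := hf n0
      rw [Finset.sum_range_succ', Finset.sum_eq_zero, zero_add] at h1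
      · exact hinj _ _ h1
      · intro k _
        rw [h _ (by omega), map_zero]
    · exact h n hn

lemma isQE_of {V : Type*} [AddCommGroup V] [Module ℂ V] [FiniteDimensional ℂ V]
    (Λ : Finset ℂ) (m : ℕ) (g : ℂ → ℂ → V) (hg : ∀ Q, PolyV m (g Q)) (u0 : ℂ) :
    IsQE (fun u => ∑ Q ∈ Λ, Complex.exp (Complex.log Q * (u - u0)) • g Q (u - u0)) := by
  have h1 : ∀ Q, PolyV m (fun u => Complex.exp (- (Complex.log Q * u0)) • g Q (u + -u0)) :=
    fun Q => ((hg Q).shift (-u0)).smul _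
  choose v hv using fun Q => (h1 Q).explicit
  refine ⟨m, Λ.card, fun l => Complex.log (Λ.equivFin.symm l).1,
    fun l j => v (Λ.equivFin.symm l).1 j, fun u => ?_⟩
  rw [Equiv.sum_comp Λ.equivFin.symm (fun Q : Λ => ∑ j : Fin m,
    (Complex.exp (Complex.log Q.1 * u) * u ^ (j : ℕ)) • v Q.1 j),
    Finset.sum_coe_sort Λ (fun Q => ∑ j : Fin m,
    (Complex.exp (Complex.log Q * u) * u ^ (j : ℕ)) • v Q j)]
  refine Finset.sum_congr rfl fun Q _ => ?_
  simp only [mul_smul, ← Finset.smul_sum, ← hv]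
  rw [smul_smul, ← Complex.exp_add, ← sub_eq_add_neg u]
  congr 2
  ring

lemma conclude {V : Type*} [AddCommGroup V] [Module ℂ V] [FiniteDimensional ℂ V]
    {N : ℕ} {a : ℕ → ℂ → Module.End ℂ V} (ha : ∀ x, a N x = LinearMap.id)
    {q : ℂ[X]} (hq : RatC N a q) (hinj : ∀ (n : ℕ) v, a 0 n v = 0 → v = 0)
    (χ : ℂ[X]) (hχ : χ ≠ 0) (hk : ∀ f ∈ Sol N a, aeval (shiftS V) χ f = 0) (u0 : ℂ) :
    ∃ F : Fin (N * Module.finrank ℂ V) → ℂ → V, (∀ i, IsQE (F i)) ∧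
      (∀ i x, q.eval x ≠ 0 → ∑ k ∈ Finset.range (N + 1), a k x (F i (u0 + x + k)) = 0) ∧
      IndepPeriodic F := by
  classical
  have := Sol_finite N a ha
  let B := Module.finBasisOfFinrankEq ℂ (Sol N a) (Sol_finrank N a ha)
  choose n0 m g hg hfg using fun i => struct χ hχ (B i).1 (hk _ (B i).2)
  set Λ := χ.roots.toFinset.erase 0 with hΛ
  have h0 : (0 : ℂ) ∉ Λ := Finset.notMem_erase _ _
  have hne : ∀ Q ∈ Λ, Q ≠ 0 := fun Q hQ h => h0 (h ▸ hQ)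
  have hexp : ∀ Q ∈ Λ, ∀ (x : ℂ) (n : ℕ), Complex.exp (Complex.log Q * (x + n)) =
      Complex.exp (Complex.log Q * x) * Q ^ n := by
    intro Q hQ x n
    rw [mul_add, Complex.exp_add, mul_comm _ (n : ℂ), Complex.exp_nat_mul,
      Complex.exp_log (hne Q hQ)]
  refine ⟨fun i u => ∑ Q ∈ Λ, Complex.exp (Complex.log Q * (u - u0)) • g i Q (u - u0),
    fun i => isQE_of Λ (m i) (g i) (hg i) u0, ?_, ?_⟩
  · intro i x hx
    have hc := component hq Λ h0 (m i) (g i) (fun Q _ => hg i Q) (n0 i) (by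
      intro n hn
      have h1 := (B i).2 n
      rw [← h1]
      refine Finset.sum_congr rfl fun k _ => ?_
      rw [hfg i (n + k) (by omega)]
      push_cast
      rfl)
    have h2 : ∀ k : ℕ, a k x (∑ Q ∈ Λ, Complex.exp (Complex.log Q * (u0 + x + k - u0)) •
        g i Q (u0 + x + k - u0)) =
        ∑ Q ∈ Λ, Complex.exp (Complex.log Q * x) • a k x (Q ^ k • g i Q (x + k)) := by
      intro k
      rw [map_sum]
      refine Finset.sum_congr rfl fun Q hQ => ?_
      rw [show u0 + x + k - u0 = x + k by ring, hexp Q hQ, mul_smul, map_smul]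
    simp only [h2]
    rw [Finset.sum_comm]
    refine Finset.sum_eq_zero fun Q hQ => ?_
    rw [← Finset.smul_sum, hc Q hQ x hx, smul_zero]
  · apply indep_of_points
    intro y α hα
    have hz := key Λ h0 (fun Q x => Complex.exp (Complex.log Q * (y - u0)) •
      ∑ i, α i • g i Q (x + (y - u0))) ?_ 0 ?_
    · have hz2 : ∀ Q ∈ Λ, ∀ x, ∑ i, α i • g i Q x = 0 := by
        intro Q hQ x
        have := hz Q hQ (x - (y - u0))
        rw [smul_eq_zero] at this
        simpa using this.resolve_left (Complex.exp_ne_zero _)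
      have hs : (∑ i, α i • B i).1 = 0 := by
        refine Sol_eventually_zero hinj (∑ i, α i • B i).2 (Finset.univ.sup n0) fun n hn => ?_
        have hn' : ∀ i, n0 i ≤ n := fun i => (Finset.le_sup (Finset.mem_univ i)).trans hn
        have e1 : (∑ i, α i • B i).1 n = ∑ i, α i • (B i).1 n := by
          simp [Finset.sum_apply]
        rw [e1]
        simp only [fun i => hfg i n (hn' i), Finset.smul_sum]
        rw [Finset.sum_comm]
        refine Finset.sum_eq_zero fun Q hQ => ?_
        simp only [smul_comm _ (Q ^ n), ← Finset.smul_sum]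
        rw [hz2 Q hQ, smul_zero]
      exact Fintype.linearIndependent_iff.1 B.linearIndependent α (Subtype.ext hs)
    · intro Q _
      refine ⟨Finset.univ.sup m, PolyV.smul _ (PolyV.sum _ _ fun i _ => PolyV.smul _ ?_)⟩
      exact ((hg i Q).mono (Finset.le_sup (Finset.mem_univ i))).shift _
    · intro n _
      rw [← hα n]
      simp only [Finset.smul_sum]
      conv_rhs => rw [Finset.sum_comm]
      refine Finset.sum_congr rfl fun Q hQ => Finset.sum_congr rfl fun i _ => ?_
      rw [show y + n - u0 = (y - u0) + n by ring, hexp Q hQ, add_comm (n : ℂ)]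
      simp only [smul_smul]
      congr 1
      ring

lemma rat_aux {V : Type*} [AddCommGroup V] [Module ℂ V] (N : ℕ) (A : ℕ → ℂ → Module.End ℂ V)
    (hrat : ∀ k ≤ N, ∃ (P : Polynomial (Module.End ℂ V)) (q : Polynomial ℂ), q ≠ 0 ∧
        ∀ u : ℂ, q.eval u ≠ 0 → A k u = (q.eval u)⁻¹ • P.eval (u • (1 : Module.End ℂ V))) :
    ∃ q : ℂ[X], q ≠ 0 ∧ ∀ u0 : ℂ, (∀ n : ℕ, q.eval (u0 + N + n) ≠ 0) →
      RatC N (fun k x => A (N - k) (x + (u0 + N))) (q.comp (X + C (u0 + N))) := by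
  classical
  choose! P q hq hA using hrat
  refine ⟨∏ k ∈ Finset.range (N + 1), q k, Finset.prod_ne_zero_iff.2 fun k hk =>
    hq k (by have := Finset.mem_range.1 hk; omega), fun u0 hu0 => ⟨fun n => ?_, ?_⟩⟩
  · rw [eval_comp]
    simpa [add_comm] using hu0 n
  · intro k hk v φ
    have hmem : N - k ∈ Finset.range (N + 1) := Finset.mem_range.2 (by omega)
    let p : ℂ[X] := ∑ j ∈ Finset.range ((P (N - k)).natDegree + 1),
      C (φ ((P (N - k)).coeff j v)) * X ^ j
    have hp : ∀ u, φ ((P (N - k)).eval (u • (1 : Module.End ℂ V)) v) = p.eval u := by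
      intro u
      rw [eval_eq_sum_range, LinearMap.sum_apply, map_sum, eval_finsetSum]
      refine Finset.sum_congr rfl fun j _ => ?_
      rw [_root_.smul_pow, one_pow, mul_smul_comm, mul_one, LinearMap.smul_apply, map_smul,
        smul_eq_mul, eval_mul, eval_C, eval_pow, eval_X, mul_comm]
    refine ⟨((∏ j ∈ (Finset.range (N + 1)).erase (N - k), q j) * p).comp (X + C (u0 + N)),
      fun x hx => ?_⟩
    rw [eval_comp] at hx ⊢
    rw [eval_comp]
    simp only [eval_add, eval_X, eval_C] at hx ⊢
    rw [← Finset.mul_prod_erase _ _ hmem, eval_mul] at hx ⊢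
    have hx1 := left_ne_zero_of_mul hx
    rw [hA (N - k) (Nat.sub_le _ _) _ hx1, LinearMap.smul_apply, map_smul, hp, eval_mul,
      smul_eq_mul]
    field_simp

lemma inj_aux {V : Type*} [NormedAddCommGroup V] [NormedSpace ℂ V] [FiniteDimensional ℂ V]
    (A : ℂ → Module.End ℂ V) (L : Module.End ℂ V)
    (hlim : ∀ w : V, Tendsto (fun u => A u w) (Bornology.cobounded ℂ) (𝓝 (L w)))
    (hL : LinearMap.det L ≠ 0) :
    ∃ R : ℝ, ∀ u : ℂ, R ≤ ‖u‖ → ∀ v, A u v = 0 → v = 0 := by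
  classical
  let b := Module.finBasis ℂ V
  have h1 : Tendsto (fun u => LinearMap.toMatrix b b (A u)) (Bornology.cobounded ℂ)
      (𝓝 (LinearMap.toMatrix b b L)) := by
    refine tendsto_pi_nhds.2 fun i => tendsto_pi_nhds.2 fun j => ?_
    simp only [LinearMap.toMatrix_apply]
    exact ((LinearMap.continuous_of_finiteDimensional (b.coord i)).tendsto _).comp (hlim (b j))
  have h2 : Tendsto (fun u => (LinearMap.toMatrix b b (A u)).det) (Bornology.cobounded ℂ)
      (𝓝 (LinearMap.toMatrix b b L).det) :=
    ((continuous_id.matrix_det).tendsto (LinearMap.toMatrix b b L)).comp h1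
  simp only [LinearMap.det_toMatrix] at h2
  have h3 := h2.eventually_ne hL
  obtain ⟨R, _, hR⟩ := (hasBasis_cobounded_norm (E := ℂ)).eventually_iff.1 h3
  refine ⟨R, fun u hu v hv => ?_⟩
  have h4 := hR hu
  have h5 := (LinearMap.isUnit_iff_isUnit_det (A u)).2 (isUnit_iff_ne_zero.2 h4)
  exact ((Module.End.isUnit_iff _).1 h5).1 (by rw [hv, map_zero])

end Part6

/-- continuity principle for difference operators with quasi-exponential
kernel.  If `D_ε = ∑ A_k(u,ε) τ^{−k}` is a family of difference operators, rational in `u`,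
analytic in `ε ∈ [0,1)`, admissible at infinity for every `ε ∈ [0,1)`, whose kernel for
`ε ∈ (0,1)` is generated by quasi-exponentials of degree less than a fixed `m`, then the
kernel of `D_0` is generated by quasi-exponentials. -/
theorem statement_4
    (V : Type*) [NormedAddCommGroup V] [NormedSpace ℂ V] [FiniteDimensional ℂ V]
    (N : ℕ) (hN : 1 ≤ N)
    (A : ℕ → ℝ → ℂ → Module.End ℂ V)
    (hA0 : ∀ ε u, A 0 ε u = LinearMap.id)
    (hrat : ∀ k ≤ N, ∀ ε ∈ Set.Ico (0:ℝ) 1,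
      ∃ (P : Polynomial (Module.End ℂ V)) (q : Polynomial ℂ), q ≠ 0 ∧
        ∀ u : ℂ, q.eval u ≠ 0 → A k ε u = (q.eval u)⁻¹ • P.eval (u • (1 : Module.End ℂ V)))
    (han : ∀ k ≤ N, ∀ (u : ℂ) (w : V),
      AnalyticOn ℝ (fun ε : ℝ => A k ε u w) (Set.Ico 0 1))
    (L : ℕ → ℝ → Module.End ℂ V)
    (hL0 : ∀ ε, L 0 ε = LinearMap.id)
    (hlim : ∀ k ≤ N, ∀ ε ∈ Set.Ico (0:ℝ) 1, ∀ w : V,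
      Filter.Tendsto (fun u => A k ε u w) (Bornology.cobounded ℂ) (nhds (L k ε w)))
    (hadm : ∀ ε ∈ Set.Ico (0:ℝ) 1, LinearMap.det (L N ε) ≠ 0)
    (hgen : ∀ ε ∈ Set.Ioo (0:ℝ) 1, DiffKerGen N (fun k u => A k ε u) IsQE)
    (m : ℕ)
    (hdeg : ∀ ε ∈ Set.Ioo (0:ℝ) 1, DiffKerGen N (fun k u => A k ε u) (IsQEdeg m)) :
    DiffKerGen N (fun k u => A k 0 u) IsQE := by
  classical
  have hε : ∀ j : ℕ, (1 / ((j : ℝ) + 2)) ∈ Set.Ioo (0:ℝ) 1 := by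
    intro j
    have : (0 : ℝ) ≤ j := Nat.cast_nonneg j
    refine ⟨by positivity, ?_⟩
    rw [div_lt_one (by linarith)]
    linarith
  have hIco : ∀ j : ℕ, (1 / ((j : ℝ) + 2)) ∈ Set.Ico (0:ℝ) 1 :=
    fun j => ⟨(hε j).1.le, (hε j).2⟩
  have h0Ico : (0 : ℝ) ∈ Set.Ico (0:ℝ) 1 := ⟨le_rfl, one_pos⟩
  have hlimε : Filter.Tendsto (fun j : ℕ => (1 / ((j : ℝ) + 2))) Filter.atTop
      (nhdsWithin 0 (Set.Ico (0:ℝ) 1)) := by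
    refine tendsto_nhdsWithin_iff.2 ⟨?_, Filter.Eventually.of_forall hIco⟩
    have h1 := (Filter.tendsto_add_atTop_iff_nat (f := fun n : ℕ => (1 / (n : ℝ))) 2).2
      tendsto_one_div_atTop_nhds_zero_nat
    simpa using h1
  choose F S hF hker hind using fun j : ℕ => hdeg _ (hε j)
  choose Z Λ hZ hΛ hgenr using fun j : ℕ => generic m (F j) (hF j) (hind j)
  choose q hq0 hqR using fun j : ℕ =>
    rat_aux N (fun k u => A k (1 / ((j : ℝ) + 2)) u) (fun k hk => hrat k hk _ (hIco j))
  obtain ⟨q0, hq00, hq0R⟩ := rat_aux N (fun k u => A k 0 u) (fun k hk => hrat k hk _ h0Ico)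
  obtain ⟨R, hR⟩ := inj_aux (fun u => A N 0 u) (L N 0) (hlim N le_rfl 0 h0Ico) (hadm 0 h0Ico)
  have hfin : ∀ (T : Finset ℂ) (n : ℕ), {u : ℂ | u + N + n ∈ T}.Countable := by
    intro T n
    refine Set.Countable.mono (s₂ := (fun t : ℂ => t - n - N) '' (T : Set ℂ)) ?_
      (T.countable_toSet.image _)
    intro u hu
    exact ⟨u + N + n, hu, by ring⟩
  have hbad : ((⋃ j, Z j) ∪ (⋃ j, ⋃ n : ℕ, {u : ℂ | u + N + n ∈ S j}) ∪
      (⋃ j, ⋃ n : ℕ, {u : ℂ | u + N + n ∈ (q j).roots.toFinset}) ∪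
      (⋃ n : ℕ, {u : ℂ | u + N + n ∈ q0.roots.toFinset})).Countable :=
    (((Set.countable_iUnion hZ).union
      (Set.countable_iUnion fun j => Set.countable_iUnion fun n => hfin _ n)).union
      (Set.countable_iUnion fun j => Set.countable_iUnion fun n => hfin _ n)).union
      (Set.countable_iUnion fun n => hfin _ n)
  have hopen : IsOpen {u : ℂ | max R 0 < u.re} := isOpen_lt continuous_const Complex.continuous_re
  have hne : {u : ℂ | max R 0 < u.re}.Nonempty :=
    ⟨((max R 0 + 1 : ℝ) : ℂ), by
      show max R 0 < (((max R 0 + 1 : ℝ) : ℂ)).re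
      rw [Complex.ofReal_re]; linarith⟩
  obtain ⟨u0, hu0re, hu0⟩ := (hbad.dense_compl ℝ).inter_open_nonempty _ hopen hne
  simp only [Set.mem_compl_iff, Set.mem_union, Set.mem_iUnion, Set.mem_setOf_eq, not_or,
    not_exists] at hu0
  obtain ⟨⟨⟨hu1, hu2⟩, hu3⟩, hu4⟩ := hu0
  have hroot : ∀ (p : Polynomial ℂ), p ≠ 0 → ∀ x, x ∉ p.roots.toFinset → p.eval x ≠ 0 := by
    intro p hp x hx h
    exact hx (by rw [Multiset.mem_toFinset, Polynomial.mem_roots hp]; exact h)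
  -- the shifted coefficients
  have haN : ∀ ε : ℝ, ∀ x : ℂ, A (N - N) ε (x + (u0 + N)) = LinearMap.id := by
    intro ε x
    rw [Nat.sub_self, hA0]
  obtain ⟨χ, hχ, hk⟩ := limit_chi (N := N)
    (aj := fun j k x => A (N - k) (1 / ((j : ℝ) + 2)) (x + (u0 + N)))
    (a := fun k x => A (N - k) 0 (x + (u0 + N)))
    (fun k _ n v => ((han (N - k) (Nat.sub_le _ _) (n + (u0 + N)) v).continuousOn 0 h0Ico).tendsto.comp
      hlimε) (N * Module.finrank ℂ V * m) (by
    intro j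
    obtain ⟨hlin, g, hg, hFg⟩ := hgenr j u0 (hu1 j)
    obtain ⟨χ, h1, h2, h3⟩ := exists_chi
      (a := fun k x => A (N - k) (1 / ((j : ℝ) + 2)) (x + (u0 + N))) (haN _)
      (hqR j u0 (fun n => hroot _ (hq0 j) _ (hu3 j n))) (Λ j) (hΛ j) m
      (fun i n => F j i (u0 + n)) hlin (by
        intro i n
        have h := hker j i (u0 + N + n) (hu2 j n)
        rw [← Finset.sum_range_reflect] at h
        rw [← h]
        refine Finset.sum_congr rfl fun k hk => ?_
        have hk' : k ≤ N := Nat.lt_succ_iff.1 (Finset.mem_range.1 hk)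
        have e1 : N + 1 - 1 - k = N - k := by omega
        have e2 : (n : ℂ) + (u0 + N) = u0 + N + n := by ring
        have e3 : u0 + ((n + k : ℕ) : ℂ) = u0 + N + n - ((N - k : ℕ) : ℂ) := by
          rw [Nat.cast_sub hk']; push_cast; ring
        simp only [e1, e2, e3]) g (fun i Q _ => hg i Q) hFg
    exact ⟨χ, h1, h2, fun w => h3 _ (solOf_mem N _ (haN _) w)⟩)
  obtain ⟨G, hG1, hG2, hG3⟩ := conclude (a := fun k x => A (N - k) 0 (x + (u0 + N)))
    (haN _) (hq0R u0 (fun n => hroot _ hq00 _ (hu4 n))) (by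
      intro n v hv
      refine hR (n + (u0 + N)) ?_ v hv
      refine le_trans ?_ (Complex.re_le_norm _)
      have h1 : max R 0 < u0.re := hu0re
      have h2 := le_max_left R 0
      have h3 : (0 : ℝ) ≤ n := Nat.cast_nonneg n
      have h4 : (0 : ℝ) ≤ N := Nat.cast_nonneg N
      simp only [Complex.add_re, Complex.natCast_re]
      linarith) χ hχ (by
      intro f hf
      rw [Sol_eq_solOf (haN _) hf]
      exact hk _) u0
  refine ⟨G, q0.roots.toFinset, hG1, ?_, hG3⟩
  intro i u hu
  have h := hG2 i (u - (u0 + N)) (by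
    rw [Polynomial.eval_comp]
    simpa using hroot _ hq00 _ hu)
  rw [← Finset.sum_range_reflect] at h
  rw [← h]
  refine Finset.sum_congr rfl fun k hk => ?_
  have hk' : k ≤ N := Nat.lt_succ_iff.1 (Finset.mem_range.1 hk)
  have e1 : N - (N + 1 - 1 - k) = k := by omega
  have e2 : u - (u0 + N) + (u0 + N) = u := by ring
  have e3 : u0 + (u - (u0 + N)) + ((N + 1 - 1 - k : ℕ) : ℂ) = u - k := by
    rw [Nat.add_sub_cancel, Nat.cast_sub hk']; ring
  simp only [e1, e2, e3]
end
end
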